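/- Let μ be a log-concave probability measure on ℝⁿ that is β-strongly tilt-stable, i.e. the operator norm of the covariance matrix of (1/Z_{t,h}) μ e^{−t|x|² + h·x} is at most β² for all t > 0 and h ∈ ℝⁿ. Then ρ_LS(μ) ≤ 2β. -/

import Mathlib

open MeasureTheory Real
open scoped ENNReal NNReal RealInnerProductSpace

noncomputable section

abbrev Euc (n : ℕ) := EuclideanSpace ℝ (Fin n)

/-- Entropy of a nonnegative function with respect to a measure. -/
def ent {Ω : Type*} [MeasurableSpace Ω] (μ : Measure Ω) (g : Ω → ℝ) : ℝ :=
  (∫ x, g x * Real.log (g x) ∂μ) - (∫ x, g x ∂μ) * Real.log (∫ x, g x ∂μ)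

/-- μ satisfies the log-Sobolev inequality with constant ρ. -/
def SatisfiesLSI {n : ℕ} (μ : Measure (Euc n)) (ρ : ℝ) : Prop :=
  ∀ f : Euc n → ℝ, LocallyLipschitz f →
    Integrable (fun x => f x ^ 2) μ →
    Integrable (fun x => f x ^ 2 * Real.log (f x ^ 2)) μ →
    Integrable (fun x => ‖fderiv ℝ f x‖ ^ 2) μ →
    ent μ (fun x => f x ^ 2) ≤ 2 * ρ ^ 2 * ∫ x, ‖fderiv ℝ f x‖ ^ 2 ∂μ

/-- A measure is log-concave if it has a log-concave density wrt the Lebesgue measure. -/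
def IsLogConcave {V : Type*} [MeasureSpace V] [AddCommGroup V] [Module ℝ V] (μ : Measure V) : Prop :=
  ∃ d : V → ℝ, Measurable d ∧ (∀ x, 0 ≤ d x) ∧
    (∀ x y : V, ∀ a b : ℝ, 0 ≤ a → 0 ≤ b → a + b = 1 →
      d x ^ a * d y ^ b ≤ d (a • x + b • y)) ∧
    μ = volume.withDensity fun x => ENNReal.ofReal (d x)

/-- The ψ₂ (sub-gaussian) norm of `g` under `μ` is at most `t`. -/
def HasPsi2NormLE {Ω : Type*} [MeasurableSpace Ω] (μ : Measure Ω) (g : Ω → ℝ) (t : ℝ) : Prop :=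
  0 < t ∧ ∫ x, Real.exp (g x ^ 2 / t ^ 2) ∂μ ≤ 2

/-- The ψ₁ (sub-exponential) norm of `g` under `μ` is at most `K`. -/
def HasPsi1NormLE {Ω : Type*} [MeasurableSpace Ω] (μ : Measure Ω) (g : Ω → ℝ) (K : ℝ) : Prop :=
  0 < K ∧ ∫ x, Real.exp (|g x| / K) ∂μ ≤ 2

/-- The ψ₂ norm. -/
def psi2 {Ω : Type*} [MeasurableSpace Ω] (μ : Measure Ω) (g : Ω → ℝ) : ℝ :=
  sInf {t : ℝ | HasPsi2NormLE μ g t}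

/-- Barycenter. -/
def bary {n : ℕ} (μ : Measure (Euc n)) : Euc n := ∫ x, x ∂μ

/-- Exponential tilt. -/
def tilt {n : ℕ} (μ : Measure (Euc n)) (h : Euc n) : Measure (Euc n) :=
  (ENNReal.ofReal (∫ x, Real.exp ⟪h, x⟫ ∂μ))⁻¹ •
    μ.withDensity fun x => ENNReal.ofReal (Real.exp ⟪h, x⟫)

/-- Gaussian-tilted measure μ_{t,h}. -/
def gtilt {n : ℕ} (μ : Measure (Euc n)) (t : ℝ) (h : Euc n) : Measure (Euc n) :=
  (ENNReal.ofReal (∫ x, Real.exp (-t * ‖x‖ ^ 2 + ⟪h, x⟫) ∂μ))⁻¹ •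
    μ.withDensity fun x => ENNReal.ofReal (Real.exp (-t * ‖x‖ ^ 2 + ⟪h, x⟫))

/-- All exponential tilts of μ are well defined. -/
def TiltsWellDefined {n : ℕ} (μ : Measure (Euc n)) : Prop :=
  ∀ h : Euc n, Integrable (fun x => Real.exp ⟪h, x⟫) μ

/-- μ is β-tilt-stable: Cov(τ_h μ) ≼ β² Iₙ for all h. -/
def TiltStable {n : ℕ} (μ : Measure (Euc n)) (β : ℝ) : Prop :=
  ∀ h θ : Euc n, ‖θ‖ = 1 →
    ∫ x, ⟪x - bary (tilt μ h), θ⟫ ^ 2 ∂(tilt μ h) ≤ β ^ 2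

/-- μ is β-strongly tilt-stable. -/
def StronglyTiltStable {n : ℕ} (μ : Measure (Euc n)) (β : ℝ) : Prop :=
  ∀ t : ℝ, 0 < t → ∀ h θ : Euc n, ‖θ‖ = 1 →
    ∫ x, ⟪x - bary (gtilt μ t h), θ⟫ ^ 2 ∂(gtilt μ t h) ≤ β ^ 2

/-- Log-Sobolev constant. -/
def logSobolevConstant {n : ℕ} (μ : Measure (Euc n)) : ℝ :=
  sInf {ρ : ℝ | 0 < ρ ∧ SatisfiesLSI μ ρ}

section

open ProbabilityTheory Filter Topology
open scoped Convolution

variable {n : ℕ}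

/-- All exponential moments of the norm are finite. -/
def HasExpMoments {n : ℕ} (P : Measure (Euc n)) : Prop :=
  ∀ t : ℝ, Integrable (fun x => exp (t * ‖x‖)) P

/-- The relevant sub-Gaussian property: the centred measure has sub-Gaussian moment generating
function and covariance bounded by `C`. -/
structure IsSubG {n : ℕ} (P : Measure (Euc n)) (C : ℝ) : Prop where
  prob : IsProbabilityMeasure P
  expMoments : HasExpMoments P
  cov_le : ∀ θ : Euc n, ∫ x, ⟪θ, x - bary P⟫ ^ 2 ∂P ≤ C * ‖θ‖ ^ 2
  mgf_le : ∀ θ : Euc n, ∫ x, exp ⟪θ, x - bary P⟫ ∂P ≤ exp (C * ‖θ‖ ^ 2 / 2)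

theorem HasExpMoments.integrable {F : Type*} [NormedAddCommGroup F] {P : Measure (Euc n)}
    (hP : HasExpMoments P) {f : Euc n → F} (hf : AEStronglyMeasurable f P) (A t : ℝ)
    (h : ∀ x, ‖f x‖ ≤ A * exp (t * ‖x‖)) : Integrable f P :=
  ((hP t).const_mul A).mono' hf (Eventually.of_forall h)

theorem HasExpMoments.integrable_pow_mul {P : Measure (Euc n)} (hP : HasExpMoments P)
    {f : Euc n → ℝ} (hf : AEStronglyMeasurable f P) (A t : ℝ) (k : ℕ)
    (h : ∀ x, ‖f x‖ ≤ A * (1 + ‖x‖) ^ k * exp (t * ‖x‖)) : Integrable f P := by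
  refine hP.integrable hf (|A| * k.factorial * exp 1) (t + 1) fun x => (h x).trans ?_
  have h1 := pow_div_factorial_le_exp (1 + ‖x‖) (by positivity) k
  rw [div_le_iff₀ (by positivity)] at h1
  calc A * (1 + ‖x‖) ^ k * exp (t * ‖x‖) ≤ |A| * (exp (1 + ‖x‖) * k.factorial) * exp (t * ‖x‖) := by
        gcongr
        exact le_abs_self A
    _ = _ := by
        rw [add_mul, exp_add, exp_add, one_mul]; ring

theorem HasExpMoments.integrable_exp_inner {P : Measure (Euc n)} (hP : HasExpMoments P)
    (θ : Euc n) (c : ℝ) : Integrable (fun x => exp (⟪θ, x⟫ + c)) P := by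
  refine hP.integrable (by fun_prop) (exp c) ‖θ‖ fun x => ?_
  rw [norm_of_nonneg (exp_pos _).le, ← exp_add, exp_le_exp]
  linarith [real_inner_le_norm θ x]

theorem HasExpMoments.integrable_exp_inner_sub {P : Measure (Euc n)} (hP : HasExpMoments P)
    (θ m : Euc n) : Integrable (fun x => exp ⟪θ, x - m⟫) P := by
  simp only [inner_sub_right]
  exact hP.integrable_exp_inner θ (-⟪θ, m⟫)

theorem HasExpMoments.integrable_norm_sub_pow {P : Measure (Euc n)} (hP : HasExpMoments P)
    (m : Euc n) (k : ℕ) : Integrable (fun x => ‖x - m‖ ^ k) P := by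
  refine hP.integrable_pow_mul (by fun_prop) ((1 + ‖m‖) ^ k) 0 k fun x => ?_
  rw [norm_of_nonneg (by positivity), zero_mul, exp_zero, mul_one, ← mul_pow]
  gcongr
  nlinarith [norm_sub_le x m, norm_nonneg x, norm_nonneg m]

theorem HasExpMoments.integrable_id {P : Measure (Euc n)} (hP : HasExpMoments P) :
    Integrable (fun x : Euc n => x) P := by
  have := hP.integrable_norm_sub_pow 0 1
  simp only [sub_zero, pow_one] at this
  exact (integrable_norm_iff (by fun_prop)).1 this

theorem HasExpMoments.integral_inner_sub_bary {P : Measure (Euc n)} [IsProbabilityMeasure P]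
    (hP : HasExpMoments P) (θ : Euc n) : ∫ x, ⟪θ, x - bary P⟫ ∂P = 0 := by
  have h : Integrable (fun x => x - bary P) P := hP.integrable_id.sub (integrable_const _)
  rw [integral_inner h, integral_sub hP.integrable_id (integrable_const _)]
  simp [bary]

theorem HasExpMoments.integrable_inner_sub_pow {P : Measure (Euc n)}
    (hP : HasExpMoments P) (θ m : Euc n) (k : ℕ) : Integrable (fun x => ⟪θ, x - m⟫ ^ k) P := by
  refine ((hP.integrable_norm_sub_pow m k).const_mul (‖θ‖ ^ k)).mono' (by fun_prop)
    (Eventually.of_forall fun x => ?_)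
  rw [norm_pow, ← mul_pow]
  gcongr
  exact abs_real_inner_le_norm θ (x - m)

theorem tilted_add_const {Ω : Type*} [MeasurableSpace Ω] (P : Measure Ω)
    (f : Ω → ℝ) (c : ℝ) : P.tilted (fun x => f x + c) = P.tilted f := by
  by_cases hf : Integrable (fun x => exp (f x)) P
  · rcases eq_zero_or_neZero P with rfl | hP
    · simp
    have := isProbabilityMeasure_tilted hf
    rw [show (fun x => f x + c) = f + fun _ => c from rfl, ← tilted_tilted hf, tilted_const]
  · rw [tilted_of_not_integrable hf, tilted_of_not_integrable]
    simp only [exp_add]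
    intro h
    exact hf (by simpa [mul_assoc, ← exp_add] using h.mul_const (exp (-c)))

theorem HasExpMoments.tilted {P : Measure (Euc n)} [NeZero P] (hP : HasExpMoments P)
    {f : Euc n → ℝ} (hf : Measurable f) (a b : ℝ) (h : ∀ x, f x ≤ a + b * ‖x‖) :
    IsProbabilityMeasure (P.tilted f) ∧ HasExpMoments (P.tilted f) := by
  have h0 : Integrable (fun x => exp (f x)) P := by
    refine hP.integrable (by fun_prop) (exp a) b fun x => ?_
    rw [norm_of_nonneg (exp_pos _).le, ← exp_add, exp_le_exp]
    exact h x
  refine ⟨isProbabilityMeasure_tilted h0, fun t => ?_⟩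
  rw [integrable_tilted_iff h0]
  refine hP.integrable (by fun_prop) (exp a) (b + t) fun x => ?_
  rw [smul_eq_mul, ← exp_add, norm_of_nonneg (exp_pos _).le, ← exp_add, exp_le_exp]
  linarith [h x]

/-- Uniform covariance bounds for exponential tilts give sub-Gaussian tails. -/
theorem isSubG_of_tilted_cov_le {P : Measure (Euc n)} [IsProbabilityMeasure P]
    (hP : HasExpMoments P) {C : ℝ}
    (hC : ∀ k θ : Euc n, ‖θ‖ = 1 → ∫ x, ⟪θ, x - bary (P.tilted fun x => ⟪k, x⟫)⟫ ^ 2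
      ∂(P.tilted fun x => ⟪k, x⟫) ≤ C) : IsSubG P C := by
  refine ⟨inferInstance, hP, fun θ => ?_, fun θ => ?_⟩
  · rcases eq_or_ne θ 0 with rfl | hθ
    · simp
    have h1 := hC 0 ((‖θ‖)⁻¹ • θ) (by
      rw [norm_smul, norm_inv, norm_norm, inv_mul_cancel₀ (norm_ne_zero_iff.2 hθ)])
    simp only [inner_zero_left, tilted_const, real_inner_smul_left, mul_pow] at h1
    rw [integral_const_mul, inv_pow, inv_mul_le_iff₀ (by positivity)] at h1
    linarith
  · rcases eq_or_ne θ 0 with rfl | hθ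
    · simp
    have hθ' : 0 < ‖θ‖ := norm_pos_iff.2 hθ
    set e : Euc n := (‖θ‖)⁻¹ • θ with he
    have hen : ‖e‖ = 1 := by
      rw [he, norm_smul, norm_inv, norm_norm, inv_mul_cancel₀ hθ'.ne']
    set X : Euc n → ℝ := fun x => ⟪e, x - bary P⟫ with hX
    have hθX : ∀ x, ⟪θ, x - bary P⟫ = ‖θ‖ * X x := by
      intro x
      simp only [hX, he, real_inner_smul_left]
      field_simp
    have hi : ∀ u : ℝ, Integrable (fun x => exp (u * X x)) P := by
      intro u
      simpa [hX, real_inner_smul_left] using hP.integrable_exp_inner_sub (u • e) (bary P)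
    have hs : Set.Icc 0 ‖θ‖ ⊆ interior (integrableExpSet X P) := by
      have : integrableExpSet X P = Set.univ := Set.eq_univ_of_forall hi
      simp [this]
    have hc : P[X] = 0 := hP.integral_inner_sub_bary e
    obtain ⟨u, h1, h2⟩ := exists_cgf_eq_iteratedDeriv_two_cgf_mul hθ' hc hs
    have h3 : iteratedDeriv 2 (cgf X P) u ≤ C := by
      rw [← variance_tilted_mul (hs (Set.mem_Icc_of_Ioo h1))]
      have htl : P.tilted (fun x => u * X x) = P.tilted fun x => ⟪u • e, x⟫ := by
        rw [← tilted_add_const P (fun x => ⟪u • e, x⟫) (-(u * ⟪e, bary P⟫))]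
        congr 1
        ext x
        simp only [hX, real_inner_smul_left, inner_sub_right]
        ring
      rw [htl]
      obtain ⟨hp, hm⟩ := hP.tilted (f := fun x => ⟪u • e, x⟫) (by fun_prop) 0 ‖u • e‖
        (fun x => by linarith [real_inner_le_norm (u • e) x])
      refine le_trans (le_of_eq ?_) (hC (u • e) e hen)
      rw [variance_eq_integral (by fun_prop)]
      congr 1
      ext x
      congr 1
      have : ∀ y, X y = ⟪e, y⟫ - ⟪e, bary P⟫ := fun y => by simp [hX, inner_sub_right]
      simp only [this]
      have hie : Integrable (fun x : Euc n => ⟪e, x⟫) (P.tilted fun x => ⟪u • e, x⟫) :=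
        (innerSL ℝ e).integrable_comp hm.integrable_id
      rw [integral_sub hie (integrable_const _), integral_inner hm.integrable_id]
      simp [inner_sub_right, bary]
    calc ∫ x, exp ⟪θ, x - bary P⟫ ∂P = mgf X P ‖θ‖ := by simp only [hθX, mgf]
      _ ≤ _ := by
        rw [← exp_cgf (hi _), exp_le_exp, h2]
        gcongr

theorem IsSubG.integral_norm_sub_sq_le {P : Measure (Euc n)} {C : ℝ} (hP : IsSubG P C) :
    ∫ x, ‖x - bary P‖ ^ 2 ∂P ≤ n * C := by
  have h (x : Euc n) : ‖x - bary P‖ ^ 2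
      = ∑ i : Fin n, ⟪EuclideanSpace.single i (1 : ℝ), x - bary P⟫ ^ 2 := by
    rw [EuclideanSpace.norm_sq_eq]
    simp [EuclideanSpace.inner_single_left]
  simp only [h]
  rw [integral_finsetSum _ fun i _ => hP.expMoments.integrable_inner_sub_pow _ _ 2]
  refine (Finset.sum_le_sum fun i _ => hP.cov_le _).trans (le_of_eq ?_)
  simp

theorem pow_four_le_exp_add (y : ℝ) : y ^ 4 ≤ 24 * (exp y + exp (-y)) := by
  have h := pow_div_factorial_le_exp |y| (abs_nonneg y) 4
  have h2 : exp |y| ≤ exp y + exp (-y) := by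
    rcases abs_cases y with ⟨h, _⟩ | ⟨h, _⟩ <;> rw [h] <;> linarith [exp_pos y, exp_pos (-y)]
  rw [div_le_iff₀ (by positivity)] at h
  have h3 : |y| ^ 4 = y ^ 4 := by rw [pow_abs, abs_of_nonneg (by positivity)]
  simp only [Nat.factorial] at h
  push_cast at h
  linarith

theorem IsSubG.integral_norm_sub_pow_four_le {P : Measure (Euc n)} {C : ℝ} (hP : IsSubG P C)
    (hC : 0 < C) : ∫ x, ‖x - bary P‖ ^ 4 ∂P ≤ 96 * n ^ 2 * C ^ 2 := by
  have hs : 0 < √C := sqrt_pos.2 hC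
  have hs2 : √C ^ 2 = C := sq_sqrt hC.le
  have hs4 : √C ^ 4 = C ^ 2 := by linear_combination (√C ^ 2 + C) * hs2
  have hP' := hP.prob
  set e : Fin n → Euc n := fun i => EuclideanSpace.single i (1 : ℝ) with he
  have key (i : Fin n) : ∫ x, ⟪e i, x - bary P⟫ ^ 4 ∂P ≤ 96 * C ^ 2 := by
    have hb (σ : ℝ) (hσ : σ ^ 2 = 1) : ∫ x, exp ⟪(σ * (√C)⁻¹) • e i, x - bary P⟫ ∂P ≤ 2 := by
      refine (hP.mgf_le _).trans ?_
      have : C * ‖(σ * (√C)⁻¹) • e i‖ ^ 2 / 2 = 1 / 2 := by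
        rw [norm_smul, mul_pow, norm_eq_abs, sq_abs, mul_pow, hσ, inv_pow, hs2]
        simp [he]
        field_simp
      rw [this]
      have h1 : exp (1 / 2) ^ 2 = exp 1 := by rw [← exp_nat_mul]; norm_num
      nlinarith [exp_one_lt_d9, exp_pos (1 / 2)]
    have hint (σ : ℝ) : Integrable (fun x => exp ⟪(σ * (√C)⁻¹) • e i, x - bary P⟫) P :=
      hP.expMoments.integrable_exp_inner_sub _ _
    calc ∫ x, ⟪e i, x - bary P⟫ ^ 4 ∂P
        ≤ ∫ x, 24 * C ^ 2 * (exp ⟪((1 : ℝ) * (√C)⁻¹) • e i, x - bary P⟫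
          + exp ⟪((-1 : ℝ) * (√C)⁻¹) • e i, x - bary P⟫) ∂P := by
          refine integral_mono (hP.expMoments.integrable_inner_sub_pow _ _ 4)
            (((hint 1).add (hint (-1))).const_mul _) fun x => ?_
          have h := pow_four_le_exp_add ((√C)⁻¹ * ⟪e i, x - bary P⟫)
          simp only [real_inner_smul_left, one_mul, neg_mul]
          rw [mul_pow, inv_pow, hs4, inv_mul_le_iff₀ (by positivity)] at h
          linarith
      _ ≤ _ := by
          rw [integral_const_mul, integral_add (hint 1) (hint (-1))]
          nlinarith [hb 1 (by norm_num), hb (-1) (by norm_num), sq_nonneg C]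
  have h (x : Euc n) : ‖x - bary P‖ ^ 4 ≤ n * ∑ i : Fin n, ⟪e i, x - bary P⟫ ^ 4 := by
    have h1 : ‖x - bary P‖ ^ 2 = ∑ i : Fin n, ⟪e i, x - bary P⟫ ^ 2 := by
      rw [EuclideanSpace.norm_sq_eq]
      simp [he, EuclideanSpace.inner_single_left]
    have h2 := sq_sum_le_card_mul_sum_sq (s := Finset.univ)
      (f := fun i : Fin n => ⟪e i, x - bary P⟫ ^ 2)
    rw [← h1] at h2
    simp only [← pow_mul, Finset.card_univ, Fintype.card_fin] at h2
    exact h2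
  have hi4 (i : Fin n) := hP.expMoments.integrable_inner_sub_pow (e i) (bary P) 4
  calc ∫ x, ‖x - bary P‖ ^ 4 ∂P ≤ ∫ x, n * ∑ i : Fin n, ⟪e i, x - bary P⟫ ^ 4 ∂P :=
        integral_mono (hP.expMoments.integrable_norm_sub_pow _ 4)
          ((integrable_finsetSum _ fun i _ => hi4 i).const_mul _) h
    _ = n * ∑ i : Fin n, ∫ x, ⟪e i, x - bary P⟫ ^ 4 ∂P := by
        rw [integral_const_mul, integral_finsetSum _ fun i _ => hi4 i]
    _ ≤ n * ∑ i : Fin n, 96 * C ^ 2 := by gcongr with i; exact key i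
    _ = _ := by simp; ring

theorem integrable_of_mem_Icc {P : Measure (Euc n)} [IsFiniteMeasure P] {g : Euc n → ℝ}
    (hg : Measurable g) {c D : ℝ} (h : ∀ x, g x ∈ Set.Icc c D) : Integrable g P :=
  Integrable.of_mem_Icc c D hg.aemeasurable (Eventually.of_forall h)

theorem abs_mul_log_le {c D y : ℝ} (hc : 0 < c) (h : y ∈ Set.Icc c D) :
    |y * log y| ≤ D * (|log c| + |log D|) := by
  have hy : 0 < y := hc.trans_le h.1
  rw [abs_mul, abs_of_pos hy]
  have h1 : log c ≤ log y := log_le_log hc h.1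
  have h2 : log y ≤ log D := log_le_log hy h.2
  have : |log y| ≤ |log c| + |log D| := by
    rw [abs_le]
    constructor
    · linarith [neg_abs_le (log c), abs_nonneg (log D)]
    · linarith [le_abs_self (log D), abs_nonneg (log c)]
  exact mul_le_mul h.2 this (abs_nonneg _) (hy.le.trans h.2)

theorem integrable_mul_log {P : Measure (Euc n)} [IsFiniteMeasure P] {g : Euc n → ℝ}
    (hg : Measurable g) {c D : ℝ} (hc : 0 < c) (h : ∀ x, g x ∈ Set.Icc c D) :
    Integrable (fun x => g x * log (g x)) P :=
  Integrable.of_bound (by fun_prop) (D * (|log c| + |log D|))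
    (Eventually.of_forall fun x => abs_mul_log_le hc (h x))

theorem integral_mem_Icc {P : Measure (Euc n)} [IsProbabilityMeasure P] {g : Euc n → ℝ}
    (hg : Measurable g) {c D : ℝ} (h : ∀ x, g x ∈ Set.Icc c D) : ∫ x, g x ∂P ∈ Set.Icc c D := by
  have hi := integrable_of_mem_Icc (P := P) hg h
  constructor
  · simpa using integral_mono (integrable_const c) hi fun x => (h x).1
  · simpa using integral_mono hi (integrable_const D) fun x => (h x).2

/-- Entropic stability: the displacement of the mean is controlled by the entropy. -/
theorem IsSubG.sq_integral_mul_inner_le {P : Measure (Euc n)} {C : ℝ} (hP : IsSubG P C)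
    {g : Euc n → ℝ} (hg : Measurable g) {c D : ℝ} (hc : 0 < c) (h : ∀ x, g x ∈ Set.Icc c D)
    (k : Euc n) :
    (∫ x, g x * ⟪k, x - bary P⟫ ∂P) ^ 2 ≤ 2 * C * ‖k‖ ^ 2 * (∫ x, g x ∂P) * ent P g := by
  have hP' := hP.prob
  set M := ∫ x, g x ∂P with hM
  have hMpos : 0 < M := hc.trans_le (integral_mem_Icc hg h).1
  set b := ∫ x, g x * ⟪k, x - bary P⟫ ∂P with hb
  have hgi := integrable_of_mem_Icc (P := P) hg h
  have hgl := integrable_mul_log (P := P) hg hc h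
  have hgY : Integrable (fun x => g x * ⟪k, x - bary P⟫) P := by
    have h1 := hP.expMoments.integrable_inner_sub_pow k (bary P) 1
    simp only [pow_one] at h1
    refine h1.bdd_mul (c := max |c| |D|) hg.aestronglyMeasurable (Eventually.of_forall fun x => ?_)
    exact abs_le_max_abs_abs (h x).1 (h x).2
  have key (l : ℝ) : 0 ≤ (M * C * ‖k‖ ^ 2 / 2) * (l * l) + (-b) * l + ent P g := by
    set Λ := C * ‖l • k‖ ^ 2 / 2 with hΛ
    have hexp : Integrable (fun x => exp (⟪l • k, x - bary P⟫ - Λ)) P := by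
      simp only [exp_sub]
      exact (hP.expMoments.integrable_exp_inner_sub _ _).div_const _
    have hexp1 : ∫ x, exp (⟪l • k, x - bary P⟫ - Λ) ∂P ≤ 1 := by
      simp only [exp_sub]
      rw [integral_div, div_le_one (exp_pos _)]
      exact hP.mgf_le _
    have hpt (x : Euc n) : l * (g x * ⟪k, x - bary P⟫) - Λ * g x
        ≤ g x * log (g x) - log M * g x - g x + M * exp (⟪l • k, x - bary P⟫ - Λ) := by
      have hgx : 0 < g x := hc.trans_le (h x).1
      have h1 := add_one_le_exp (⟪l • k, x - bary P⟫ - Λ - log (g x / M))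
      rw [exp_sub _ (log _), exp_log (by positivity), log_div hgx.ne' hMpos.ne'] at h1
      have h2 := mul_le_mul_of_nonneg_left h1 hgx.le
      have h3 : g x * (exp (⟪l • k, x - bary P⟫ - Λ) / (g x / M))
          = M * exp (⟪l • k, x - bary P⟫ - Λ) := by field_simp
      rw [h3, real_inner_smul_left] at h2
      rw [real_inner_smul_left]
      linarith
    have hA1 : Integrable (fun x => g x * log (g x) - log M * g x) P :=
      hgl.sub (hgi.const_mul (log M))
    have hA2 : Integrable (fun x => g x * log (g x) - log M * g x - g x) P := hA1.sub hgi
    have hint := integral_mono ((hgY.const_mul l).sub (hgi.const_mul Λ))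
      (hA2.add (hexp.const_mul M)) hpt
    simp only [Pi.sub_apply, Pi.add_apply] at hint
    rw [integral_sub (hgY.const_mul l) (hgi.const_mul Λ), integral_add hA2 (hexp.const_mul M),
      integral_sub hA1 hgi, integral_sub hgl (hgi.const_mul (log M)),
      integral_const_mul, integral_const_mul, integral_const_mul, integral_const_mul,
      ← hM, ← hb] at hint
    have h4 : Λ = C * ‖k‖ ^ 2 / 2 * (l * l) := by
      rw [hΛ, norm_smul, mul_pow, norm_eq_abs, sq_abs]; ring
    have h5 : M * ∫ x, exp (⟪l • k, x - bary P⟫ - Λ) ∂P ≤ M * 1 := by gcongr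
    rw [ent, ← hM]
    rw [h4] at hint h5
    nlinarith
  have := discrim_le_zero key
  rw [discrim] at this
  linarith

/-- Bounded functions have tilted means that depend in a Lipschitz way on the tilt. -/
theorem IsSubG.abs_integral_tilted_sub_le {Q : Measure (Euc n)} {B : ℝ} (hQ : IsSubG Q B)
    (hB : 0 < B) {g : Euc n → ℝ} (hg : Measurable g) {D : ℝ} (h : ∀ x, |g x| ≤ D) (k : Euc n) :
    |∫ x, g x ∂(Q.tilted fun x => ⟪k, x⟫) - ∫ x, g x ∂Q| ≤ 4 * D * √B * ‖k‖ := by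
  have hQ' := hQ.prob
  have hD : 0 ≤ D := (abs_nonneg _).trans (h 0)
  rcases eq_or_ne k 0 with rfl | hk
  · simp
  have hk' : 0 < ‖k‖ := norm_pos_iff.2 hk
  have htl : Q.tilted (fun x => ⟪k, x⟫) = Q.tilted fun x => ⟪k, x - bary Q⟫ := by
    rw [← tilted_add_const Q (fun x => ⟪k, x⟫) (-⟪k, bary Q⟫)]
    congr 1
    ext x
    rw [inner_sub_right]; ring
  rw [htl]
  set Y : Euc n → ℝ := fun x => ⟪k, x - bary Q⟫ with hY
  have hYi : Integrable (fun x => exp (Y x)) Q := hQ.expMoments.integrable_exp_inner_sub _ _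
  have hYp := isProbabilityMeasure_tilted hYi
  have hgi (ν : Measure (Euc n)) [IsProbabilityMeasure ν] : Integrable g ν :=
    Integrable.of_bound hg.aestronglyMeasurable D (Eventually.of_forall h)
  have hgb (ν : Measure (Euc n)) [IsProbabilityMeasure ν] : |∫ x, g x ∂ν| ≤ D := by
    simpa using norm_integral_le_of_norm_le_const (μ := ν) (f := g) (Eventually.of_forall h)
  set ε := 2 * √B * ‖k‖ with hε
  have hεp : 0 < ε := by positivity
  have hε2 : ε ^ 2 = 4 * (B * ‖k‖ ^ 2) := by rw [hε, mul_pow, mul_pow, sq_sqrt hB.le]; ring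
  suffices H : |∫ x, g x ∂(Q.tilted Y) - ∫ x, g x ∂Q| ≤ 2 * D * ε by rw [hε] at H; linarith
  rcases le_or_gt 1 ε with h1 | h1
  · calc _ ≤ |∫ x, g x ∂(Q.tilted Y)| + |∫ x, g x ∂Q| := abs_sub _ _
      _ ≤ D + D := add_le_add (hgb _) (hgb _)
      _ ≤ 2 * D * ε := by nlinarith
  set Z := ∫ x, exp (Y x) ∂Q with hZ
  have hZ1 : 1 ≤ Z := by
    have h0 := hQ.expMoments.integral_inner_sub_bary k
    have hi := hQ.expMoments.integrable_inner_sub_pow k (bary Q) 1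
    simp only [pow_one] at hi
    have := integral_mono (hi.add (integrable_const 1)) hYi fun x => add_one_le_exp (Y x)
    simp only [Pi.add_apply] at this
    rw [integral_add hi (integrable_const 1), h0] at this
    simpa using this
  set ρ : Euc n → ℝ := fun x => exp (Y x) / Z with hρ
  have hρi : Integrable ρ Q := hYi.div_const Z
  have hρ1 : ∫ x, ρ x ∂Q = 1 := by
    rw [integral_div, ← hZ, div_self (by positivity)]
  have hsq (x : Euc n) : ρ x ^ 2 = exp ⟪(2 : ℝ) • k, x - bary Q⟫ / Z ^ 2 := by
    simp only [hρ, hY, div_pow, ← exp_nat_mul, real_inner_smul_left]; norm_num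
  have hρ2i : Integrable (fun x => ρ x ^ 2) Q := by
    simp only [hsq]
    exact (hQ.expMoments.integrable_exp_inner_sub _ _).div_const _
  have hρ2 : ∫ x, ρ x ^ 2 ∂Q ≤ 1 + ε ^ 2 := by
    simp only [hsq]
    rw [integral_div]
    refine (div_le_self (integral_nonneg fun _ => (exp_pos _).le) (by nlinarith)).trans ?_
    refine (hQ.mgf_le _).trans ?_
    rw [norm_smul, mul_pow]
    have h2 : B * (‖(2 : ℝ)‖ ^ 2 * ‖k‖ ^ 2) / 2 = ε ^ 2 / 2 := by rw [hε2]; norm_num; ring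
    rw [h2]
    have h3 := abs_exp_sub_one_sub_id_le (x := ε ^ 2 / 2) (by rw [abs_le]; constructor <;> nlinarith)
    rw [abs_le] at h3
    have h4 : ε ^ 2 ≤ 1 := by nlinarith
    have h5 : (ε ^ 2 / 2) ^ 2 ≤ ε ^ 2 / 2 := by nlinarith [sq_nonneg ε]
    linarith [h3.2]
  have habs : ∫ x, |ρ x - 1| ∂Q ≤ ε := by
    have hpt (x : Euc n) : |ρ x - 1| ≤ ε / 2 + (2 * ε)⁻¹ * (ρ x ^ 2 - 2 * ρ x + 1) := by
      have h4 : ρ x ^ 2 - 2 * ρ x + 1 = |ρ x - 1| ^ 2 := by rw [sq_abs]; ring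
      rw [h4, ← sub_nonneg]
      have : ε / 2 + (2 * ε)⁻¹ * |ρ x - 1| ^ 2 - |ρ x - 1| = (2 * ε)⁻¹ * (|ρ x - 1| - ε) ^ 2 := by
        field_simp; ring
      rw [this]; positivity
    have hi3 : Integrable (fun x => ρ x ^ 2 - 2 * ρ x) Q := hρ2i.sub (hρi.const_mul 2)
    have hi2 : Integrable (fun x => ρ x ^ 2 - 2 * ρ x + 1) Q :=
      hi3.add (integrable_const 1)
    have hi1 := (integrable_const (ε / 2)).add (hi2.const_mul (2 * ε)⁻¹)
    have := integral_mono (hρi.sub (integrable_const 1)).abs hi1 hpt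
    refine this.trans ?_
    simp only [Pi.add_apply]
    rw [integral_add (integrable_const _) (hi2.const_mul _), integral_const_mul,
      integral_add hi3 (integrable_const 1),
      integral_sub hρ2i (hρi.const_mul 2), integral_const_mul, hρ1]
    simp only [integral_const, probReal_univ, smul_eq_mul, one_mul]
    have : (2 * ε)⁻¹ * (∫ x, ρ x ^ 2 ∂Q - 2 * 1 + 1) ≤ (2 * ε)⁻¹ * ε ^ 2 := by
      gcongr; linarith
    have h5 : (2 * ε)⁻¹ * ε ^ 2 = ε / 2 := by field_simp
    linarith
  have heq : ∫ x, g x ∂(Q.tilted Y) - ∫ x, g x ∂Q = ∫ x, g x * (ρ x - 1) ∂Q := by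
    rw [integral_tilted, ← integral_sub]
    · congr 1; ext x; simp only [hρ, smul_eq_mul]; ring
    · simp only [smul_eq_mul]
      exact (hρi.mul_bdd (c := D) hg.aestronglyMeasurable (Eventually.of_forall h))
    · exact hgi Q
  rw [heq]
  calc |∫ x, g x * (ρ x - 1) ∂Q| ≤ ∫ x, |g x * (ρ x - 1)| ∂Q := abs_integral_le_integral_abs
    _ ≤ ∫ x, D * |ρ x - 1| ∂Q := by
        refine integral_mono ?_ ((hρi.sub (integrable_const 1)).abs.const_mul D) fun x => ?_
        · exact ((hρi.sub (integrable_const 1)).bdd_mul (c := D) hg.aestronglyMeasurable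
            (Eventually.of_forall h)).abs
        · simp only [abs_mul]
          gcongr
          exact h x
    _ ≤ D * ε := by rw [integral_const_mul]; gcongr
    _ ≤ 2 * D * ε := by nlinarith

theorem hasExpMoments_stdGaussian : HasExpMoments (stdGaussian (Euc n)) := by
  intro t
  obtain ⟨C, hC, h⟩ := IsGaussian.exists_integrable_exp_sq (stdGaussian (Euc n))
  refine (h.const_mul (exp (t ^ 2 / (4 * C)))).mono' (by fun_prop) (Eventually.of_forall fun x => ?_)
  rw [norm_of_nonneg (exp_pos _).le, ← exp_add, exp_le_exp, ← sub_nonneg]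
  have : t ^ 2 / (4 * C) + C * ‖x‖ ^ 2 - t * ‖x‖ = (t - 2 * C * ‖x‖) ^ 2 / (4 * C) := by
    field_simp; ring
  rw [this]; positivity

theorem map_inner_stdGaussian (a : Euc n) :
    (stdGaussian (Euc n)).map (fun z => ⟪a, z⟫) = gaussianReal 0 (‖a‖ ^ 2).toNNReal := by
  have h := IsGaussian.map_eq_gaussianReal (μ := stdGaussian (Euc n)) (innerSL ℝ a)
  rw [variance_dual_stdGaussian, integral_strongDual_stdGaussian, innerSL_apply_norm] at h
  exact h

theorem integral_inner_sq_stdGaussian (a : Euc n) :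
    ∫ z, ⟪a, z⟫ ^ 2 ∂(stdGaussian (Euc n)) = ‖a‖ ^ 2 := by
  have h := variance_dual_stdGaussian (E := Euc n) (innerSL ℝ a)
  rw [variance_of_integral_eq_zero (by fun_prop) (integral_strongDual_stdGaussian _),
    innerSL_apply_norm] at h
  exact h

theorem integrable_exp_inner_stdGaussian (a : Euc n) (c : ℝ) :
    Integrable (fun z => exp (⟪a, z⟫ + c)) (stdGaussian (Euc n)) :=
  hasExpMoments_stdGaussian.integrable_exp_inner a c

theorem integral_exp_inner_stdGaussian (a : Euc n) :
    ∫ z, exp (⟪a, z⟫ - ‖a‖ ^ 2 / 2) ∂(stdGaussian (Euc n)) = 1 := by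
  have h := mgf_gaussianReal (map_inner_stdGaussian a) 1
  rw [mgf] at h
  simp only [one_mul] at h
  simp only [exp_sub]
  rw [integral_div, h, coe_toNNReal _ (by positivity)]
  simp

theorem one_add_mul_log_le {y : ℝ} (hy : -1 < y) :
    (1 + y) * log (1 + y) ≤ y + y ^ 2 / 2 + 4 * |y| ^ 3 := by
  have hy' : 0 < 1 + y := by linarith
  have hcube : |y| ^ 3 = |y| * y ^ 2 := by rw [← sq_abs y]; ring
  rcases le_or_gt |y| (1 / 2) with h | h
  · have h1 := abs_log_sub_add_sum_range_le (x := -y) (by rw [abs_neg]; linarith) 2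
    simp only [Finset.sum_range_succ, Finset.sum_range_zero, abs_neg, sub_neg_eq_add] at h1
    norm_num at h1
    have h2 : |y| ^ 3 / (1 - |y|) ≤ 2 * |y| ^ 3 := by
      rw [div_le_iff₀ (by linarith)]
      nlinarith [pow_nonneg (abs_nonneg y) 3]
    have h3 : log (1 + y) ≤ y - y ^ 2 / 2 + 2 * |y| ^ 3 := by
      linarith [le_abs_self (-y + y ^ 2 / 2 + log (1 + y))]
    have h4 := mul_le_mul_of_nonneg_left h3 hy'.le
    have h5 : -y ^ 3 ≤ |y| ^ 3 := by rw [← abs_pow]; exact neg_le_abs _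
    have h6 : y * |y| ^ 3 ≤ 1 / 2 * |y| ^ 3 := by
      gcongr
      exact (le_abs_self y).trans h
    nlinarith [pow_nonneg (abs_nonneg y) 3]
  · have h1 := log_le_sub_one_of_pos hy'
    have h2 := mul_le_mul_of_nonneg_left h1 hy'.le
    have : 1 / 2 * y ^ 2 ≤ |y| ^ 3 := by rw [hcube]; gcongr
    nlinarith [sq_nonneg y]

theorem mul_log_le_taylor {t M : ℝ} (ht : 0 < t) (hM : 0 < M) :
    t * log t ≤ M * log M + (t - M) * (1 + log M) + (t - M) ^ 2 / (2 * M)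
      + 4 * |t - M| ^ 3 / M ^ 2 := by
  have h := one_add_mul_log_le (y := (t - M) / M) (by rw [lt_div_iff₀ hM]; linarith)
  have h1 : 1 + (t - M) / M = t / M := by field_simp; ring
  rw [h1, log_div ht.ne' hM.ne', abs_div, abs_of_pos hM] at h
  have h2 := mul_le_mul_of_nonneg_left h hM.le
  have h3 : M * (t / M * (log t - log M)) = t * log t - t * log M := by field_simp
  have h4 : M * ((t - M) / M + ((t - M) / M) ^ 2 / 2 + 4 * (|t - M| / M) ^ 3)
      = (t - M) + (t - M) ^ 2 / (2 * M) + 4 * |t - M| ^ 3 / M ^ 2 := by field_simp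
  rw [h3, h4] at h2
  linarith

theorem abs_exp_sub_one_sub_le (y : ℝ) : |exp y - 1 - y| ≤ y ^ 2 * exp |y| := by
  have h1 : 0 ≤ exp y - 1 - y := by linarith [add_one_le_exp y]
  rw [abs_of_nonneg h1]
  have h2 : 1 ≤ exp |y| := one_le_exp (abs_nonneg y)
  have h3 := add_one_le_exp (-y)
  have h4 : exp y * exp (-y) = 1 := by rw [← exp_add]; simp
  have h5 : exp y - 1 ≤ y * exp y := by nlinarith [exp_pos y]
  rcases le_total 0 y with hy | hy
  · rw [abs_of_nonneg hy]
    nlinarith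
  · have h6 : 1 - y ≤ exp |y| := by rw [abs_of_nonpos hy]; linarith
    have h7 : exp y * (1 - y) ≤ 1 := by nlinarith [exp_pos y]
    have h8 : exp y ≤ 1 := by rw [exp_le_one_iff]; exact hy
    -- `exp y - 1 - y ≤ y * exp y - y = y * (exp y - 1) ≤ y ^ 2`
    have h9 : y * (exp y - 1) ≤ y * y := by
      apply mul_le_mul_of_nonpos_left _ hy
      linarith [add_one_le_exp y]
    nlinarith [sq_nonneg y]

/-- The exponent of one step of the localization process with pinned barycentre. -/
def locExp {n : ℕ} (m : Euc n) (r : ℝ) (z x : Euc n) : ℝ :=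
  r * ⟪x - m, z⟫ - r ^ 2 * ‖x - m‖ ^ 2 / 2

theorem locExp_eq (m : Euc n) (r : ℝ) (z x : Euc n) :
    locExp m r z x = ⟪r • (x - m), z⟫ - ‖r • (x - m)‖ ^ 2 / 2 := by
  rw [locExp, norm_smul, real_inner_smul_left, mul_pow, norm_eq_abs, sq_abs]

@[fun_prop]
theorem continuous_locExp (m : Euc n) (r : ℝ) :
    Continuous fun q : Euc n × Euc n => locExp m r q.2 q.1 := by
  unfold locExp; fun_prop

@[fun_prop]
theorem continuous_locExp_right (m : Euc n) (r : ℝ) (z : Euc n) :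
    Continuous fun x : Euc n => locExp m r z x := by
  unfold locExp; fun_prop

theorem integral_exp_locExp (m : Euc n) (r : ℝ) (x : Euc n) :
    ∫ z, exp (locExp m r z x) ∂(stdGaussian (Euc n)) = 1 := by
  simp only [locExp_eq]
  exact integral_exp_inner_stdGaussian _

theorem integrable_exp_locExp_prod (P : Measure (Euc n)) [IsProbabilityMeasure P] (m : Euc n)
    (r : ℝ) : Integrable (fun q : Euc n × Euc n => exp (locExp m r q.2 q.1))
      (P.prod (stdGaussian (Euc n))) := by
  rw [integrable_prod_iff (continuous_locExp m r).rexp.aestronglyMeasurable]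
  constructor
  · refine Eventually.of_forall fun x => ?_
    simp only [locExp_eq, sub_eq_add_neg]
    exact integrable_exp_inner_stdGaussian _ _
  · simp only [norm_of_nonneg (exp_pos _).le, integral_exp_locExp]
    exact integrable_const _

theorem integrable_mul_exp_locExp_prod (P : Measure (Euc n)) [IsProbabilityMeasure P] (m : Euc n)
    (r : ℝ) {φ : Euc n → ℝ} (hφ : Measurable φ) {D : ℝ} (h : ∀ x, |φ x| ≤ D) :
    Integrable (fun q : Euc n × Euc n => φ q.1 * exp (locExp m r q.2 q.1))
      (P.prod (stdGaussian (Euc n))) :=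
  (integrable_exp_locExp_prod P m r).bdd_mul (c := D)
    (hφ.comp measurable_fst).aestronglyMeasurable (Eventually.of_forall fun q => h q.1)

theorem integrable_integral_mul_exp_locExp (P : Measure (Euc n)) [IsProbabilityMeasure P]
    (m : Euc n) (r : ℝ) {φ : Euc n → ℝ} (hφ : Measurable φ) {D : ℝ} (h : ∀ x, |φ x| ≤ D) :
    Integrable (fun z => ∫ x, φ x * exp (locExp m r z x) ∂P) (stdGaussian (Euc n)) :=
  (integrable_mul_exp_locExp_prod P m r hφ h).integral_prod_right

theorem integral_integral_mul_exp_locExp (P : Measure (Euc n)) [IsProbabilityMeasure P]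
    (m : Euc n) (r : ℝ) {φ : Euc n → ℝ} (hφ : Measurable φ) {D : ℝ} (h : ∀ x, |φ x| ≤ D) :
    ∫ z, ∫ x, φ x * exp (locExp m r z x) ∂P ∂(stdGaussian (Euc n)) = ∫ x, φ x ∂P := by
  rw [← integral_integral_swap (f := fun x z => φ x * exp (locExp m r z x))
    (integrable_mul_exp_locExp_prod P m r hφ h)]
  simp only [integral_const_mul, integral_exp_locExp, mul_one]

theorem HasExpMoments.integrable_exp_locExp {P : Measure (Euc n)} (hP : HasExpMoments P)
    (m : Euc n) (r : ℝ) (z : Euc n) : Integrable (fun x => exp (locExp m r z x)) P := by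
  refine hP.integrable (by fun_prop) (exp (-⟪r • z, m⟫)) ‖r • z‖ fun x => ?_
  rw [norm_of_nonneg (exp_pos _).le, ← exp_add, exp_le_exp, locExp]
  have h := real_inner_le_norm (r • z) x
  have : r * ⟪x - m, z⟫ = -⟪r • z, m⟫ + ⟪r • z, x⟫ := by
    rw [real_inner_smul_left, real_inner_smul_left, inner_sub_left, real_inner_comm z,
      real_inner_comm z]; ring
  nlinarith [sq_nonneg (r * ‖x - m‖)]

/-- The step from mean zero tilt: changing `z` amounts to an exponential tilt. -/
theorem HasExpMoments.tilted_locExp {P : Measure (Euc n)} (hP : HasExpMoments P)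
    (m : Euc n) (r : ℝ) (z : Euc n) :
    P.tilted (locExp m r z) = (P.tilted (locExp m r 0)).tilted fun x => ⟪r • z, x⟫ := by
  rw [tilted_tilted (hP.integrable_exp_locExp m r 0),
    ← tilted_add_const P _ ⟪r • z, m⟫]
  congr 1
  ext x
  simp only [Pi.add_apply, locExp, inner_zero_right, real_inner_smul_left, inner_sub_left]
  rw [real_inner_comm z, real_inner_comm z m]
  ring

theorem HasExpMoments.integral_exp_locExp_mul {P : Measure (Euc n)} [IsProbabilityMeasure P]
    (hP : HasExpMoments P) (m : Euc n) (r : ℝ) (z : Euc n) (φ : Euc n → ℝ) :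
    (∫ x, exp (locExp m r z x) ∂P) * ∫ x, φ x ∂(P.tilted (locExp m r z))
      = ∫ x, φ x * exp (locExp m r z x) ∂P := by
  have hp := integral_exp_pos (hP.integrable_exp_locExp m r z)
  rw [integral_tilted, ← integral_const_mul]
  congr 1
  ext x
  rw [smul_eq_mul]
  field_simp

/-- The mean of a bounded function moves at most linearly during one localization step. -/
theorem IsSubG.abs_integral_tilted_locExp_sub_le {P : Measure (Euc n)} {C B : ℝ}
    (hP : IsSubG P C) (hC : 0 < C) (hCB : C ≤ B) {r : ℝ} (hr : 0 < r) (hr1 : r ≤ 1)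
    (hP0 : IsSubG (P.tilted (locExp (bary P) r 0)) B)
    {g : Euc n → ℝ} (hg : Measurable g) {D : ℝ} (h : ∀ x, g x ∈ Set.Icc 0 D) (z : Euc n) :
    |∫ x, g x ∂(P.tilted (locExp (bary P) r z)) - ∫ x, g x ∂P|
      ≤ (4 * D * √B + D * (n * B)) * r * (‖z‖ + 1) := by
  have hP' := hP.prob
  have hP0' := hP0.prob
  set m := bary P with hm
  have hD : 0 ≤ D := (h 0).1.trans (h 0).2
  have hgabs (x : Euc n) : |g x| ≤ D := by rw [abs_of_nonneg (h x).1]; exact (h x).2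
  have h1 := hP0.abs_integral_tilted_sub_le (hC.trans_le hCB) hg hgabs (r • z)
  rw [← hP.expMoments.tilted_locExp m r z, norm_smul, norm_of_nonneg hr.le] at h1
  set M := ∫ x, g x ∂P with hM
  set p := ∫ x, exp (locExp m r 0 x) ∂P with hp
  set E := ∫ x, g x ∂(P.tilted (locExp m r 0)) with hE
  set u : Euc n → ℝ := fun x => r ^ 2 * ‖x - m‖ ^ 2 / 2 with hu
  have hu0 (x : Euc n) : 0 ≤ u x := by simp only [hu]; positivity
  have hloc (x : Euc n) : locExp m r 0 x = -u x := by simp [locExp, hu]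
  have hei := hP.expMoments.integrable_exp_locExp m r 0
  have hui : Integrable u P :=
    ((hP.expMoments.integrable_norm_sub_pow m 2).const_mul (r ^ 2)).div_const 2
  have hU : ∫ x, u x ∂P ≤ r ^ 2 * (n * C) / 2 := by
    simp only [hu]
    rw [integral_div, integral_const_mul]
    gcongr
    exact hP.integral_norm_sub_sq_le
  have hMm := integral_mem_Icc (P := P) hg h
  have hEm := integral_mem_Icc (P := P.tilted (locExp m r 0)) hg h
  have hEM : |E - M| ≤ D := by
    rw [abs_le]; constructor <;> linarith [hMm.1, hMm.2, hEm.1, hEm.2]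
  have hexpu (x : Euc n) : |exp (locExp m r 0 x) - 1| ≤ u x := by
    rw [hloc, abs_le]
    constructor
    · linarith [add_one_le_exp (-u x)]
    · have : exp (-u x) ≤ 1 := by rw [exp_le_one_iff]; linarith [hu0 x]
      linarith [hu0 x]
  have hp1 : 1 - p ≤ ∫ x, u x ∂P := by
    have h2 : 1 - p = ∫ x, (1 - exp (locExp m r 0 x)) ∂P := by
      rw [integral_sub (integrable_const _) hei]; simp [hp]
    rw [h2]
    refine integral_mono ((integrable_const _).sub hei) hui fun x => ?_
    linarith [(abs_le.1 (hexpu x)).1]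
  have key : |E - M| ≤ 2 * (D * ∫ x, u x ∂P) := by
    rcases le_or_gt (1 / 2) p with h2 | h2
    · have h3 : p * (E - M) = ∫ x, (g x - M) * (exp (locExp m r 0 x) - 1) ∂P := by
        have e1 := hP.expMoments.integral_exp_locExp_mul m r 0 g
        have i1 : Integrable (fun x => g x * exp (locExp m r 0 x)) P :=
          hei.bdd_mul (c := D) hg.aestronglyMeasurable (Eventually.of_forall hgabs)
        have i2 : Integrable g P := integrable_of_mem_Icc hg h
        have e2 : (fun x => (g x - M) * (exp (locExp m r 0 x) - 1))
            = fun x => (g x * exp (locExp m r 0 x) - M * exp (locExp m r 0 x)) - (g x - M) := by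
          ext x; ring
        have i3 : Integrable (fun x => g x * exp (locExp m r 0 x) - M * exp (locExp m r 0 x)) P :=
          i1.sub (hei.const_mul M)
        have i4 : Integrable (fun x => g x - M) P := i2.sub (integrable_const M)
        rw [e2, integral_sub i3 i4, integral_sub i1 (hei.const_mul M),
          integral_sub i2 (integrable_const M), integral_const_mul, ← e1]
        simp only [integral_const, probReal_univ, smul_eq_mul, one_mul]
        rw [← hM, ← hp, ← hE]; ring
      have h4 : |p * (E - M)| ≤ D * ∫ x, u x ∂P := by
        rw [h3, ← integral_const_mul]
        refine (abs_integral_le_integral_abs).trans (integral_mono_of_nonneg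
          (Eventually.of_forall fun x => abs_nonneg _) (hui.const_mul D)
          (Eventually.of_forall fun x => ?_))
        simp only [abs_mul]
        refine mul_le_mul ?_ (hexpu x) (abs_nonneg _) hD
        rw [abs_le]; constructor <;> linarith [hMm.1, hMm.2, (h x).1, (h x).2]
      rw [abs_mul, abs_of_pos (by linarith : 0 < p)] at h4
      nlinarith [abs_nonneg (E - M)]
    · nlinarith
  have h5 : |∫ x, g x ∂(P.tilted (locExp m r z)) - M|
      ≤ |∫ x, g x ∂(P.tilted (locExp m r z)) - E| + |E - M| := abs_sub_le _ _ _
  have h6 : 2 * (D * ∫ x, u x ∂P) ≤ D * (n * B) * r := by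
    have : r ^ 2 * (n * C) / 2 ≤ r * (n * B) / 2 := by
      have : r ^ 2 ≤ r := by nlinarith
      gcongr
    have := mul_le_mul_of_nonneg_left (hU.trans this) hD
    linarith
  have hB : 0 < B := hC.trans_le hCB
  have h7 : 0 ≤ 4 * D * √B * r := by positivity
  have h8 : 0 ≤ D * (n * B) * r * ‖z‖ := by positivity
  have e : (4 * D * √B + D * (n * B)) * r * (‖z‖ + 1)
    = 4 * D * √B * (r * ‖z‖) + 4 * D * √B * r + D * (n * B) * r * ‖z‖ + D * (n * B) * r := by ring
  rw [e]
  linarith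

/-- The second order remainder of the density of one localization step. -/
def locRem {n : ℕ} (m : Euc n) (r : ℝ) (z x : Euc n) : ℝ :=
  exp (locExp m r z x) - 1 - r * ⟪x - m, z⟫

theorem HasExpMoments.integrable_norm_mul_norm_prod {P : Measure (Euc n)} [IsProbabilityMeasure P]
    (hP : HasExpMoments P) (m : Euc n) :
    Integrable (fun q : Euc n × Euc n => ‖q.1 - m‖ * ‖q.2‖) (P.prod (stdGaussian (Euc n))) := by
  have h1 := hP.integrable_norm_sub_pow m 1
  have h2 := (hasExpMoments_stdGaussian (n := n)).integrable_norm_sub_pow 0 1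
  simp only [pow_one, sub_zero] at h1 h2
  exact h1.mul_prod h2

theorem HasExpMoments.integrable_inner_prod {P : Measure (Euc n)} [IsProbabilityMeasure P]
    (hP : HasExpMoments P) (m : Euc n) (r : ℝ) :
    Integrable (fun q : Euc n × Euc n => r * ⟪q.1 - m, q.2⟫) (P.prod (stdGaussian (Euc n))) := by
  refine ((hP.integrable_norm_mul_norm_prod m).mono' (by fun_prop)
    (Eventually.of_forall fun q => ?_)).const_mul r
  exact abs_real_inner_le_norm _ _

theorem HasExpMoments.integrable_locRem_prod {P : Measure (Euc n)} [IsProbabilityMeasure P]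
    (hP : HasExpMoments P) (m : Euc n) (r : ℝ) :
    Integrable (fun q : Euc n × Euc n => locRem m r q.2 q.1) (P.prod (stdGaussian (Euc n))) :=
  ((integrable_exp_locExp_prod P m r).sub (integrable_const 1)).sub
    (hP.integrable_inner_prod m r)

/-- A Gaussian polynomial-exponential moment. -/
def gaussMoment (n : ℕ) : ℝ :=
  ∫ z, (‖z‖ + 1) * ((‖z‖ + 1) ^ 2 * exp (‖z‖ + 1) + 1) ∂(stdGaussian (Euc n))

theorem integrable_gaussMoment : Integrable
    (fun z : Euc n => (‖z‖ + 1) * ((‖z‖ + 1) ^ 2 * exp (‖z‖ + 1) + 1)) (stdGaussian (Euc n)) := by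
  refine hasExpMoments_stdGaussian.integrable_pow_mul (by fun_prop) (2 * exp 1) 1 3 fun z => ?_
  rw [norm_of_nonneg (by positivity), exp_add, one_mul]
  have h1 : 1 ≤ exp ‖z‖ := one_le_exp (norm_nonneg z)
  have h2 : 1 ≤ exp 1 := one_le_exp zero_le_one
  have h3 : 1 ≤ exp ‖z‖ * exp 1 := one_le_mul_of_one_le_of_one_le h1 h2
  have h4 : 1 ≤ (1 + ‖z‖) ^ 2 := one_le_pow₀ (by linarith [norm_nonneg z])
  have h5 : 1 ≤ (1 + ‖z‖) ^ 2 * (exp ‖z‖ * exp 1) := one_le_mul_of_one_le_of_one_le h4 h3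
  have h6 : (‖z‖ + 1) * ((‖z‖ + 1) ^ 2 * (exp ‖z‖ * exp 1) + 1)
      ≤ (‖z‖ + 1) * (2 * ((1 + ‖z‖) ^ 2 * (exp ‖z‖ * exp 1))) := by
    gcongr
    rw [add_comm ‖z‖ 1]; linarith
  linarith

theorem abs_locRem_le (m : Euc n) {r : ℝ} (z x : Euc n)
    (h : ‖r • (x - m)‖ ≤ 1) :
    |locRem m r z x| ≤ ‖r • (x - m)‖ ^ 2 * ((‖z‖ + 1) ^ 2 * exp (‖z‖ + 1) + 1) := by
  rw [locRem, locExp_eq]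
  set a := r • (x - m) with ha
  rw [show r * ⟪x - m, z⟫ = ⟪a, z⟫ by rw [ha, real_inner_smul_left]]
  set y := ⟪a, z⟫ - ‖a‖ ^ 2 / 2 with hy
  have h1 := abs_exp_sub_one_sub_le y
  have h0 := abs_real_inner_le_norm a z
  have hyabs : |y| ≤ ‖a‖ * (‖z‖ + 1) := by
    rw [abs_le] at *
    constructor <;> nlinarith [norm_nonneg a, norm_nonneg z]
  have hy2 : y ^ 2 ≤ ‖a‖ ^ 2 * (‖z‖ + 1) ^ 2 := by
    rw [← mul_pow, ← sq_abs y]; gcongr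
  have hye : exp |y| ≤ exp (‖z‖ + 1) := by
    rw [exp_le_exp]
    nlinarith [norm_nonneg a, norm_nonneg z]
  have h2 : y ^ 2 * exp |y| ≤ ‖a‖ ^ 2 * (‖z‖ + 1) ^ 2 * exp (‖z‖ + 1) := by gcongr
  have h3 : exp y - 1 - ⟪a, z⟫ = (exp y - 1 - y) - ‖a‖ ^ 2 / 2 := by rw [hy]; ring
  rw [h3]
  refine (abs_sub _ _).trans ?_
  rw [abs_of_nonneg (by positivity : 0 ≤ ‖a‖ ^ 2 / 2)]
  nlinarith [sq_nonneg ‖a‖]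

set_option maxHeartbeats 400000 in
theorem IsSubG.integral_locRem_mul_le {P : Measure (Euc n)} {C : ℝ} (hP : IsSubG P C)
    (hC : 0 < C) {r : ℝ} (hr : 0 < r) (hr1 : r ≤ 1) {G : Euc n → ℝ}
    (hG : Measurable G) {A D : ℝ} (hA0 : 0 ≤ A) (hA : ∀ z, |G z| ≤ A * r * (‖z‖ + 1))
    (hD : ∀ z, |G z| ≤ D) :
    ∫ q, |locRem (bary P) r q.2 q.1| * |G q.2| ∂(P.prod (stdGaussian (Euc n)))
      ≤ gaussMoment n * (A * (n * C) + 3 * D * (96 * n ^ 2 * C ^ 2)) * r ^ 3 := by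
  have hP' := hP.prob
  set m := bary P with hm
  have hD0 : 0 ≤ D := (abs_nonneg _).trans (hD 0)
  have hRG : Integrable (fun q : Euc n × Euc n => |locRem m r q.2 q.1| * |G q.2|)
      (P.prod (stdGaussian (Euc n))) := by
    refine (hP.expMoments.integrable_locRem_prod m r).abs.mul_bdd (c := D)
      (hG.comp measurable_snd).abs.aestronglyMeasurable (Eventually.of_forall fun q => ?_)
    rw [norm_eq_abs, abs_abs]; exact hD _
  have hK := integrable_gaussMoment (n := n)
  have hnorm : Integrable (fun z : Euc n => ‖z‖) (stdGaussian (Euc n)) := by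
    simpa using (hasExpMoments_stdGaussian (n := n)).integrable_norm_sub_pow 0 1
  have hKnorm : ∫ z : Euc n, (‖z‖ + 1) ∂(stdGaussian (Euc n)) ≤ gaussMoment n := by
    refine integral_mono (hnorm.add (integrable_const 1)) hK fun z => ?_
    have : 0 ≤ (‖z‖ + 1) ^ 2 * exp (‖z‖ + 1) := by positivity
    nlinarith [norm_nonneg z]
  have hnorm0 : 0 ≤ ∫ z : Euc n, ‖z‖ ∂(stdGaussian (Euc n)) :=
    integral_nonneg fun z => norm_nonneg z
  have hKn : (∫ z : Euc n, ‖z‖ ∂(stdGaussian (Euc n))) + 1 ≤ gaussMoment n := by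
    rw [integral_add hnorm (integrable_const 1)] at hKnorm
    simpa using hKnorm
  have hpt (x : Euc n) : ∫ z, |locRem m r z x| * |G z| ∂(stdGaussian (Euc n))
      ≤ gaussMoment n * A * r * ‖r • (x - m)‖ ^ 2
        + 3 * D * gaussMoment n * ‖r • (x - m)‖ ^ 4 := by
    rcases le_or_gt ‖r • (x - m)‖ 1 with h | h
    · have h1 : ∫ z, |locRem m r z x| * |G z| ∂(stdGaussian (Euc n))
          ≤ ∫ z : Euc n, ‖r • (x - m)‖ ^ 2 * (A * r) *
            ((‖z‖ + 1) * ((‖z‖ + 1) ^ 2 * exp (‖z‖ + 1) + 1)) ∂(stdGaussian (Euc n)) := by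
        refine integral_mono_of_nonneg (Eventually.of_forall fun z => by positivity)
          (hK.const_mul _) (Eventually.of_forall fun z => ?_)
        have := mul_le_mul (abs_locRem_le m z x h) (hA z) (abs_nonneg _) (by positivity)
        refine this.trans (le_of_eq ?_)
        ring
      rw [integral_const_mul] at h1
      change _ ≤ _ * gaussMoment n at h1
      have : 0 ≤ 3 * D * gaussMoment n * ‖r • (x - m)‖ ^ 4 := by
        have : 0 ≤ gaussMoment n := by linarith
        positivity
      linarith
    · set a := r • (x - m) with ha
      have hexp : Integrable (fun z => exp (locExp m r z x)) (stdGaussian (Euc n)) := by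
        simp only [locExp_eq, sub_eq_add_neg]
        exact integrable_exp_inner_stdGaussian _ _
      have hc : Integrable (fun z : Euc n => 1 + ‖a‖ * ‖z‖) (stdGaussian (Euc n)) :=
        (integrable_const 1).add (hnorm.const_mul _)
      have hb : Integrable (fun z : Euc n => exp (locExp m r z x) + (1 + ‖a‖ * ‖z‖))
          (stdGaussian (Euc n)) :=
        hexp.add hc
      have h1 : ∫ z, |locRem m r z x| * |G z| ∂(stdGaussian (Euc n))
          ≤ ∫ z : Euc n, (exp (locExp m r z x) + (1 + ‖a‖ * ‖z‖)) * D ∂(stdGaussian (Euc n)) := by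
        refine integral_mono_of_nonneg (Eventually.of_forall fun z => by positivity)
          (hb.mul_const _) (Eventually.of_forall fun z => ?_)
        refine mul_le_mul ?_ (hD z) (abs_nonneg _) (by positivity)
        rw [locRem, show r * ⟪x - m, z⟫ = ⟪a, z⟫ by rw [ha, real_inner_smul_left]]
        have h0 := abs_real_inner_le_norm a z
        have h2 := exp_pos (locExp m r z x)
        rw [abs_le] at *
        constructor <;> linarith [h0.1, h0.2]
      rw [integral_mul_const, integral_add hexp hc,
        integral_add (integrable_const 1) (hnorm.const_mul _), integral_const_mul,
        integral_exp_locExp] at h1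
      simp only [integral_const, probReal_univ, smul_eq_mul, one_mul] at h1
      have ha4 : ‖a‖ ≤ ‖a‖ ^ 4 := by
        calc ‖a‖ = ‖a‖ ^ 1 := (pow_one _).symm
          _ ≤ ‖a‖ ^ 4 := pow_le_pow_right₀ h.le (by norm_num)
      have h3 : 1 + (1 + ‖a‖ * ∫ z : Euc n, ‖z‖ ∂(stdGaussian (Euc n)))
          ≤ 3 * gaussMoment n * ‖a‖ ^ 4 := by
        have e1 : 1 ≤ ‖a‖ ^ 4 := h.le.trans ha4
        have e2 : ‖a‖ * ∫ z : Euc n, ‖z‖ ∂(stdGaussian (Euc n)) ≤ ‖a‖ ^ 4 * gaussMoment n := by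
          exact mul_le_mul ha4 (by linarith) hnorm0 (by positivity)
        have e3 : (1 : ℝ) ≤ gaussMoment n * ‖a‖ ^ 4 :=
          one_le_mul_of_one_le_of_one_le (by linarith) e1
        linarith
      have h4 := mul_le_mul_of_nonneg_right h3 hD0
      have h5 : 0 ≤ gaussMoment n * A * r * ‖a‖ ^ 2 := by
        have : 0 ≤ gaussMoment n := by linarith
        positivity
      linarith
  rw [integral_prod _ hRG]
  have i2 := hP.expMoments.integrable_norm_sub_pow m 2
  have i4 := hP.expMoments.integrable_norm_sub_pow m 4
  have hpt' (x : Euc n) : ∫ z, |locRem m r z x| * |G z| ∂(stdGaussian (Euc n))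
      ≤ gaussMoment n * A * r ^ 3 * ‖x - m‖ ^ 2
        + 3 * D * gaussMoment n * r ^ 4 * ‖x - m‖ ^ 4 := by
    refine (hpt x).trans (le_of_eq ?_)
    rw [norm_smul, norm_of_nonneg hr.le]; ring
  have h1 := integral_mono hRG.integral_prod_left
    ((i2.const_mul (gaussMoment n * A * r ^ 3)).add
      (i4.const_mul (3 * D * gaussMoment n * r ^ 4))) hpt'
  simp only [Pi.add_apply] at h1
  rw [integral_add (i2.const_mul _) (i4.const_mul _), integral_const_mul, integral_const_mul] at h1
  refine h1.trans ?_
  have hg0 : 0 ≤ gaussMoment n := by linarith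
  have e2 : gaussMoment n * A * r ^ 3 * ∫ x, ‖x - m‖ ^ 2 ∂P
      ≤ gaussMoment n * A * r ^ 3 * (n * C) := by
    gcongr; exact hP.integral_norm_sub_sq_le
  have e4 : 3 * D * gaussMoment n * r ^ 4 * ∫ x, ‖x - m‖ ^ 4 ∂P
      ≤ 3 * D * gaussMoment n * r ^ 3 * (96 * n ^ 2 * C ^ 2) := by
    have : r ^ 4 ≤ r ^ 3 := pow_le_pow_of_le_one hr.le hr1 (by norm_num)
    gcongr
    exact hP.integral_norm_sub_pow_four_le hC
  linarith

theorem ent_nonneg_of_mem_Icc {P : Measure (Euc n)} [IsProbabilityMeasure P] {g : Euc n → ℝ}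
    (hg : Measurable g) {c D : ℝ} (hc : 0 < c) (h : ∀ x, g x ∈ Set.Icc c D) : 0 ≤ ent P g := by
  set M := ∫ x, g x ∂P with hM
  have hMpos : 0 < M := hc.trans_le (integral_mem_Icc hg h).1
  have hgi := integrable_of_mem_Icc (P := P) hg h
  have hgl := integrable_mul_log (P := P) hg hc h
  have hi : Integrable (fun x => g x * log M + g x) P := (hgi.mul_const _).add hgi
  have key := integral_mono (hi.sub (integrable_const M)) hgl fun x => by
    have hgx : 0 < g x := hc.trans_le (h x).1
    have h1 := log_le_sub_one_of_pos (div_pos hMpos hgx)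
    rw [log_div hMpos.ne' hgx.ne'] at h1
    have h2 := mul_le_mul_of_nonneg_left h1 hgx.le
    have h3 : g x * (M / g x - 1) = M - g x := by field_simp
    change g x * log M + g x - M ≤ g x * log (g x)
    linarith
  simp only [Pi.sub_apply] at key
  rw [integral_sub hi (integrable_const M), integral_add (hgi.mul_const _) hgi,
    integral_mul_const, ← hM] at key
  simp only [integral_const, probReal_univ, smul_eq_mul, one_mul] at key
  rw [ent, ← hM]
  linarith

theorem IsSubG.sq_norm_integral_smul_le {P : Measure (Euc n)} {C : ℝ} (hP : IsSubG P C)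
    (hC : 0 < C) {g : Euc n → ℝ} (hg : Measurable g) {c D : ℝ} (hc : 0 < c)
    (h : ∀ x, g x ∈ Set.Icc c D) :
    ∃ v : Euc n, (∀ z, ∫ x, g x * ⟪z, x - bary P⟫ ∂P = ⟪v, z⟫) ∧
      ‖v‖ ^ 2 ≤ 2 * C * (∫ x, g x ∂P) * ent P g := by
  have hP' := hP.prob
  have hi : Integrable (fun x => g x • (x - bary P)) P := by
    refine (hP.expMoments.integrable_id.sub (integrable_const _)).bdd_smul (max |c| |D|)
      hg.aestronglyMeasurable (Eventually.of_forall fun x => ?_)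
    exact abs_le_max_abs_abs (h x).1 (h x).2
  have hv (z : Euc n) : ∫ x, g x * ⟪z, x - bary P⟫ ∂P = ⟪∫ x, g x • (x - bary P) ∂P, z⟫ := by
    rw [real_inner_comm, ← integral_inner hi]
    simp only [real_inner_smul_right]
  refine ⟨∫ x, g x • (x - bary P) ∂P, hv, ?_⟩
  set v := ∫ x, g x • (x - bary P) ∂P
  have h1 := hP.sq_integral_mul_inner_le hg hc h v
  rw [hv, real_inner_self_eq_norm_sq] at h1
  have hM : 0 < ∫ x, g x ∂P := hc.trans_le (integral_mem_Icc hg h).1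
  have hE := ent_nonneg_of_mem_Icc (P := P) hg hc h
  rcases eq_or_ne v 0 with h0 | h0
  · rw [h0, norm_zero]
    have : 0 ≤ 2 * C * (∫ x, g x ∂P) * ent P g := by positivity
    simpa using this
  · have : 0 < ‖v‖ ^ 2 := by positivity
    nlinarith

/-- The constant in the third order error of one localization step. -/
def stepConst (n : ℕ) (B c D : ℝ) : ℝ :=
  let A := 4 * D * √B + D * (n * B)
  let e := gaussMoment n * (A * (n * B) + 3 * D * (96 * n ^ 2 * B ^ 2))
  3 * D * e / (2 * c) + 4 * (A ^ 3 * gaussMoment n + D ^ 2 * e) / c ^ 2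

theorem measurable_integral_mul_exp_locExp (P : Measure (Euc n)) [IsProbabilityMeasure P]
    (m : Euc n) (r : ℝ) {φ : Euc n → ℝ} (hφ : Measurable φ) :
    Measurable fun z => ∫ x, φ x * exp (locExp m r z x) ∂P := by
  have h : Measurable fun q : Euc n × Euc n => φ q.1 * exp (locExp m r q.2 q.1) :=
    (hφ.comp measurable_fst).mul (continuous_locExp m r).rexp.measurable
  exact h.stronglyMeasurable.integral_prod_left'.measurable

set_option maxHeartbeats 1000000 in
/-- One step of entropic localization. -/
theorem IsSubG.ent_step {P : Measure (Euc n)} {C B : ℝ} (hP : IsSubG P C)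
    (hC : 0 < C) (hCB : C ≤ B) {r : ℝ} (hr : 0 < r) (hr1 : r ≤ 1)
    (hP0 : IsSubG (P.tilted (locExp (bary P) r 0)) B)
    {g : Euc n → ℝ} (hg : Measurable g) {c D : ℝ} (hc : 0 < c) (h : ∀ x, g x ∈ Set.Icc c D)
    {w : Euc n → ℝ} (hw : Measurable w) {W : ℝ} (hW : ∀ x, |w x| ≤ W) {a b : ℝ}
    (hstep : ∀ z, ent (P.tilted (locExp (bary P) r z)) g
      ≤ a * ∫ x, w x ∂(P.tilted (locExp (bary P) r z)) + b) :
    (1 - r ^ 2 * C) * ent P g ≤ a * ∫ x, w x ∂P + b + stepConst n B c D * r ^ 3 := by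
  have hP' := hP.prob
  have hexpM := hP.expMoments
  have hcD : c ≤ D := (h 0).1.trans (h 0).2
  have hD : 0 < D := hc.trans_le hcD
  have hBpos : 0 < B := hC.trans_le hCB
  have hh0 (x : Euc n) : g x ∈ Set.Icc 0 D := ⟨hc.le.trans (h x).1, (h x).2⟩
  have hgabs (x : Euc n) : |g x| ≤ D := by rw [abs_of_nonneg (hh0 x).1]; exact (h x).2
  set m := bary P with hm
  set M := ∫ x, g x ∂P with hM
  have hMm : M ∈ Set.Icc c D := integral_mem_Icc hg h
  have hMpos : 0 < M := hc.trans_le hMm.1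
  set γ := stdGaussian (Euc n) with hγ
  set p : Euc n → ℝ := fun z => ∫ x, exp (locExp m r z x) ∂P with hp
  set G : Euc n → ℝ := fun z => ∫ x, g x ∂(P.tilted (locExp m r z)) with hG
  have hei (z : Euc n) := hexpM.integrable_exp_locExp m r z
  have hprob (z : Euc n) : IsProbabilityMeasure (P.tilted (locExp m r z)) :=
    isProbabilityMeasure_tilted (hei z)
  have hppos (z : Euc n) : 0 < p z := integral_exp_pos (hei z)
  have hpφ (φ : Euc n → ℝ) (z : Euc n) : p z * ∫ x, φ x ∂(P.tilted (locExp m r z))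
      = ∫ x, φ x * exp (locExp m r z x) ∂P := hexpM.integral_exp_locExp_mul m r z φ
  have hpone : p = fun z => ∫ x, (1 : ℝ) * exp (locExp m r z x) ∂P := by simp [hp]
  have hpm : Measurable p := by
    rw [hpone]; exact measurable_integral_mul_exp_locExp P m r measurable_const
  have hpi : Integrable p γ := by
    rw [hpone]
    exact integrable_integral_mul_exp_locExp P m r measurable_const (D := 1) (by simp)
  have hp1 : ∫ z, p z ∂γ = 1 := by
    rw [hpone, integral_integral_mul_exp_locExp P m r measurable_const (D := 1) (by simp)]
    simp
  have mixi {φ : Euc n → ℝ} (hφ : Measurable φ) {K : ℝ} (hK : ∀ x, |φ x| ≤ K) :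
      Integrable (fun z => p z * ∫ x, φ x ∂(P.tilted (locExp m r z))) γ := by
    simp only [hpφ]
    exact integrable_integral_mul_exp_locExp P m r hφ hK
  have mix {φ : Euc n → ℝ} (hφ : Measurable φ) {K : ℝ} (hK : ∀ x, |φ x| ≤ K) :
      ∫ z, p z * ∫ x, φ x ∂(P.tilted (locExp m r z)) ∂γ = ∫ x, φ x ∂P := by
    simp only [hpφ]
    exact integral_integral_mul_exp_locExp P m r hφ hK
  have hGm : Measurable G := by
    have : G = fun z => (∫ x, g x * exp (locExp m r z x) ∂P) / p z := by
      ext z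
      rw [← hpφ, mul_div_cancel_left₀ _ (hppos z).ne']
    rw [this]
    exact (measurable_integral_mul_exp_locExp P m r hg).div hpm
  have hGI (z : Euc n) : G z ∈ Set.Icc c D := integral_mem_Icc hg h
  have hGM (z : Euc n) : |G z - M| ≤ D := by
    rw [abs_le]; constructor <;> linarith [(hGI z).1, (hGI z).2, hMm.1, hMm.2]
  set A := 4 * D * √B + D * (n * B) with hA
  have hA0 : 0 ≤ A := by positivity
  have hGA (z : Euc n) : |G z - M| ≤ A * r * (‖z‖ + 1) :=
    hP.abs_integral_tilted_locExp_sub_le hC hCB hr hr1 hP0 hg hh0 z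
  have hGMm : Measurable fun z => G z - M := hGm.sub_const M
  -- integrability of bounded functions against the mixing density
  have hpb {F : Euc n → ℝ} (hF : Measurable F) {K : ℝ} (hK : ∀ z, |F z| ≤ K) :
      Integrable (fun z => p z * F z) γ :=
    hpi.mul_bdd (c := K) hF.aestronglyMeasurable (Eventually.of_forall hK)
  have hb {F : Euc n → ℝ} (hF : Measurable F) {K : ℝ} (hK : ∀ z, |F z| ≤ K) :
      Integrable F γ :=
    Integrable.of_bound hF.aestronglyMeasurable K (Eventually.of_forall hK)
  -- the remainder
  set e := ∫ q, |locRem m r q.2 q.1| * |G q.2 - M| ∂(P.prod γ) with he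
  set e0 := gaussMoment n * (A * (n * B) + 3 * D * (96 * n ^ 2 * B ^ 2)) with he0
  have hgm0 : 0 ≤ gaussMoment n := integral_nonneg fun z => by positivity
  have hee0 : e ≤ e0 * r ^ 3 := by
    refine (hP.integral_locRem_mul_le hC hr hr1 hGMm hA0 hGA hGM).trans ?_
    rw [he0]
    gcongr
  have hRi := hexpM.integrable_locRem_prod m r
  have hRGi : Integrable (fun q : Euc n × Euc n => |locRem m r q.2 q.1| * |G q.2 - M|)
      (P.prod γ) := by
    refine hRi.abs.mul_bdd (c := D)
      (hGMm.comp measurable_snd).abs.aestronglyMeasurable (Eventually.of_forall fun q => ?_)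
    rw [norm_eq_abs, abs_abs]; exact hGM _
  set ez : Euc n → ℝ := fun z => (∫ x, |locRem m r z x| ∂P) * |G z - M| with hez
  have hezi : Integrable ez γ := by
    have := hRGi.integral_prod_right
    simpa only [integral_mul_const] using this
  have hezint : ∫ z, ez z ∂γ = e := by
    rw [he, integral_prod_symm _ hRGi]
    simp only [integral_mul_const, hez]
  have hini (z : Euc n) : Integrable (fun x => r * ⟪x - m, z⟫) P := by
    have := (hexpM.integrable_inner_sub_pow z m 1).const_mul r
    simpa only [pow_one, real_inner_comm] using this
  have hin0 (z : Euc n) : ∫ x, r * ⟪x - m, z⟫ ∂P = 0 := by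
    rw [integral_const_mul]
    have := hexpM.integral_inner_sub_bary z
    simp only [real_inner_comm z]
    rw [this, mul_zero]
  have hRz (z : Euc n) : Integrable (fun x => locRem m r z x) P :=
    ((hei z).sub (integrable_const 1)).sub (hini z)
  have hRint (z : Euc n) : ∫ x, locRem m r z x ∂P = p z - 1 := by
    have h1 : Integrable (fun x => exp (locExp m r z x) - 1) P := (hei z).sub (integrable_const 1)
    simp only [locRem]
    rw [integral_sub h1 (hini z), integral_sub (hei z) (integrable_const 1), hin0]
    simp [hp]
  have hp1abs (z : Euc n) : |p z - 1| ≤ ∫ x, |locRem m r z x| ∂P := by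
    rw [← hRint]; exact abs_integral_le_integral_abs
  obtain ⟨v, hv, hvn⟩ := hP.sq_norm_integral_smul_le hC hg hc h
  rw [← hm] at hv
  rw [← hM] at hvn
  have hgi := integrable_of_mem_Icc (P := P) hg h
  have hlin (z : Euc n) : p z * (G z - M)
      = r * ⟪v, z⟫ + ∫ x, (g x - M) * locRem m r z x ∂P := by
    have i1 : Integrable (fun x => g x * exp (locExp m r z x)) P :=
      (hei z).bdd_mul (c := D) hg.aestronglyMeasurable (Eventually.of_forall hgabs)
    have i2 : Integrable (fun x => g x * exp (locExp m r z x) - M * exp (locExp m r z x)) P :=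
      i1.sub ((hei z).const_mul M)
    have i3 : Integrable (fun x => g x - M) P := hgi.sub (integrable_const M)
    have i4 : Integrable (fun x => g x * (r * ⟪x - m, z⟫)) P :=
      (hini z).bdd_mul (c := D) hg.aestronglyMeasurable (Eventually.of_forall hgabs)
    have i5 : Integrable (fun x => g x * (r * ⟪x - m, z⟫) - M * (r * ⟪x - m, z⟫)) P :=
      i4.sub ((hini z).const_mul M)
    have e1 : (fun x => (g x - M) * locRem m r z x)
        = fun x => ((g x * exp (locExp m r z x) - M * exp (locExp m r z x)) - (g x - M))
          - (g x * (r * ⟪x - m, z⟫) - M * (r * ⟪x - m, z⟫)) := by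
      ext x; rw [locRem]; ring
    have i6 : Integrable (fun x => (g x * exp (locExp m r z x) - M * exp (locExp m r z x))
      - (g x - M)) P := i2.sub i3
    have e2 : ∫ x, g x * (r * ⟪x - m, z⟫) ∂P = r * ⟪v, z⟫ := by
      rw [← hv, ← integral_const_mul]
      congr 1; ext x; rw [real_inner_comm z]; ring
    rw [e1, integral_sub i6 i5, integral_sub i2 i3, integral_sub i1 ((hei z).const_mul M),
      integral_sub i4 ((hini z).const_mul M), integral_sub hgi (integrable_const M),
      integral_const_mul, integral_const_mul, hin0, e2, ← hpφ]
    simp only [integral_const, probReal_univ, smul_eq_mul, one_mul]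
    rw [← hM]
    change p z * (G z - M) = r * ⟪v, z⟫ + (p z * G z - M * p z - (M - M) - (r * ⟪v, z⟫ - M * 0))
    ring
  have hgR (z : Euc n) : |∫ x, (g x - M) * locRem m r z x ∂P| ≤ D * ∫ x, |locRem m r z x| ∂P := by
    rw [← integral_const_mul]
    refine abs_integral_le_integral_abs.trans (integral_mono_of_nonneg
      (Eventually.of_forall fun x => abs_nonneg _) ((hRz z).abs.const_mul D)
      (Eventually.of_forall fun x => ?_))
    simp only [abs_mul]
    gcongr
    rw [abs_le]; constructor <;> linarith [(h x).1, (h x).2, hMm.1, hMm.2]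
  -- the quadratic terms
  have hsqb (z : Euc n) : |(G z - M) ^ 2| ≤ D ^ 2 := by
    rw [abs_pow]; exact pow_le_pow_left₀ (abs_nonneg _) (hGM z) 2
  have hcbb (z : Euc n) : |(|G z - M| ^ 3)| ≤ D ^ 3 := by
    rw [abs_pow, abs_abs]; exact pow_le_pow_left₀ (abs_nonneg _) (hGM z) 3
  have hVi := hpb (hGMm.pow_const 2) hsqb
  have hWi := hb (hGMm.pow_const 2) hsqb
  have hTi := hpb (hGMm.abs.pow_const 3) hcbb
  have hvi : Integrable (fun z => ⟪v, z⟫ ^ 2) γ := by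
    simpa using (hasExpMoments_stdGaussian (n := n)).integrable_inner_sub_pow v 0 2
  set V := ∫ z, p z * (G z - M) ^ 2 ∂γ with hV
  set U := ∫ z, (G z - M) ^ 2 ∂γ with hU
  set T := ∫ z, p z * |G z - M| ^ 3 ∂γ with hT
  have hVle : V ≤ 1 / 2 * U + r ^ 2 / 2 * ‖v‖ ^ 2 + D * e := by
    have i1 : Integrable (fun z => 1 / 2 * (G z - M) ^ 2 + r ^ 2 / 2 * ⟪v, z⟫ ^ 2) γ :=
      (hWi.const_mul _).add (hvi.const_mul _)
    have h1 := integral_mono hVi (i1.add (hezi.const_mul D)) fun z => by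
      change p z * (G z - M) ^ 2
        ≤ 1 / 2 * (G z - M) ^ 2 + r ^ 2 / 2 * ⟪v, z⟫ ^ 2 + D * ez z
      have e1 : p z * (G z - M) ^ 2 = (G z - M) * (p z * (G z - M)) := by ring
      rw [e1, hlin]
      have e2 : (G z - M) * ∫ x, (g x - M) * locRem m r z x ∂P ≤ D * ez z := by
        refine (le_abs_self _).trans ?_
        rw [abs_mul]
        refine (mul_le_mul_of_nonneg_left (hgR z) (abs_nonneg _)).trans (le_of_eq ?_)
        simp only [hez]; ring
      nlinarith [sq_nonneg ((G z - M) - r * ⟪v, z⟫)]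
    simp only [Pi.add_apply] at h1
    rw [integral_add i1 (hezi.const_mul D), integral_add (hWi.const_mul _) (hvi.const_mul _),
      integral_const_mul, integral_const_mul, integral_const_mul, hezint,
      integral_inner_sq_stdGaussian] at h1
    exact h1
  have hUle : U ≤ V + D * e := by
    have h1 := integral_mono hWi (hVi.add (hezi.const_mul D)) fun z => by
      change (G z - M) ^ 2 ≤ p z * (G z - M) ^ 2 + D * ez z
      have e1 : (1 - p z) * (G z - M) ^ 2 ≤ D * ez z := by
        calc (1 - p z) * (G z - M) ^ 2 ≤ |p z - 1| * (|G z - M| * |G z - M|) := by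
              rw [← sq_abs (G z - M), ← sq]
              gcongr
              linarith [neg_abs_le (p z - 1)]
          _ ≤ (∫ x, |locRem m r z x| ∂P) * (D * |G z - M|) := by
              refine mul_le_mul (hp1abs z) ?_ (by positivity)
                (integral_nonneg fun x => abs_nonneg _)
              exact mul_le_mul_of_nonneg_right (hGM z) (abs_nonneg _)
          _ = D * ez z := by simp only [hez]; ring
      linarith
    simp only [Pi.add_apply] at h1
    rwa [integral_add hVi (hezi.const_mul D), integral_const_mul, hezint] at h1
  have hTle : T ≤ A ^ 3 * r ^ 3 * gaussMoment n + D ^ 2 * e := by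
    have i1 := (integrable_gaussMoment (n := n)).const_mul (A ^ 3 * r ^ 3)
    have h1 := integral_mono hTi (i1.add (hezi.const_mul (D ^ 2))) fun z => by
      change p z * |G z - M| ^ 3 ≤ A ^ 3 * r ^ 3 * ((‖z‖ + 1) * ((‖z‖ + 1) ^ 2
        * exp (‖z‖ + 1) + 1)) + D ^ 2 * ez z
      have e1 : (p z - 1) * |G z - M| ^ 3 ≤ D ^ 2 * ez z := by
        calc (p z - 1) * |G z - M| ^ 3 ≤ |p z - 1| * (|G z - M| ^ 2 * |G z - M|) := by
              rw [← pow_succ]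
              gcongr
              exact le_abs_self _
          _ ≤ (∫ x, |locRem m r z x| ∂P) * (D ^ 2 * |G z - M|) := by
              refine mul_le_mul (hp1abs z) ?_ (by positivity)
                (integral_nonneg fun x => abs_nonneg _)
              exact mul_le_mul_of_nonneg_right
                (pow_le_pow_left₀ (abs_nonneg _) (hGM z) 2) (abs_nonneg _)
          _ = D ^ 2 * ez z := by simp only [hez]; ring
      have e2 : |G z - M| ^ 3 ≤ A ^ 3 * r ^ 3 * (‖z‖ + 1) ^ 3 := by
        rw [← mul_pow, ← mul_pow]
        exact pow_le_pow_left₀ (abs_nonneg _) (hGA z) 3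
      have e3 : (‖z‖ + 1) ^ 3 ≤ (‖z‖ + 1) * ((‖z‖ + 1) ^ 2 * exp (‖z‖ + 1) + 1) := by
        have h2 : (‖z‖ + 1) ^ 2 * 1 ≤ (‖z‖ + 1) ^ 2 * exp (‖z‖ + 1) := by
          gcongr; exact one_le_exp (by positivity)
        calc (‖z‖ + 1) ^ 3 = (‖z‖ + 1) * ((‖z‖ + 1) ^ 2 * 1) := by ring
          _ ≤ _ := by gcongr; linarith
      have e4 : A ^ 3 * r ^ 3 * (‖z‖ + 1) ^ 3 ≤ A ^ 3 * r ^ 3 * ((‖z‖ + 1) * ((‖z‖ + 1) ^ 2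
          * exp (‖z‖ + 1) + 1)) := mul_le_mul_of_nonneg_left e3 (by positivity)
      linarith
    simp only [Pi.add_apply] at h1
    rw [integral_add i1 (hezi.const_mul _), integral_const_mul, integral_const_mul, hezint] at h1
    exact h1
  -- the entropy decomposition
  have hGlb (z : Euc n) : |G z * log (G z)| ≤ D * (|log c| + |log D|) := abs_mul_log_le hc (hGI z)
  have hGli := hpb (hGm.mul hGm.log) hGlb
  have hlogb (x : Euc n) : |g x * log (g x)| ≤ D * (|log c| + |log D|) := abs_mul_log_le hc (h x)
  have hE1 : ∫ x, g x * log (g x) ∂P - ∫ z, p z * (G z * log (G z)) ∂γ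
      ≤ a * ∫ x, w x ∂P + b := by
    have i1 := mixi (hg.mul hg.log) hlogb
    have i2 := mixi hw hW
    have h1 := integral_mono (i1.sub hGli) ((i2.const_mul a).add (hpi.const_mul b)) fun z => by
      change p z * (∫ x, g x * log (g x) ∂(P.tilted (locExp m r z)))
        - p z * (G z * log (G z)) ≤ a * (p z * ∫ x, w x ∂(P.tilted (locExp m r z))) + b * p z
      have := mul_le_mul_of_nonneg_left (hstep z) (hppos z).le
      rw [ent] at this
      linarith
    simp only [Pi.add_apply, Pi.sub_apply] at h1
    rw [integral_sub i1 hGli, integral_add (i2.const_mul a) (hpi.const_mul b), integral_const_mul,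
      integral_const_mul, hp1] at h1
    have e1 := mix (hg.mul hg.log) hlogb
    have e2 := mix hw hW
    simp only [Pi.mul_apply] at e1 h1
    rw [e1, e2] at h1
    linarith
  have hE2 : ∫ z, p z * (G z * log (G z)) ∂γ
      ≤ M * log M + (1 / (2 * M)) * V + 4 / M ^ 2 * T := by
    have i0 : Integrable (fun z => p z * G z) γ := mixi hg hgabs
    have i0' : ∫ z, p z * G z ∂γ = M := mix hg hgabs
    have i1 : Integrable (fun z => (M * log M - M * (1 + log M)) * p z
        + (1 + log M) * (p z * G z)) γ := (hpi.const_mul _).add (i0.const_mul _)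
    have i2 : Integrable (fun z => (M * log M - M * (1 + log M)) * p z
        + (1 + log M) * (p z * G z) + (1 / (2 * M)) * (p z * (G z - M) ^ 2)) γ :=
      i1.add (hVi.const_mul _)
    have h1 := integral_mono hGli (i2.add (hTi.const_mul (4 / M ^ 2))) fun z => by
      change p z * (G z * log (G z)) ≤ (M * log M - M * (1 + log M)) * p z
        + (1 + log M) * (p z * G z) + (1 / (2 * M)) * (p z * (G z - M) ^ 2)
        + 4 / M ^ 2 * (p z * |G z - M| ^ 3)
      have := mul_le_mul_of_nonneg_left (mul_log_le_taylor (hc.trans_le (hGI z).1) hMpos)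
        (hppos z).le
      refine this.trans (le_of_eq ?_)
      ring
    simp only [Pi.add_apply] at h1
    rw [integral_add i2 (hTi.const_mul _), integral_add i1 (hVi.const_mul _),
      integral_add (hpi.const_mul _) (i0.const_mul _), integral_const_mul, integral_const_mul,
      integral_const_mul, integral_const_mul, hp1, i0'] at h1
    refine h1.trans (le_of_eq ?_)
    rw [← hV, ← hT]; ring
  have he_nonneg : 0 ≤ e := integral_nonneg fun q => by positivity
  have hV2 : V ≤ r ^ 2 * ‖v‖ ^ 2 + 3 * D * e := by linarith
  have hV3 : (1 / (2 * M)) * V ≤ r ^ 2 * C * ent P g + 3 * D * (e0 * r ^ 3) / (2 * c) := by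
    have h1 : (1 / (2 * M)) * V ≤ (1 / (2 * M)) * (r ^ 2 * (2 * C * M * ent P g) + 3 * D * e) := by
      gcongr
      refine hV2.trans ?_
      gcongr
    have h2 : (1 / (2 * M)) * (r ^ 2 * (2 * C * M * ent P g) + 3 * D * e)
        = r ^ 2 * C * ent P g + 3 * D * e / (2 * M) := by field_simp
    have h3 : 3 * D * e / (2 * M) ≤ 3 * D * (e0 * r ^ 3) / (2 * c) := by
      have := hMm.1
      gcongr
    linarith
  have hT2 : 4 / M ^ 2 * T ≤ 4 * (A ^ 3 * gaussMoment n + D ^ 2 * e0) * r ^ 3 / c ^ 2 := by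
    have h1 : T ≤ (A ^ 3 * gaussMoment n + D ^ 2 * e0) * r ^ 3 := by
      have : D ^ 2 * e ≤ D ^ 2 * (e0 * r ^ 3) := by gcongr
      linarith
    have h2 : 0 ≤ T := integral_nonneg fun z => by
      have := (hppos z).le
      positivity
    have := hMm.1
    calc 4 / M ^ 2 * T ≤ 4 / c ^ 2 * ((A ^ 3 * gaussMoment n + D ^ 2 * e0) * r ^ 3) := by
          gcongr
      _ = _ := by ring
  have hsc : stepConst n B c D * r ^ 3 = 3 * D * (e0 * r ^ 3) / (2 * c)
      + 4 * (A ^ 3 * gaussMoment n + D ^ 2 * e0) * r ^ 3 / c ^ 2 := by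
    simp only [stepConst]
    rw [← hA, ← he0]
    ring
  have hent : ent P g = ∫ x, g x * log (g x) ∂P - M * log M := by rw [ent, ← hM]
  rw [hsc]
  linarith

theorem neg_sq_add_inner_le {s : ℝ} (hs : 0 < s) (h : Euc n) (t : ℝ) (x : Euc n) :
    t * ‖x‖ + (-s * ‖x‖ ^ 2 + ⟪h, x⟫) ≤ (t + ‖h‖) ^ 2 / (4 * s) := by
  have h1 := real_inner_le_norm h x
  have h2 : (t + ‖h‖) * ‖x‖ - s * ‖x‖ ^ 2 ≤ (t + ‖h‖) ^ 2 / (4 * s) := by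
    rw [le_div_iff₀ (by positivity)]
    nlinarith [sq_nonneg (t + ‖h‖ - 2 * s * ‖x‖)]
  linarith

theorem continuous_neg_sq_add_inner (s : ℝ) (h : Euc n) :
    Continuous fun x : Euc n => -s * ‖x‖ ^ 2 + ⟪h, x⟫ := by
  fun_prop

theorem integrable_exp_neg_sq_add_inner (μ : Measure (Euc n)) [IsFiniteMeasure μ] {s : ℝ}
    (hs : 0 < s) (h : Euc n) (t : ℝ) :
    Integrable (fun x => exp (t * ‖x‖ + (-s * ‖x‖ ^ 2 + ⟪h, x⟫))) μ := by
  refine Integrable.of_bound (by fun_prop) (exp ((t + ‖h‖) ^ 2 / (4 * s)))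
    (Eventually.of_forall fun x => ?_)
  rw [norm_eq_abs, abs_exp]
  exact exp_le_exp.2 (neg_sq_add_inner_le hs h t x)

theorem integrable_exp_gtilt (μ : Measure (Euc n)) [IsFiniteMeasure μ] {s : ℝ}
    (hs : 0 < s) (h : Euc n) :
    Integrable (fun x => exp (-s * ‖x‖ ^ 2 + ⟪h, x⟫)) μ := by
  simpa using integrable_exp_neg_sq_add_inner μ hs h 0

theorem gtilt_eq_tilted (μ : Measure (Euc n)) [IsProbabilityMeasure μ] {s : ℝ} (hs : 0 < s)
    (h : Euc n) : gtilt μ s h = μ.tilted fun x => -s * ‖x‖ ^ 2 + ⟪h, x⟫ := by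
  have hZ := integral_exp_pos (integrable_exp_gtilt μ hs h)
  rw [gtilt, Measure.tilted, ← withDensity_smul]
  · congr 1
    ext x
    rw [Pi.smul_apply, smul_eq_mul, ENNReal.ofReal_div_of_pos hZ, mul_comm, div_eq_mul_inv]
  · fun_prop

theorem isProbabilityMeasure_gtilt (μ : Measure (Euc n)) [IsProbabilityMeasure μ] {s : ℝ}
    (hs : 0 < s) (h : Euc n) : IsProbabilityMeasure (gtilt μ s h) := by
  rw [gtilt_eq_tilted μ hs]
  exact isProbabilityMeasure_tilted (integrable_exp_gtilt μ hs h)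

theorem hasExpMoments_gtilt (μ : Measure (Euc n)) [IsProbabilityMeasure μ] {s : ℝ}
    (hs : 0 < s) (h : Euc n) : HasExpMoments (gtilt μ s h) := by
  intro t
  rw [gtilt_eq_tilted μ hs, integrable_tilted_iff (integrable_exp_gtilt μ hs h)]
  refine (integrable_exp_neg_sq_add_inner μ hs h t).congr (Eventually.of_forall fun x => ?_)
  simp only [smul_eq_mul]
  rw [← exp_add, add_comm]

theorem gtilt_tilted (μ : Measure (Euc n)) [IsProbabilityMeasure μ] {s : ℝ} (hs : 0 < s)
    {t : ℝ} (ht : 0 ≤ t) (h k : Euc n) :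
    (gtilt μ s h).tilted (fun x => -t * ‖x‖ ^ 2 + ⟪k, x⟫) = gtilt μ (s + t) (h + k) := by
  rw [gtilt_eq_tilted μ hs, gtilt_eq_tilted μ (by positivity),
    tilted_tilted (integrable_exp_gtilt μ hs h)]
  congr 1
  ext x
  simp only [Pi.add_apply, inner_add_left]
  ring

theorem gtilt_tilted_locExp (μ : Measure (Euc n)) [IsProbabilityMeasure μ] {s : ℝ} (hs : 0 < s)
    (h m : Euc n) (r : ℝ) (z : Euc n) :
    (gtilt μ s h).tilted (locExp m r z)
      = gtilt μ (s + r ^ 2 / 2) (h + (r • z + r ^ 2 • m)) := by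
  rw [← gtilt_tilted μ hs (by positivity),
    ← tilted_add_const _ _ (r * ⟪z, m⟫ + r ^ 2 / 2 * ‖m‖ ^ 2)]
  congr 1
  ext x
  rw [locExp, inner_sub_left, inner_add_left, real_inner_smul_left, real_inner_smul_left,
    norm_sub_sq_real, real_inner_comm x z, real_inner_comm x m, real_inner_comm m z]
  ring

theorem IsSubG.mono {P : Measure (Euc n)} {C C' : ℝ} (hP : IsSubG P C) (hC : C ≤ C') :
    IsSubG P C' where
  prob := hP.prob
  expMoments := hP.expMoments
  cov_le θ := (hP.cov_le θ).trans (by gcongr)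
  mgf_le θ := (hP.mgf_le θ).trans (by gcongr)

/-- Propagation of an entropy inequality to smaller Gaussian tilts. -/
theorem ent_gtilt_backward (μ : Measure (Euc n)) [IsProbabilityMeasure μ] {s₀ s₁ : ℝ}
    (hs₀ : 0 < s₀) (hs : s₀ ≤ s₁) {C : ℝ → ℝ} {B : ℝ} (hC0 : ∀ s, s₀ ≤ s → 0 < C s)
    (hCB : ∀ s, s₀ ≤ s → C s ≤ B) (hP : ∀ s, s₀ ≤ s → ∀ h, IsSubG (gtilt μ s h) (C s))
    {ω : ℝ → ℝ} {Ω δ₀ : ℝ} (hδ₀ : 0 < δ₀)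
    (hω0 : ∀ s ∈ Set.Icc s₀ s₁, 0 < ω s) (hωΩ : ∀ s ∈ Set.Icc s₀ s₁, ω s ≤ Ω)
    (hω : ∀ s δ, s₀ ≤ s → 0 < δ → δ ≤ δ₀ → s + δ ≤ s₁ → ω s ≤ ω (s + δ) * (1 - 2 * δ * C s))
    {g : Euc n → ℝ} (hg : Measurable g) {c D : ℝ} (hc : 0 < c) (h : ∀ x, g x ∈ Set.Icc c D)
    {w : Euc n → ℝ} (hw : Measurable w) {W : ℝ} (hW : ∀ x, |w x| ≤ W) {a b : ℝ}
    (hQ : ∀ k, ω s₁ * ent (gtilt μ s₁ k) g ≤ a * ∫ x, w x ∂(gtilt μ s₁ k) + b) (k : Euc n) :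
    ω s₀ * ent (gtilt μ s₀ k) g ≤ a * ∫ x, w x ∂(gtilt μ s₀ k) + b := by
  rcases hs.eq_or_lt with rfl | hlt
  · exact hQ k
  have hcD : c ≤ D := (h 0).1.trans (h 0).2
  have hBpos : 0 < B := (hC0 s₀ le_rfl).trans_le (hCB s₀ le_rfl)
  set K := stepConst n B c D with hK
  have hK0 : 0 ≤ K := by
    have hD : 0 < D := hc.trans_le hcD
    have hgm0 : 0 ≤ gaussMoment n := integral_nonneg fun z => by positivity
    rw [hK]; simp only [stepConst]; positivity
  set L := s₁ - s₀ with hL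
  have hLpos : 0 < L := sub_pos.2 hlt
  have hΩ0 : 0 < Ω := (hω0 s₀ ⟨le_rfl, hs⟩).trans_le (hωΩ s₀ ⟨le_rfl, hs⟩)
  have key (N : ℕ) (hN : 0 < N) (hN1 : L / N ≤ δ₀) (hN2 : L / N ≤ 1 / 2) (j : ℕ) (hj : j ≤ N)
      (k : Euc n) : ω (s₁ - j * (L / N)) * ent (gtilt μ (s₁ - j * (L / N)) k) g
        ≤ a * ∫ x, w x ∂(gtilt μ (s₁ - j * (L / N)) k) + b
          + j * (Ω * (K * √(2 * (L / N)) ^ 3)) := by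
    induction j generalizing k with
    | zero => simpa using hQ k
    | succ j ih =>
      have hNpos : (0 : ℝ) < N := by exact_mod_cast hN
      set δ := L / N with hδ
      have hδpos : 0 < δ := by positivity
      set s := s₁ - (j + 1 : ℕ) * δ with hs'
      have hsδ : s₁ - j * δ = s + δ := by rw [hs']; push_cast; ring
      have hss : s₀ ≤ s := by
        have : ((j + 1 : ℕ) : ℝ) * δ ≤ N * δ := by gcongr
        have h2 : N * δ = L := by rw [hδ]; field_simp
        rw [hs']; linarith
      have hspos := hs₀.trans_le hss
      have hss1 : s + δ ≤ s₁ := by rw [← hsδ]; have : 0 ≤ j * δ := by positivity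
                                   linarith
      rw [hsδ] at ih
      have hr2 : √(2 * δ) ^ 2 = 2 * δ := sq_sqrt (by positivity)
      have hωδ := hω0 (s + δ) ⟨by linarith, hss1⟩
      have hst := (hP s hss k).ent_step (hC0 s hss) (hCB s hss) (r := √(2 * δ))
        (sqrt_pos.2 (by positivity)) (sqrt_le_one.2 (by linarith)) (by
          rw [gtilt_tilted_locExp μ hspos]
          exact (hP _ (by rw [hr2]; linarith) _).mono (hCB _ (by rw [hr2]; linarith)))
        hg hc h hw hW (a := a / ω (s + δ))
        (b := (b + j * (Ω * (K * √(2 * δ) ^ 3))) / ω (s + δ)) (fun z => by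
          rw [gtilt_tilted_locExp μ hspos, hr2, mul_div_cancel_left₀ _ two_ne_zero]
          have := ih (by omega) (k + (√(2 * δ) • z + (2 * δ) • bary (gtilt μ s k)))
          rw [← mul_le_mul_iff_right₀ hωδ]
          refine this.trans (le_of_eq ?_)
          field_simp
          ring)
      rw [hr2] at hst
      have hpr := isProbabilityMeasure_gtilt μ hspos k
      have hE := ent_nonneg_of_mem_Icc (P := gtilt μ s k) hg hc h
      have h1 := mul_le_mul_of_nonneg_right (hω s δ hss hδpos hN1 hss1) hE
      have h2 := mul_le_mul_of_nonneg_left hst hωδ.le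
      have h3 : ω (s + δ) * (K * √(2 * δ) ^ 3) ≤ Ω * (K * √(2 * δ) ^ 3) := by
        gcongr
        exact hωΩ _ ⟨by linarith, hss1⟩
      have h4 : ω (s + δ) * (a / ω (s + δ) * ∫ x, w x ∂(gtilt μ s k)
          + (b + j * (Ω * (K * √(2 * δ) ^ 3))) / ω (s + δ) + K * √(2 * δ) ^ 3)
          = a * ∫ x, w x ∂(gtilt μ s k) + b + j * (Ω * (K * √(2 * δ) ^ 3))
            + ω (s + δ) * (K * √(2 * δ) ^ 3) := by
        field_simp
        ring
      rw [h4] at h2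
      push_cast
      linarith
  have hδlim : Tendsto (fun N : ℕ => L / N) atTop (𝓝 0) := tendsto_const_div_atTop_nhds_zero_nat L
  have hlim : Tendsto (fun N : ℕ => a * ∫ x, w x ∂(gtilt μ s₀ k) + b
      + Ω * K * (2 * L) * √(2 * (L / N))) atTop
      (𝓝 (a * ∫ x, w x ∂(gtilt μ s₀ k) + b)) := by
    have h1 := ((hδlim.const_mul 2).sqrt.const_mul (Ω * K * (2 * L))).const_add
      (a * ∫ x, w x ∂(gtilt μ s₀ k) + b)
    simpa using h1
  refine ge_of_tendsto hlim ?_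
  filter_upwards [eventually_gt_atTop 0, hδlim.eventually_le_const hδ₀,
    hδlim.eventually_le_const (by norm_num : (0 : ℝ) < 1 / 2)] with N hN h1 h2
  have hNpos : (0 : ℝ) < N := by exact_mod_cast hN
  have h3 := key N hN h1 h2 N le_rfl k
  have h4 : N * (L / N) = L := by field_simp
  have h5 : s₁ - N * (L / N) = s₀ := by rw [h4, hL]; ring
  rw [h5] at h3
  refine h3.trans (le_of_eq ?_)
  have h6 : √(2 * (L / N)) ^ 3 = 2 * (L / N) * √(2 * (L / N)) := by
    rw [pow_succ, sq_sqrt (by positivity)]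
  rw [h6]
  linear_combination (2 * Ω * K * √(2 * (L / N))) * h4

theorem volume_add_le_of_midpoint_mem_of_isCompact {A B S : Set ℝ} (hA : IsCompact A)
    (hB : IsCompact B) (hA0 : A.Nonempty) (hB0 : B.Nonempty)
    (h : ∀ x ∈ A, ∀ y ∈ B, (x + y) / 2 ∈ S) : volume A + volume B ≤ 2 * volume S := by
  obtain ⟨a, ha, ha'⟩ := hA.exists_isGreatest hA0
  obtain ⟨b, hb, hb'⟩ := hB.exists_isLeast hB0
  have hS : volume ((fun x : ℝ => 2⁻¹ * x) ⁻¹' S) = 2 * volume S := by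
    rw [Real.volume_preimage_mul_left (by norm_num)]
    norm_num
  have h1 : volume ((fun x => -b + x) ⁻¹' A) = volume A := measure_preimage_add _ _ _
  have h2 : volume ((fun x => -a + x) ⁻¹' B) = volume B := measure_preimage_add _ _ _
  have hm1 : MeasurableSet ((fun x => -a + x) ⁻¹' B) :=
    (measurable_const_add (-a)) hB.measurableSet
  have hdis : AEDisjoint volume ((fun x => -b + x) ⁻¹' A) ((fun x => -a + x) ⁻¹' B) := by
    refine measure_mono_null (t := {a + b}) (fun x hx => ?_) (by simp)
    have e1 := ha' hx.1
    have e2 := hb' hx.2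
    simp only [Set.mem_singleton_iff] at *
    linarith
  rw [← hS, ← h1, ← h2, ← measure_union₀ hm1.nullMeasurableSet hdis]
  refine measure_mono (Set.union_subset (fun x hx => ?_) fun x hx => ?_)
  · have := h _ hx b hb
    have e : (-b + x + b) / 2 = 2⁻¹ * x := by ring
    rwa [e] at this
  · have := h a ha _ hx
    have e : (a + (-a + x)) / 2 = 2⁻¹ * x := by ring
    rwa [e] at this

/-- The one-dimensional Brunn-Minkowski inequality. -/
theorem volume_add_le_of_midpoint_mem {A B S : Set ℝ} (hA : MeasurableSet A)
    (hB : MeasurableSet B) (hA0 : A.Nonempty) (hB0 : B.Nonempty)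
    (h : ∀ x ∈ A, ∀ y ∈ B, (x + y) / 2 ∈ S) : volume A + volume B ≤ 2 * volume S := by
  have approx {E : Set ℝ} (hE : MeasurableSet E) (hE0 : E.Nonempty) {t : ℝ≥0∞}
      (ht : t < volume E) : ∃ K ⊆ E, IsCompact K ∧ K.Nonempty ∧ t < volume K := by
    obtain ⟨K, hK, hKc, hKt⟩ := hE.exists_lt_isCompact ht
    refine ⟨K, hK, hKc, ?_, hKt⟩
    rw [Set.nonempty_iff_ne_empty]
    rintro rfl
    simp at hKt
  have single {E : Set ℝ} (hE0 : E.Nonempty) : ∃ K ⊆ E, IsCompact K ∧ K.Nonempty := by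
    obtain ⟨x, hx⟩ := hE0
    exact ⟨{x}, by simpa using hx, isCompact_singleton, by simp⟩
  have le_of {E : Set ℝ} (hE : MeasurableSet E) (hE0 : E.Nonempty) {u v : ℝ≥0∞}
      (hK : ∀ K ⊆ E, IsCompact K → K.Nonempty → volume K + u ≤ v) : volume E + u ≤ v := by
    obtain ⟨K₀, hK₀, hK₀c, hK₀n⟩ := single hE0
    have hu : u ≤ v := le_add_self.trans (hK K₀ hK₀ hK₀c hK₀n)
    rcases eq_or_ne u ⊤ with rfl | hu'
    · rw [top_le_iff.1 hu]; exact le_top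
    refine (ENNReal.le_sub_iff_add_le_right hu' hu).1 (le_of_forall_lt fun t ht => ?_)
    obtain ⟨K, hKE, hKc, hKn, hKt⟩ := approx hE hE0 ht
    exact hKt.trans_le (ENNReal.le_sub_of_add_le_right hu' (hK K hKE hKc hKn))
  refine le_of hA hA0 fun K hK hKc hKn => ?_
  rw [add_comm]
  refine le_of hB hB0 fun K' hK' hKc' hKn' => ?_
  rw [add_comm]
  exact volume_add_le_of_midpoint_mem_of_isCompact hKc hKc' hKn hKn'
    fun x hx y hy => h x (hK hx) y (hK' hy)

theorem lintegral_add_le_of_mul_le_sq {f g h : ℝ → ℝ} (hf : Measurable f) (hg : Measurable g)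
    (hh : Measurable h) (hf0 : ∀ x, 0 ≤ f x) (hg0 : ∀ x, 0 ≤ g x) (hh0 : ∀ x, 0 ≤ h x)
    (hfs : IsLUB (Set.range f) 1) (hgs : IsLUB (Set.range g) 1)
    (H : ∀ x y, f x * g y ≤ h ((x + y) / 2) ^ 2) :
    (∫⁻ x, ENNReal.ofReal (f x)) + ∫⁻ x, ENNReal.ofReal (g x)
      ≤ 2 * ∫⁻ x, ENNReal.ofReal (h x) := by
  rw [lintegral_eq_lintegral_meas_lt _ (ae_of_all _ hf0) hf.aemeasurable,
    lintegral_eq_lintegral_meas_lt _ (ae_of_all _ hg0) hg.aemeasurable,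
    lintegral_eq_lintegral_meas_lt _ (ae_of_all _ hh0) hh.aemeasurable,
    ← lintegral_const_mul' _ _ ENNReal.ofNat_ne_top]
  have hanti (φ : ℝ → ℝ) : Antitone fun t : ℝ => volume {a | t < φ a} :=
    fun s t hst => measure_mono fun x hx => hst.trans_lt hx
  rw [← lintegral_add_left (hanti f).measurable]
  refine setLIntegral_mono ((hanti h).measurable.const_mul 2) fun t ht => ?_
  rw [Set.mem_Ioi] at ht
  rcases lt_or_ge t 1 with h1 | h1
  · refine volume_add_le_of_midpoint_mem (measurableSet_lt measurable_const hf)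
      (measurableSet_lt measurable_const hg) ?_ ?_ fun x hx y hy => ?_
    · obtain ⟨_, ⟨x, rfl⟩, hx⟩ := (lt_isLUB_iff hfs).1 h1
      exact ⟨x, hx⟩
    · obtain ⟨_, ⟨x, rfl⟩, hx⟩ := (lt_isLUB_iff hgs).1 h1
      exact ⟨x, hx⟩
    · refine lt_of_pow_lt_pow_left₀ 2 (hh0 _) (lt_of_lt_of_le ?_ (H x y))
      rw [sq]
      exact mul_lt_mul'' hx hy ht.le ht.le
  · have e {φ : ℝ → ℝ} (hφ : IsLUB (Set.range φ) 1) : {a | t < φ a} = ∅ := by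
      ext x
      simpa using (hφ.1 ⟨x, rfl⟩).trans h1
    simp [e hfs, e hgs]

theorem lintegral_mul_le_sq_of_bounded {f g h : ℝ → ℝ} (hf : Measurable f) (hg : Measurable g)
    (hh : Measurable h) (hf0 : ∀ x, 0 ≤ f x) (hg0 : ∀ x, 0 ≤ g x) (hh0 : ∀ x, 0 ≤ h x)
    (hfb : BddAbove (Set.range f)) (hgb : BddAbove (Set.range g))
    (H : ∀ x y, f x * g y ≤ h ((x + y) / 2) ^ 2) :
    (∫⁻ x, ENNReal.ofReal (f x)) * ∫⁻ x, ENNReal.ofReal (g x)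
      ≤ (∫⁻ x, ENNReal.ofReal (h x)) ^ 2 := by
  by_cases hfz : ∀ x, f x = 0
  · simp [hfz]
  by_cases hgz : ∀ x, g x = 0
  · simp [hgz]
  push Not at hfz hgz
  have lub {φ : ℝ → ℝ} (hφ0 : ∀ x, 0 ≤ φ x) (hφb : BddAbove (Set.range φ)) (hφ : ∃ x, φ x ≠ 0) :
      ∃ A, 0 < A ∧ IsLUB (Set.range fun x => φ x / A) 1 := by
    have h1 := isLUB_csSup (Set.range_nonempty φ) hφb
    obtain ⟨x, hx⟩ := hφ
    have h2 : 0 < sSup (Set.range φ) := (lt_of_le_of_ne (hφ0 x) hx.symm).trans_le (h1.1 ⟨x, rfl⟩)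
    refine ⟨_, h2, ?_, fun b hb => ?_⟩
    · rintro _ ⟨y, rfl⟩
      exact (div_le_one h2).2 (h1.1 ⟨y, rfl⟩)
    · have h3 : sSup (Set.range φ) ≤ b * sSup (Set.range φ) := h1.2 (by
        rintro _ ⟨y, rfl⟩
        exact (div_le_iff₀ h2).1 (hb ⟨y, rfl⟩))
      nlinarith
  obtain ⟨A, hA, hAl⟩ := lub hf0 hfb hfz
  obtain ⟨B, hB, hBl⟩ := lub hg0 hgb hgz
  have key := lintegral_add_le_of_mul_le_sq (hf.div_const A) (hg.div_const B)
    (hh.div_const √(A * B)) (fun x => div_nonneg (hf0 x) hA.le)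
    (fun x => div_nonneg (hg0 x) hB.le) (fun x => div_nonneg (hh0 x) (sqrt_nonneg _)) hAl hBl
    fun x y => by
      rw [div_mul_div_comm, div_pow, sq_sqrt (by positivity)]
      gcongr
      exact H x y
  have hAB : 0 < √(A * B) := sqrt_pos.2 (by positivity)
  have scale (φ : ℝ → ℝ) {a : ℝ} (ha : 0 < a) : ∫⁻ x, ENNReal.ofReal (φ x / a)
      = ENNReal.ofReal a⁻¹ * ∫⁻ x, ENNReal.ofReal (φ x) := by
    rw [← lintegral_const_mul' _ _ ENNReal.ofReal_ne_top]
    congr 1; ext x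
    rw [← ENNReal.ofReal_mul (by positivity), div_eq_inv_mul]
  rw [scale f hA, scale g hB, scale h hAB] at key
  generalize ∫⁻ x, ENNReal.ofReal (f x) = u at *
  generalize ∫⁻ x, ENNReal.ofReal (g x) = v at *
  generalize ∫⁻ x, ENNReal.ofReal (h x) = w at *
  rcases eq_or_ne w ⊤ with rfl | hw
  · simp
  have hA' : ENNReal.ofReal A⁻¹ ≠ 0 := by simpa using hA
  have hB' : ENNReal.ofReal B⁻¹ ≠ 0 := by simpa using hB
  have hfin : 2 * (ENNReal.ofReal (√(A * B))⁻¹ * w) ≠ ⊤ :=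
    ENNReal.mul_ne_top (by simp) (ENNReal.mul_ne_top ENNReal.ofReal_ne_top hw)
  have hu : u ≠ ⊤ := by
    rintro rfl
    rw [ENNReal.mul_top hA', top_add, top_le_iff] at key
    exact hfin key
  have hv : v ≠ ⊤ := by
    rintro rfl
    rw [ENNReal.mul_top hB', add_top, top_le_iff] at key
    exact hfin key
  lift u to ℝ≥0 using hu
  lift v to ℝ≥0 using hv
  lift w to ℝ≥0 using hw
  have key' := ENNReal.toReal_mono hfin key
  rw [ENNReal.toReal_add (ENNReal.mul_ne_top ENNReal.ofReal_ne_top ENNReal.coe_ne_top)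
    (ENNReal.mul_ne_top ENNReal.ofReal_ne_top ENNReal.coe_ne_top)] at key'
  simp only [ENNReal.toReal_mul, ENNReal.toReal_ofReal (inv_nonneg.2 hA.le),
    ENNReal.toReal_ofReal (inv_nonneg.2 hB.le), ENNReal.toReal_ofReal (inv_nonneg.2 hAB.le),
    ENNReal.coe_toReal, ENNReal.toReal_ofNat] at key'
  have h2 : (u : ℝ) * v ≤ w ^ 2 := by
    have e1 : 4 * ((A⁻¹ * u) * (B⁻¹ * v)) ≤ (2 * ((√(A * B))⁻¹ * w)) ^ 2 := by
      refine le_trans ?_ (pow_le_pow_left₀ (by positivity) key' 2)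
      nlinarith [sq_nonneg (A⁻¹ * (u : ℝ) - B⁻¹ * v)]
    have e2 : (2 * ((√(A * B))⁻¹ * w)) ^ 2 = 4 * w ^ 2 / (A * B) := by
      rw [mul_pow, mul_pow, inv_pow, sq_sqrt (by positivity)]
      ring
    rw [e2, le_div_iff₀ (by positivity)] at e1
    have e3 : 4 * ((A⁻¹ * (u : ℝ)) * (B⁻¹ * v)) * (A * B) = 4 * (u * v) := by field_simp
    linarith
  exact_mod_cast h2

/-- The midpoint form of the Prékopa-Leindler inequality for a measure. -/
def PrekopaLeindler {V : Type*} [MeasurableSpace V] [AddCommGroup V] [Module ℝ V]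
    (μ : Measure V) : Prop :=
  ∀ f g h : V → ℝ≥0∞, Measurable f → Measurable g → Measurable h →
    (∀ x y, f x * g y ≤ h ((2⁻¹ : ℝ) • (x + y)) ^ 2) →
    (∫⁻ x, f x ∂μ) * ∫⁻ x, g x ∂μ ≤ (∫⁻ x, h x ∂μ) ^ 2

theorem lintegral_eq_iSup_min {V : Type*} [MeasurableSpace V] (μ : Measure V) {f : V → ℝ≥0∞}
    (hf : Measurable f) : ∫⁻ x, f x ∂μ = ⨆ N : ℕ, ∫⁻ x, min (f x) N ∂μ := by
  rw [← lintegral_iSup (fun N => hf.min measurable_const)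
    fun N M hNM x => min_le_min_left _ (by exact_mod_cast hNM)]
  congr 1
  ext x
  refine le_antisymm (le_of_forall_lt fun t ht => ?_) (iSup_le fun N => min_le_left _ _)
  obtain ⟨N, hN⟩ := ENNReal.exists_nat_gt ht.ne_top
  exact (lt_min ht hN).trans_le (le_iSup (fun N : ℕ => min (f x) N) N)

theorem prekopaLeindler_real : PrekopaLeindler (volume : Measure ℝ) := by
  intro f g h hf hg hh H
  have key (N : ℕ) : (∫⁻ x, min (f x) N) * ∫⁻ x, min (g x) N ≤ (∫⁻ x, h x) ^ 2 := by
    have hfin (φ : ℝ → ℝ≥0∞) (x : ℝ) : min (φ x) N ≠ ⊤ :=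
      ((min_le_right _ _).trans_lt (ENNReal.natCast_lt_top N)).ne
    have hbd (φ : ℝ → ℝ≥0∞) : BddAbove (Set.range fun x => (min (φ x) N).toReal) := by
      refine ⟨N, ?_⟩
      rintro _ ⟨x, rfl⟩
      exact ENNReal.toReal_le_of_le_ofReal (by positivity) (by simp)
    have h1 := lintegral_mul_le_sq_of_bounded
      (f := fun x => (min (f x) N).toReal) (g := fun x => (min (g x) N).toReal)
      (h := fun x => (min (h x) N).toReal)
      (hf.min measurable_const).ennreal_toReal (hg.min measurable_const).ennreal_toReal
      (hh.min measurable_const).ennreal_toReal (fun x => ENNReal.toReal_nonneg)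
      (fun x => ENNReal.toReal_nonneg) (fun x => ENNReal.toReal_nonneg) (hbd f) (hbd g)
      fun x y => by
        rw [← ENNReal.toReal_mul, ← ENNReal.toReal_pow]
        refine ENNReal.toReal_mono (ENNReal.pow_ne_top (hfin h _)) ?_
        have e : (2⁻¹ : ℝ) • (x + y) = (x + y) / 2 := by rw [smul_eq_mul]; ring
        have h2 := H x y
        rw [e] at h2
        rcases le_total (h ((x + y) / 2)) N with h3 | h3
        · rw [min_eq_left h3]
          exact (mul_le_mul' (min_le_left _ _) (min_le_left _ _)).trans h2
        · rw [min_eq_right h3, sq]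
          exact mul_le_mul' (min_le_right _ _) (min_le_right _ _)
    simp only [ENNReal.ofReal_toReal (hfin _ _)] at h1
    refine h1.trans (pow_le_pow_left₀ bot_le (lintegral_mono fun x => min_le_left _ _) 2)
  have hmono (φ : ℝ → ℝ≥0∞) : Monotone fun N : ℕ => ∫⁻ x, min (φ x) N :=
    fun N M hNM => lintegral_mono fun x => min_le_min_left _ (by exact_mod_cast hNM)
  rw [lintegral_eq_iSup_min _ hf, lintegral_eq_iSup_min _ hg,
    ENNReal.iSup_mul]
  refine iSup_le fun N => ?_
  rw [ENNReal.mul_iSup]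
  exact iSup_le fun M => (mul_le_mul' (hmono f (le_max_left N M))
    (hmono g (le_max_right N M))).trans (key (max N M))

theorem PrekopaLeindler.prod {V W : Type*} [MeasurableSpace V] [AddCommGroup V] [Module ℝ V]
    [MeasurableSpace W] [AddCommGroup W] [Module ℝ W] {μ : Measure V} {ν : Measure W}
    [SFinite ν] (hμ : PrekopaLeindler μ) (hν : PrekopaLeindler ν) :
    PrekopaLeindler (μ.prod ν) := by
  intro f g h hf hg hh H
  rw [lintegral_prod _ hf.aemeasurable, lintegral_prod _ hg.aemeasurable,
    lintegral_prod _ hh.aemeasurable]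
  refine hμ _ _ _ hf.lintegral_prod_right' hg.lintegral_prod_right' hh.lintegral_prod_right'
    fun x y => ?_
  exact hν _ _ _ (hf.comp measurable_prodMk_left) (hg.comp measurable_prodMk_left)
    (hh.comp measurable_prodMk_left) fun u v => H (x, u) (y, v)

theorem PrekopaLeindler.of_measurePreserving {V W : Type*} [MeasurableSpace V] [AddCommGroup V]
    [Module ℝ V] [MeasurableSpace W] [AddCommGroup W] [Module ℝ W] {μ : Measure V}
    {ν : Measure W} (hμ : PrekopaLeindler μ) {e : V → W} (he : MeasurePreserving e μ ν)
    (hmid : ∀ x y, e ((2⁻¹ : ℝ) • (x + y)) = (2⁻¹ : ℝ) • (e x + e y)) :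
    PrekopaLeindler ν := by
  intro f g h hf hg hh H
  rw [← he.lintegral_comp hf, ← he.lintegral_comp hg, ← he.lintegral_comp hh]
  refine hμ _ _ _ (hf.comp he.measurable) (hg.comp he.measurable) (hh.comp he.measurable)
    fun x y => ?_
  rw [hmid]
  exact H _ _

theorem prekopaLeindler_pi (n : ℕ) : PrekopaLeindler (volume : Measure (Fin n → ℝ)) := by
  induction n with
  | zero =>
    intro f g h hf hg hh H
    rw [volume_pi, Measure.pi_of_empty (fun _ => volume) 0, lintegral_dirac' _ hf,
      lintegral_dirac' _ hg, lintegral_dirac' _ hh]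
    simpa using H 0 0
  | succ n ih =>
    refine (prekopaLeindler_real.prod ih).of_measurePreserving
      (volume_preserving_piFinSuccAbove (fun _ => ℝ) (0 : Fin (n + 1))).symm fun x y => ?_
    ext i
    refine Fin.cases ?_ (fun j => ?_) i <;>
      simp [MeasurableEquiv.piFinSuccAbove, mul_add]

theorem prekopaLeindler_euc (n : ℕ) : PrekopaLeindler (volume : Measure (Euc n)) :=
  (prekopaLeindler_pi n).of_measurePreserving
    (EuclideanSpace.volume_preserving_symm_measurableEquiv_toLp (Fin n)).symm fun x y => by
      ext i; simp

theorem one_add_add_sq_sub_le_exp (u : ℝ) : 1 + u + u ^ 2 / 2 - |u| ^ 3 ≤ exp u := by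
  rcases le_or_gt |u| 1 with h | h
  · have h1 := Real.exp_bound h (n := 3) (by norm_num)
    norm_num [Finset.sum_range_succ, Nat.factorial] at h1
    have h2 := (abs_le.1 h1).1
    nlinarith [pow_nonneg (abs_nonneg u) 3]
  · rcases le_or_gt 0 u with h0 | h0
    · have := quadratic_le_exp_of_nonneg h0
      nlinarith [pow_nonneg (abs_nonneg u) 3]
    · rw [abs_of_neg h0] at h ⊢
      refine le_trans ?_ (exp_pos u).le
      nlinarith [mul_nonneg (sq_nonneg u) (by linarith : 0 ≤ -u - 1)]

theorem IsLogConcave.mul_le_sq {μ : Measure (Euc n)} (hμ : IsLogConcave μ) :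
    ∃ d : Euc n → ℝ, Measurable d ∧ (∀ x, 0 ≤ d x) ∧
      (∀ x y, d x * d y ≤ d ((2⁻¹ : ℝ) • (x + y)) ^ 2) ∧
      μ = volume.withDensity fun x => ENNReal.ofReal (d x) := by
  obtain ⟨d, hd, hd0, h, rfl⟩ := hμ
  refine ⟨d, hd, hd0, fun x y => ?_, rfl⟩
  have h1 := h x y (1 / 2) (1 / 2) (by norm_num) (by norm_num) (by norm_num)
  rw [← sqrt_eq_rpow, ← sqrt_eq_rpow, ← smul_add, one_div] at h1
  calc d x * d y = (√(d x) * √(d y)) ^ 2 := by rw [mul_pow, sq_sqrt (hd0 x), sq_sqrt (hd0 y)]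
    _ ≤ _ := pow_le_pow_left₀ (by positivity) h1 2

/-- A Gaussian tilt of a log-concave measure has strongly sub-gaussian differences. -/
theorem IsLogConcave.integral_exp_mul_integral_exp_neg_le {μ : Measure (Euc n)}
    [IsProbabilityMeasure μ] (hμ : IsLogConcave μ) {s : ℝ} (hs : 0 < s) (k h : Euc n) :
    (∫ x, exp ⟪h, x⟫ ∂(gtilt μ s k)) * ∫ x, exp ⟪-h, x⟫ ∂(gtilt μ s k)
      ≤ exp (‖h‖ ^ 2 / (2 * s)) := by
  obtain ⟨d, hd, hd0, hdd, hμd⟩ := hμ.mul_le_sq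
  have hpr := isProbabilityMeasure_gtilt μ hs k
  have hexpM := hasExpMoments_gtilt μ hs k
  set q : Euc n → ℝ := fun x => -s * ‖x‖ ^ 2 + ⟪k, x⟫ with hq
  set Z := ∫ x, exp (q x) ∂μ with hZ
  have hqm : Measurable q := (continuous_neg_sq_add_inner s k).measurable
  have hZ0 : 0 < Z := integral_exp_pos (integrable_exp_gtilt μ hs k)
  have hp : gtilt μ s k
      = volume.withDensity fun x => ENNReal.ofReal (d x * (exp (q x) / Z)) := by
    rw [gtilt_eq_tilted μ hs, Measure.tilted]
    change μ.withDensity (fun x => ENNReal.ofReal (exp (q x) / Z)) = _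
    conv_lhs => rw [hμd]
    rw [← withDensity_mul _ (by fun_prop) (by fun_prop)]
    congr 1
    ext x
    rw [Pi.mul_apply, ENNReal.ofReal_mul (hd0 x)]
  set p : Euc n → ℝ := fun x => d x * (exp (q x) / Z) with hpdef
  have hpm : Measurable p := by fun_prop
  have hp0 (x : Euc n) : 0 ≤ p x := mul_nonneg (hd0 x) (by positivity)
  have hlin (φ : Euc n → ℝ) (hφ : Measurable φ) : ∫⁻ x, ENNReal.ofReal (φ x) ∂(gtilt μ s k)
      = ∫⁻ x, ENNReal.ofReal (p x * φ x) := by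
    rw [hp, lintegral_withDensity_eq_lintegral_mul _ (by fun_prop) (by fun_prop)]
    congr 1
    ext x
    rw [Pi.mul_apply, ENNReal.ofReal_mul (hp0 x)]
  have hone : ∫⁻ x, ENNReal.ofReal (p x) = 1 := by
    have := hlin (fun _ => 1) measurable_const
    simpa using this.symm
  have hpp (x y : Euc n) : (p x * exp ⟪h, x⟫) * (p y * exp ⟪-h, y⟫)
      ≤ (p ((2⁻¹ : ℝ) • (x + y)) * exp (‖h‖ ^ 2 / (4 * s))) ^ 2 := by
    set z := (2⁻¹ : ℝ) • (x + y) with hz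
    have e1 : q x + q y + ⟪h, x⟫ + ⟪-h, y⟫ ≤ 2 * q z + 2 * (‖h‖ ^ 2 / (4 * s)) := by
      have e2 : q x + q y = 2 * q z - s / 2 * ‖x - y‖ ^ 2 := by
        simp only [hq, hz, norm_smul, inner_smul_right, inner_add_right, mul_pow,
          norm_add_sq_real, norm_sub_sq_real, norm_inv, norm_ofNat]
        ring
      have e3 : ⟪h, x⟫ + ⟪-h, y⟫ = ⟪h, x - y⟫ := by
        rw [inner_neg_left, inner_sub_right]; ring
      have e4 := real_inner_le_norm h (x - y)
      have e5 : ‖h‖ * ‖x - y‖ - s / 2 * ‖x - y‖ ^ 2 ≤ 2 * (‖h‖ ^ 2 / (4 * s)) := by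
        rw [← mul_div_assoc, le_div_iff₀ (by positivity)]
        nlinarith [sq_nonneg (‖h‖ - s * ‖x - y‖)]
      linarith
    calc (p x * exp ⟪h, x⟫) * (p y * exp ⟪-h, y⟫)
        = (d x * d y) * (exp (q x + q y + ⟪h, x⟫ + ⟪-h, y⟫) / Z ^ 2) := by
          simp only [hpdef, exp_add]; ring
      _ ≤ d z ^ 2 * (exp (2 * q z + 2 * (‖h‖ ^ 2 / (4 * s))) / Z ^ 2) := by
          gcongr
          exact hdd x y
      _ = _ := by
          rw [← mul_add, two_mul, exp_add, exp_add]
          simp only [hpdef]; ring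
  have hPL := prekopaLeindler_euc n (fun x => ENNReal.ofReal (p x * exp ⟪h, x⟫))
    (fun x => ENNReal.ofReal (p x * exp ⟪-h, x⟫))
    (fun x => ENNReal.ofReal (p x * exp (‖h‖ ^ 2 / (4 * s)))) (by fun_prop) (by fun_prop)
    (by fun_prop) fun x y => by
      rw [← ENNReal.ofReal_mul (mul_nonneg (hp0 x) (exp_pos _).le),
        ← ENNReal.ofReal_pow (mul_nonneg (hp0 _) (exp_pos _).le)]
      exact ENNReal.ofReal_le_ofReal (hpp x y)
  rw [← hlin (fun x => exp ⟪h, x⟫) (by fun_prop), ← hlin (fun x => exp ⟪-h, x⟫) (by fun_prop),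
    ← ofReal_integral_eq_lintegral_ofReal (hexpM.integrable_exp_inner h 0 |>.congr (by simp))
      (ae_of_all _ fun x => (exp_pos _).le),
    ← ofReal_integral_eq_lintegral_ofReal (hexpM.integrable_exp_inner (-h) 0 |>.congr (by simp))
      (ae_of_all _ fun x => (exp_pos _).le)] at hPL
  have e6 : ∫⁻ x, ENNReal.ofReal (p x * exp (‖h‖ ^ 2 / (4 * s)))
      = ENNReal.ofReal (exp (‖h‖ ^ 2 / (4 * s))) := by
    simp only [ENNReal.ofReal_mul (hp0 _)]
    rw [lintegral_mul_const _ (by fun_prop), hone, one_mul]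
  rw [e6, ← ENNReal.ofReal_mul (integral_nonneg fun x => (exp_pos _).le),
    ← ENNReal.ofReal_pow (exp_pos _).le, ENNReal.ofReal_le_ofReal_iff (by positivity),
    ← exp_nat_mul] at hPL
  refine hPL.trans (le_of_eq ?_)
  congr 1
  push_cast
  field_simp
  ring

/-- A second order expansion of a symmetrized Laplace transform bound. -/
theorem HasExpMoments.integral_inner_sq_le {P : Measure (Euc n)} [IsProbabilityMeasure P]
    (hP : HasExpMoments P) {C : ℝ}
    (h : ∀ θ, (∫ x, exp ⟪θ, x⟫ ∂P) * ∫ x, exp ⟪-θ, x⟫ ∂P ≤ exp (C * ‖θ‖ ^ 2)) {θ : Euc n}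
    (hθ : ‖θ‖ = 1) : ∫ x, ⟪θ, x - bary P⟫ ^ 2 ∂P ≤ C := by
  set m := bary P with hm
  set v := ∫ x, ⟪θ, x - m⟫ ^ 2 ∂P with hv
  set κ := ∫ x, |⟪θ, x - m⟫| ^ 3 ∂P with hκ
  have i1 : Integrable (fun x => ⟪θ, x - m⟫) P := by
    simpa using hP.integrable_inner_sub_pow θ m 1
  have i2 : Integrable (fun x => ⟪θ, x - m⟫ ^ 2) P := hP.integrable_inner_sub_pow θ m 2
  have i3 : Integrable (fun x => |⟪θ, x - m⟫| ^ 3) P := by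
    simpa only [abs_pow] using (hP.integrable_inner_sub_pow θ m 3).abs
  have hv0 : 0 ≤ v := integral_nonneg fun x => sq_nonneg _
  have lower (ε : ℝ) : 1 + ε ^ 2 / 2 * v - |ε| ^ 3 * κ ≤ ∫ x, exp ⟪ε • θ, x - m⟫ ∂P := by
    have j1 : Integrable (fun x => 1 + ε * ⟪θ, x - m⟫) P := (integrable_const 1).add (i1.const_mul ε)
    have j2 : Integrable (fun x => 1 + ε * ⟪θ, x - m⟫ + ε ^ 2 / 2 * ⟪θ, x - m⟫ ^ 2) P :=
      j1.add (i2.const_mul _)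
    have h1 := integral_mono (j2.sub (i3.const_mul (|ε| ^ 3)))
      (hP.integrable_exp_inner_sub (ε • θ) m) fun x => by
        change 1 + ε * ⟪θ, x - m⟫ + ε ^ 2 / 2 * ⟪θ, x - m⟫ ^ 2 - |ε| ^ 3 * |⟪θ, x - m⟫| ^ 3
          ≤ exp ⟪ε • θ, x - m⟫
        refine le_trans (le_of_eq ?_) (one_add_add_sq_sub_le_exp _)
        rw [real_inner_smul_left, abs_mul]
        ring
    simp only [Pi.sub_apply] at h1
    rw [integral_sub j2 (i3.const_mul _), integral_add j1 (i2.const_mul _),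
      integral_add (integrable_const 1) (i1.const_mul ε), integral_const_mul, integral_const_mul,
      integral_const_mul, hm, hP.integral_inner_sub_bary θ] at h1
    simpa using h1
  have shift (ξ : Euc n) : ∫ x, exp ⟪ξ, x - m⟫ ∂P = exp (-⟪ξ, m⟫) * ∫ x, exp ⟪ξ, x⟫ ∂P := by
    rw [← integral_const_mul]
    congr 1; ext x
    rw [inner_sub_right, ← exp_add]; congr 1; ring
  have upper (ξ : Euc n) : (∫ x, exp ⟪ξ, x - m⟫ ∂P) * ∫ x, exp ⟪-ξ, x - m⟫ ∂P
      ≤ exp (C * ‖ξ‖ ^ 2) := by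
    rw [shift, shift]
    refine le_trans (le_of_eq ?_) (h ξ)
    have : exp (-⟪ξ, m⟫) * exp (-⟪-ξ, m⟫) = 1 := by
      rw [← exp_add, inner_neg_left]; simp
    linear_combination ((∫ x, exp ⟪ξ, x⟫ ∂P) * ∫ x, exp ⟪-ξ, x⟫ ∂P) * this
  have hlim : Tendsto (fun ε : ℝ => C + (2 * ε * κ + ε ^ 2 * C ^ 2)) (𝓝[>] 0) (𝓝 C) := by
    have : Tendsto (fun ε : ℝ => C + (2 * ε * κ + ε ^ 2 * C ^ 2)) (𝓝 0)
        (𝓝 (C + (2 * 0 * κ + 0 ^ 2 * C ^ 2))) := by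
      apply Continuous.tendsto; fun_prop
    simp only [mul_zero, zero_mul, ne_eq, OfNat.ofNat_ne_zero, not_false_eq_true, zero_pow,
      add_zero] at this
    exact this.mono_left nhdsWithin_le_nhds
  have hev1 : ∀ᶠ ε : ℝ in 𝓝[>] 0, ε ^ 3 * κ ≤ 1 := by
    have : Tendsto (fun ε : ℝ => ε ^ 3 * κ) (𝓝 0) (𝓝 (0 ^ 3 * κ)) := by
      apply Continuous.tendsto; fun_prop
    exact (this.mono_left nhdsWithin_le_nhds).eventually_le_const (by norm_num)
  have hev2 : ∀ᶠ ε : ℝ in 𝓝[>] 0, |C * ε ^ 2| ≤ 1 := by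
    have : Tendsto (fun ε : ℝ => |C * ε ^ 2|) (𝓝 0) (𝓝 |C * 0 ^ 2|) := by
      apply Continuous.tendsto; fun_prop
    exact (this.mono_left nhdsWithin_le_nhds).eventually_le_const (by norm_num)
  refine ge_of_tendsto hlim ?_
  filter_upwards [hev1, hev2, self_mem_nhdsWithin] with ε h1 h2 hε
  rw [Set.mem_Ioi] at hε
  have l1 := lower ε
  have l2 := lower (-ε)
  have u := upper (ε • θ)
  rw [← neg_smul, norm_smul, hθ, mul_one, norm_eq_abs, sq_abs] at u
  rw [abs_neg, neg_sq] at l2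
  rw [abs_of_pos hε] at l1 l2
  set t := ε ^ 2 / 2 * v - ε ^ 3 * κ with ht
  have ht1 : 0 ≤ 1 + t := by
    have : 0 ≤ ε ^ 2 / 2 * v := by positivity
    linarith
  have l1' : 1 + t ≤ ∫ x, exp ⟪ε • θ, x - m⟫ ∂P := by linarith
  have l2' : 1 + t ≤ ∫ x, exp ⟪(-ε) • θ, x - m⟫ ∂P := by linarith
  have h3 := (mul_le_mul l1' l2' ht1 (ht1.trans l1')).trans u
  have h4 := (abs_le.1 (Real.abs_exp_sub_one_sub_id_le h2)).2
  have h5 : ε ^ 2 * v ≤ ε ^ 2 * (C + (2 * ε * κ + ε ^ 2 * C ^ 2)) := by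
    nlinarith [sq_nonneg t]
  exact le_of_mul_le_mul_left h5 (by positivity)

theorem gtilt_tilted_inner (μ : Measure (Euc n)) [IsProbabilityMeasure μ] {s : ℝ} (hs : 0 < s)
    (h k : Euc n) :
    (gtilt μ s h).tilted (fun x => ⟪k, x⟫) = gtilt μ s (h + k) := by
  simpa using gtilt_tilted μ hs le_rfl h k

theorem IsLogConcave.isSubG_gtilt {μ : Measure (Euc n)} [IsProbabilityMeasure μ]
    (hμ : IsLogConcave μ) {s : ℝ} (hs : 0 < s) (h : Euc n) :
    IsSubG (gtilt μ s h) (1 / (2 * s)) := by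
  have := isProbabilityMeasure_gtilt μ hs h
  refine isSubG_of_tilted_cov_le (hasExpMoments_gtilt μ hs h) fun k θ hθ => ?_
  rw [gtilt_tilted_inner μ hs]
  have := isProbabilityMeasure_gtilt μ hs (h + k)
  refine (hasExpMoments_gtilt μ hs _).integral_inner_sq_le (fun ξ => ?_) hθ
  refine (hμ.integral_exp_mul_integral_exp_neg_le hs _ ξ).trans (le_of_eq ?_)
  rw [one_div_mul_eq_div]

theorem StronglyTiltStable.isSubG_gtilt {μ : Measure (Euc n)} [IsProbabilityMeasure μ] {β : ℝ}
    (hμ : StronglyTiltStable μ β) {s : ℝ} (hs : 0 < s) (h : Euc n) :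
    IsSubG (gtilt μ s h) (β ^ 2) := by
  have := isProbabilityMeasure_gtilt μ hs h
  refine isSubG_of_tilted_cov_le (hasExpMoments_gtilt μ hs h) fun k θ hθ => ?_
  rw [gtilt_tilted_inner μ hs]
  simpa only [real_inner_comm θ] using hμ s hs (h + k) θ hθ

/-- Functions pinched between positive constants with bounded Lipschitz gradient. -/
structure IsNice (f : Euc n → ℝ) (c D G L : ℝ) : Prop where
  pos : 0 < c
  lip_nonneg : 0 ≤ L
  mem : ∀ x, f x ∈ Set.Icc c D
  differentiable : Differentiable ℝ f
  norm_fderiv_le : ∀ x, ‖fderiv ℝ f x‖ ≤ G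
  norm_fderiv_sub_le : ∀ x y, ‖fderiv ℝ f x - fderiv ℝ f y‖ ≤ L * ‖x - y‖

theorem IsNice.measurable_norm_fderiv_sq {f : Euc n → ℝ} :
    Measurable fun x => ‖fderiv ℝ f x‖ ^ 2 :=
  (measurable_fderiv ℝ f).norm.pow_const 2

theorem IsNice.sq_mem {f : Euc n → ℝ} {c D G L : ℝ} (hf : IsNice f c D G L) (x : Euc n) :
    f x ^ 2 ∈ Set.Icc (c ^ 2) (D ^ 2) :=
  ⟨pow_le_pow_left₀ hf.pos.le (hf.mem x).1 2,
    pow_le_pow_left₀ (hf.pos.le.trans (hf.mem x).1) (hf.mem x).2 2⟩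

theorem IsNice.abs_norm_fderiv_sq_le {f : Euc n → ℝ} {c D G L : ℝ} (hf : IsNice f c D G L)
    (x : Euc n) : |‖fderiv ℝ f x‖ ^ 2| ≤ G ^ 2 := by
  rw [abs_of_nonneg (sq_nonneg _)]
  exact pow_le_pow_left₀ (norm_nonneg _) (hf.norm_fderiv_le x) 2

theorem sq_mul_log_sq_le {c D y z : ℝ} (hc : 0 < c) (hy : y ∈ Set.Icc c D)
    (hz : z ∈ Set.Icc c D) : y ^ 2 * log (y ^ 2) ≤ z ^ 2 * log (z ^ 2)
      + (y ^ 2 - z ^ 2) * (1 + log (z ^ 2)) + 2 * (y - z) ^ 2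
      + (2 * D / c ^ 2 + 32 * D ^ 3 / c ^ 4) * |y - z| ^ 3 := by
  have hy0 : 0 < y := hc.trans_le hy.1
  have hz0 : 0 < z := hc.trans_le hz.1
  have hD : 0 < D := hy0.trans_le hy.2
  refine (mul_log_le_taylor (pow_pos hy0 2) (pow_pos hz0 2)).trans ?_
  have h1 : (y ^ 2 - z ^ 2) ^ 2 / (2 * z ^ 2) ≤ 2 * (y - z) ^ 2 + 2 * D / c ^ 2 * |y - z| ^ 3 := by
    have e1 : (y ^ 2 - z ^ 2) ^ 2 / (2 * z ^ 2)
        = 2 * (y - z) ^ 2 + (y - z) ^ 2 * ((y - z) * (y + 3 * z) / (2 * z ^ 2)) := by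
      field_simp; ring
    have e2 : (y - z) * (y + 3 * z) / (2 * z ^ 2) ≤ |y - z| * (D + 3 * D) / (2 * c ^ 2) := by
      have := le_abs_self (y - z)
      have h1 := hy.2
      have h2 := hz.1
      have h3 := hz.2
      gcongr
    rw [e1, ← sq_abs (y - z)]
    have := mul_le_mul_of_nonneg_left e2 (sq_nonneg |y - z|)
    refine (add_le_add_right this _).trans (le_of_eq ?_)
    field_simp; ring
  have h2 : 4 * |y ^ 2 - z ^ 2| ^ 3 / (z ^ 2) ^ 2 ≤ 32 * D ^ 3 / c ^ 4 * |y - z| ^ 3 := by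
    have e1 : |y ^ 2 - z ^ 2| ≤ |y - z| * (2 * D) := by
      rw [sq_sub_sq, abs_mul, mul_comm, abs_of_pos (by positivity : 0 < y + z)]
      gcongr
      linarith [hy.2, hz.2]
    have h2 := hz.1
    calc 4 * |y ^ 2 - z ^ 2| ^ 3 / (z ^ 2) ^ 2 ≤ 4 * (|y - z| * (2 * D)) ^ 3 / (c ^ 2) ^ 2 := by
          gcongr
      _ = _ := by ring
  linarith

theorem IsSubG.integral_norm_sub_pow_three_le {P : Measure (Euc n)} {C : ℝ} (hP : IsSubG P C)
    (hC : 0 < C) : ∫ x, ‖x - bary P‖ ^ 3 ∂P ≤ (n + 96 * n ^ 2) / 2 * (C * √C) := by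
  have i2 := hP.expMoments.integrable_norm_sub_pow (bary P) 2
  have i4 := hP.expMoments.integrable_norm_sub_pow (bary P) 4
  have hs : 0 < √C := sqrt_pos.2 hC
  have hs2 : √C * √C = C := mul_self_sqrt hC.le
  have h1 := integral_mono (hP.expMoments.integrable_norm_sub_pow (bary P) 3)
    ((i2.const_mul (√C / 2)).add (i4.const_mul (1 / (2 * √C)))) fun x => by
      change ‖x - bary P‖ ^ 3
        ≤ √C / 2 * ‖x - bary P‖ ^ 2 + 1 / (2 * √C) * ‖x - bary P‖ ^ 4
      have e : √C / 2 * ‖x - bary P‖ ^ 2 + 1 / (2 * √C) * ‖x - bary P‖ ^ 4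
          = ‖x - bary P‖ ^ 3 + 1 / (2 * √C) * (‖x - bary P‖ * (‖x - bary P‖ - √C)) ^ 2 := by
        field_simp; ring
      rw [e]
      have : 0 ≤ 1 / (2 * √C) * (‖x - bary P‖ * (‖x - bary P‖ - √C)) ^ 2 := by positivity
      linarith
  simp only [Pi.add_apply] at h1
  rw [integral_add (i2.const_mul _) (i4.const_mul _), integral_const_mul, integral_const_mul] at h1
  have h2 := mul_le_mul_of_nonneg_left hP.integral_norm_sub_sq_le (by positivity : 0 ≤ √C / 2)
  have h4 := mul_le_mul_of_nonneg_left (hP.integral_norm_sub_pow_four_le hC)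
    (by positivity : 0 ≤ 1 / (2 * √C))
  have e : 1 / (2 * √C) * (96 * n ^ 2 * C ^ 2) = 96 * n ^ 2 / 2 * (C * √C) := by
    rw [div_mul_eq_mul_div, one_mul, div_eq_iff (by positivity)]
    linear_combination (-96 * (n : ℝ) ^ 2 * C) * hs2
  rw [e] at h4
  refine h1.trans ?_
  linarith

theorem IsSubG.integral_norm_sub_le {P : Measure (Euc n)} {C : ℝ} (hP : IsSubG P C)
    (hC : 0 < C) : ∫ x, ‖x - bary P‖ ∂P ≤ (n + 1) / 2 * √C := by
  have hP' := hP.prob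
  have i1 : Integrable (fun x => ‖x - bary P‖) P := by
    simpa using hP.expMoments.integrable_norm_sub_pow (bary P) 1
  have i2 := hP.expMoments.integrable_norm_sub_pow (bary P) 2
  have hs : 0 < √C := sqrt_pos.2 hC
  have hs2 : √C * √C = C := mul_self_sqrt hC.le
  have h1 := integral_mono i1
    ((integrable_const (√C / 2)).add (i2.const_mul (1 / (2 * √C)))) fun x => by
      change ‖x - bary P‖ ≤ √C / 2 + 1 / (2 * √C) * ‖x - bary P‖ ^ 2
      have e : √C / 2 + 1 / (2 * √C) * ‖x - bary P‖ ^ 2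
          = ‖x - bary P‖ + 1 / (2 * √C) * (‖x - bary P‖ - √C) ^ 2 := by
        field_simp; ring
      rw [e]
      have : 0 ≤ 1 / (2 * √C) * (‖x - bary P‖ - √C) ^ 2 := by positivity
      linarith
  simp only [Pi.add_apply] at h1
  rw [integral_add (integrable_const _) (i2.const_mul _), integral_const_mul] at h1
  simp only [integral_const, probReal_univ, smul_eq_mul, one_mul] at h1
  have h2 := mul_le_mul_of_nonneg_left hP.integral_norm_sub_sq_le
    (by positivity : 0 ≤ 1 / (2 * √C))
  have e : 1 / (2 * √C) * (n * C) = n / 2 * √C := by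
    rw [div_mul_eq_mul_div, one_mul, div_eq_iff (by positivity)]
    linear_combination (-(n : ℝ)) * hs2
  rw [e] at h2
  linarith

/-- The log-Sobolev inequality at small scales, up to a higher order error. -/
theorem IsNice.ent_le_of_isSubG {f : Euc n → ℝ} {c D G L : ℝ} (hf : IsNice f c D G L) :
    ∃ K, ∀ (P : Measure (Euc n)) (C : ℝ), IsSubG P C → 0 < C →
      ent P (fun x => f x ^ 2) ≤ 2 * C * ∫ x, ‖fderiv ℝ f x‖ ^ 2 ∂P + K * (C * √C) := by
  set K₀ := 2 * D / c ^ 2 + 32 * D ^ 3 / c ^ 4 with hK₀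
  refine ⟨(4 * G * L + K₀ * G ^ 3) * ((n + 96 * n ^ 2) / 2) + 2 * (2 * G * L * ((n + 1) / 2)),
    fun P C hP hC => ?_⟩
  have hP' := hP.prob
  have hcD : c ≤ D := (hf.mem 0).1.trans (hf.mem 0).2
  have hc := hf.pos
  have hD : 0 < D := hc.trans_le hcD
  have hK₀0 : 0 ≤ K₀ := by positivity
  have hG0 : 0 ≤ G := (norm_nonneg _).trans (hf.norm_fderiv_le 0)
  set m := bary P with hm
  set a := f m ^ 2 with ha
  have ha0 : 0 < a := pow_pos (hc.trans_le (hf.mem m).1) 2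
  set θ := (InnerProductSpace.toDual ℝ (Euc n)).symm (fderiv ℝ f m) with hθ
  have hθi (x : Euc n) : fderiv ℝ f m x = ⟪θ, x⟫ := by
    rw [hθ, InnerProductSpace.toDual_symm_apply]
  have hθn : ‖θ‖ = ‖fderiv ℝ f m‖ := LinearIsometryEquiv.norm_map _ _
  have hfm : Measurable f := hf.differentiable.continuous.measurable
  have hgm : Measurable fun x => f x ^ 2 := hfm.pow_const 2
  have hgi := integrable_of_mem_Icc (P := P) hgm hf.sq_mem
  have hgl := integrable_mul_log (P := P) hgm (pow_pos hc 2) hf.sq_mem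
  have hM := integral_mem_Icc (P := P) hgm hf.sq_mem
  set M := ∫ x, f x ^ 2 ∂P with hMdef
  have hMpos : 0 < M := (pow_pos hc 2).trans_le hM.1
  have hL := hf.lip_nonneg
  have hLnn (x : Euc n) : 0 ≤ L * ‖x - m‖ := mul_nonneg hL (norm_nonneg _)
  have hfd (x : Euc n) : |f x - f m| ≤ G * ‖x - m‖ := by
    have := convex_univ.norm_image_sub_le_of_norm_fderiv_le
      (fun y _ => hf.differentiable y) (fun y _ => hf.norm_fderiv_le y)
      (Set.mem_univ m) (Set.mem_univ x)
    rwa [norm_eq_abs] at this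
  have hfl (x : Euc n) : |f x - f m - ⟪θ, x - m⟫| ≤ L * ‖x - m‖ * ‖x - m‖ := by
    have := (convex_closedBall m ‖x - m‖).norm_image_sub_le_of_norm_fderiv_le'
      (f := f) (𝕜 := ℝ) (φ := fderiv ℝ f m) (C := L * ‖x - m‖)
      (fun y _ => hf.differentiable y) (fun y hy => by
        refine (hf.norm_fderiv_sub_le y m).trans ?_
        rw [mem_closedBall_iff_norm] at hy
        gcongr)
      (Metric.mem_closedBall_self (norm_nonneg _))
      (mem_closedBall_iff_norm.2 le_rfl : x ∈ Metric.closedBall m ‖x - m‖)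
    rwa [norm_eq_abs, hθi] at this
  have hθv (x : Euc n) : |⟪θ, x - m⟫| ≤ G * ‖x - m‖ := by
    refine (abs_real_inner_le_norm _ _).trans ?_
    gcongr
    rw [hθn]; exact hf.norm_fderiv_le m
  have hpt (x : Euc n) : f x ^ 2 * log (f x ^ 2) ≤ a * log a + (f x ^ 2 - a) * (1 + log a)
      + 2 * ⟪θ, x - m⟫ ^ 2 + (4 * G * L + K₀ * G ^ 3) * ‖x - m‖ ^ 3 := by
    refine (sq_mul_log_sq_le hc (hf.mem x) (hf.mem m)).trans ?_
    have h1 : |f x - f m| ^ 3 ≤ (G * ‖x - m‖) ^ 3 := pow_le_pow_left₀ (abs_nonneg _) (hfd x) 3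
    have h2 : (f x - f m) ^ 2 ≤ ⟪θ, x - m⟫ ^ 2 + 2 * G * L * ‖x - m‖ ^ 3 := by
      have e1 : (f x - f m) ^ 2 = ⟪θ, x - m⟫ ^ 2
          + (f x - f m - ⟪θ, x - m⟫) * (f x - f m + ⟪θ, x - m⟫) := by ring
      have e2 : (f x - f m - ⟪θ, x - m⟫) * (f x - f m + ⟪θ, x - m⟫)
          ≤ L * ‖x - m‖ * ‖x - m‖ * (G * ‖x - m‖ + G * ‖x - m‖) := by
        refine (le_abs_self _).trans ?_
        rw [abs_mul]
        refine mul_le_mul (hfl x) ((abs_add_le _ _).trans (add_le_add (hfd x) (hθv x)))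
          (abs_nonneg _) (mul_nonneg (hLnn x) (norm_nonneg _))
      rw [e1]
      refine (add_le_add_right e2 _).trans (le_of_eq ?_)
      ring
    have h3 := mul_le_mul_of_nonneg_left h1 hK₀0
    have h4 : K₀ * (G * ‖x - m‖) ^ 3 = K₀ * G ^ 3 * ‖x - m‖ ^ 3 := by ring
    linarith
  have i2 : Integrable (fun x => ⟪θ, x - m⟫ ^ 2) P := hP.expMoments.integrable_inner_sub_pow θ m 2
  have i3 : Integrable (fun x => ‖x - m‖ ^ 3) P := hP.expMoments.integrable_norm_sub_pow m 3
  have j0 : Integrable (fun x => (f x ^ 2 - a) * (1 + log a)) P :=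
    (hgi.sub (integrable_const a)).mul_const _
  have j1 : Integrable (fun x => a * log a + (f x ^ 2 - a) * (1 + log a)) P :=
    (integrable_const (a * log a)).add j0
  have j2 : Integrable (fun x => a * log a + (f x ^ 2 - a) * (1 + log a)
      + 2 * ⟪θ, x - m⟫ ^ 2) P := j1.add (i2.const_mul 2)
  have h1 := integral_mono hgl (j2.add (i3.const_mul (4 * G * L + K₀ * G ^ 3))) hpt
  simp only [Pi.add_apply] at h1
  rw [integral_add j2 (i3.const_mul _), integral_add j1 (i2.const_mul 2),
    integral_add (integrable_const _) j0, integral_mul_const (1 + log a),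
    integral_sub hgi (integrable_const a), ← hMdef] at h1
  simp only [integral_const_mul] at h1
  simp only [integral_const, probReal_univ, smul_eq_mul, one_mul] at h1
  have h2 := hP.cov_le θ
  rw [hθn] at h2
  have h3 := hP.integral_norm_sub_pow_three_le hC
  rw [← hm] at h2 h3
  have h4 : ‖fderiv ℝ f m‖ ^ 2
      ≤ ∫ x, ‖fderiv ℝ f x‖ ^ 2 ∂P + 2 * G * L * ((n + 1) / 2 * √C) := by
    have k0 : Integrable (fun x => ‖fderiv ℝ f x‖ ^ 2) P :=
      Integrable.of_bound IsNice.measurable_norm_fderiv_sq.aestronglyMeasurable (G ^ 2)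
        (Eventually.of_forall hf.abs_norm_fderiv_sq_le)
    have k1 : Integrable (fun x => ‖x - m‖) P := by
      simpa using hP.expMoments.integrable_norm_sub_pow m 1
    have l1 := integral_mono (integrable_const (‖fderiv ℝ f m‖ ^ 2))
      (k0.add (k1.const_mul (2 * G * L))) fun x => by
        change ‖fderiv ℝ f m‖ ^ 2 ≤ ‖fderiv ℝ f x‖ ^ 2 + 2 * G * L * ‖x - m‖
        have e1 : ‖fderiv ℝ f m‖ - ‖fderiv ℝ f x‖ ≤ L * ‖x - m‖ := by
          refine (norm_sub_norm_le _ _).trans ?_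
          rw [norm_sub_rev]
          exact hf.norm_fderiv_sub_le x m
        have e2 := mul_le_mul_of_nonneg_right e1
          (add_nonneg (norm_nonneg (fderiv ℝ f m)) (norm_nonneg (fderiv ℝ f x)))
        have e3 := mul_le_mul_of_nonneg_left
          (add_le_add (hf.norm_fderiv_le m) (hf.norm_fderiv_le x)) (hLnn x)
        linarith
    simp only [Pi.add_apply] at l1
    rw [integral_add k0 (k1.const_mul _), integral_const_mul] at l1
    simp only [integral_const, probReal_univ, smul_eq_mul, one_mul] at l1
    have l2 := hP.integral_norm_sub_le hC
    rw [← hm] at l2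
    refine l1.trans ?_
    gcongr
  have h5 : M - a ≤ M * log M - M * log a := by
    have e1 := log_le_sub_one_of_pos (div_pos ha0 hMpos)
    rw [log_div ha0.ne' hMpos.ne'] at e1
    have e2 := mul_le_mul_of_nonneg_left e1 hMpos.le
    have e3 : M * (a / M - 1) = a - M := by field_simp
    linarith
  have h6 := mul_le_mul_of_nonneg_left h3 (by positivity : 0 ≤ 4 * G * L + K₀ * G ^ 3)
  have h7 := mul_le_mul_of_nonneg_left h4 hC.le
  rw [ent, ← hMdef]
  change ∫ x, f x ^ 2 * log (f x ^ 2) ∂P - M * log M ≤ _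
  linarith

theorem IsNice.ent_gtilt_le_of_isSubG {f : Euc n → ℝ} {c D G L : ℝ} (hf : IsNice f c D G L)
    (μ : Measure (Euc n)) [IsProbabilityMeasure μ] {u : ℝ} (hu : 0 < u)
    (hP : ∀ s, u ≤ s → ∀ h, IsSubG (gtilt μ s h) (1 / (2 * s))) (k : Euc n) :
    u * ent (gtilt μ u k) (fun x => f x ^ 2) ≤ ∫ x, ‖fderiv ℝ f x‖ ^ 2 ∂(gtilt μ u k) := by
  obtain ⟨K, hK⟩ := hf.ent_le_of_isSubG
  have hgm : Measurable fun x => f x ^ 2 := hf.differentiable.continuous.measurable.pow_const 2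
  set E := ent (gtilt μ u k) (fun x => f x ^ 2)
  set I := ∫ x, ‖fderiv ℝ f x‖ ^ 2 ∂(gtilt μ u k)
  have key (U : ℝ) (hU : u ≤ U) (hU' : U⁻¹ < u) :
      (u - U⁻¹) * E ≤ 1 * I + K / 2 * √(1 / (2 * U)) := by
    have hUpos : 0 < U := hu.trans_le hU
    have hη : 0 < U⁻¹ := inv_pos.2 hUpos
    refine ent_gtilt_backward μ hu hU (C := fun s => 1 / (2 * s)) (B := 1 / (2 * u))
      (fun s hs => by have := hu.trans_le hs; positivity) (fun s hs => by gcongr) hP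
      (ω := fun s => s - U⁻¹) (Ω := U) hη (fun s hs => by linarith [hs.1])
      (fun s hs => by linarith [hs.2]) (fun s δ hs hδ hδη _ => ?_) hgm (pow_pos hf.pos 2) hf.sq_mem
      IsNice.measurable_norm_fderiv_sq hf.abs_norm_fderiv_sq_le (fun k => ?_) k
    · have hspos := hu.trans_le hs
      have e : (s + δ - U⁻¹) * (1 - 2 * δ * (1 / (2 * s))) = s - U⁻¹ + δ * (U⁻¹ - δ) / s := by
        generalize U⁻¹ = η
        field_simp
        ring
      rw [e]
      have : 0 ≤ δ * (U⁻¹ - δ) / s := div_nonneg (mul_nonneg hδ.le (by linarith)) hspos.le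
      linarith
    · have hpr := isProbabilityMeasure_gtilt μ hUpos k
      have h1 := hK _ _ (hP U hU k) (by positivity)
      have h2 := ent_nonneg_of_mem_Icc (P := gtilt μ U k) hgm (pow_pos hf.pos 2) hf.sq_mem
      have h3 := mul_le_mul_of_nonneg_left h1 hUpos.le
      have h4 : U * (2 * (1 / (2 * U)) * ∫ x, ‖fderiv ℝ f x‖ ^ 2 ∂(gtilt μ U k)
          + K * (1 / (2 * U) * √(1 / (2 * U))))
          = 1 * ∫ x, ‖fderiv ℝ f x‖ ^ 2 ∂(gtilt μ U k) + K / 2 * √(1 / (2 * U)) := by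
        generalize √(1 / (2 * U)) = q
        field_simp
      rw [h4] at h3
      have h5 := mul_nonneg hη.le h2
      linarith
  have hinv : Tendsto (fun U : ℝ => U⁻¹) atTop (𝓝 0) := tendsto_inv_atTop_zero
  have hl1 : Tendsto (fun U : ℝ => (u - U⁻¹) * E) atTop (𝓝 (u * E)) := by
    simpa using (hinv.const_sub u).mul_const E
  have hl2 : Tendsto (fun U : ℝ => 1 * I + K / 2 * √(1 / (2 * U))) atTop (𝓝 I) := by
    have h1 : Tendsto (fun U : ℝ => 1 * I + K / 2 * √(2⁻¹ * U⁻¹)) atTop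
        (𝓝 (1 * I + K / 2 * √(2⁻¹ * 0))) :=
      (((hinv.const_mul 2⁻¹).sqrt).const_mul _).const_add _
    simpa [mul_comm] using h1
  refine le_of_tendsto_of_tendsto hl1 hl2 ?_
  filter_upwards [eventually_ge_atTop u, hinv.eventually_lt_const hu] with U h1 h2
  exact key U h1 h2

theorem IsNice.ent_gtilt_le {f : Euc n → ℝ} {c D G L : ℝ} (hf : IsNice f c D G L)
    {μ : Measure (Euc n)} [IsProbabilityMeasure μ] (hlc : IsLogConcave μ) {β : ℝ} (hβ : 0 < β)
    (hsts : StronglyTiltStable μ β) {ε : ℝ} (hε : 0 < ε) (hε1 : ε ≤ 1 / (4 * β ^ 2))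
    (k : Euc n) :
    ent (gtilt μ ε k) (fun x => f x ^ 2)
      ≤ 8 * β ^ 2 * ∫ x, ‖fderiv ℝ f x‖ ^ 2 ∂(gtilt μ ε k) := by
  have hgm : Measurable fun x => f x ^ 2 := hf.differentiable.continuous.measurable.pow_const 2
  have hu : 0 < 1 / (4 * β ^ 2) := by positivity
  have hu' : β ^ 2 * (1 / (4 * β ^ 2)) = 1 / 4 := by field_simp
  set u := 1 / (4 * β ^ 2) with hudef
  have hβ2 : 0 < β ^ 2 := by positivity
  have key := ent_gtilt_backward μ hε hε1 (C := fun _ => β ^ 2) (B := β ^ 2)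
    (fun _ _ => hβ2) (fun _ _ => le_rfl) (fun s hs h => hsts.isSubG_gtilt (hε.trans_le hs) h)
    (ω := fun s => 1 - 2 * β ^ 2 * (u - s)) (Ω := 1) (δ₀ := 1) one_pos
    (fun s hs => by nlinarith [mul_pos hβ2 (hε.trans_le hs.1)])
    (fun s hs => by nlinarith [mul_nonneg hβ2.le (sub_nonneg.2 hs.2)])
    (fun s δ hs hδ _ hsδ => by
      have h1 := mul_nonneg (mul_nonneg hβ2.le hδ.le) (mul_nonneg hβ2.le (sub_nonneg.2 hsδ))
      nlinarith)
    hgm (pow_pos hf.pos 2) hf.sq_mem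
    IsNice.measurable_norm_fderiv_sq hf.abs_norm_fderiv_sq_le (a := 4 * β ^ 2) (b := 0)
    (fun k => by
      have h1 := hf.ent_gtilt_le_of_isSubG μ hu
        (fun s hs h => hlc.isSubG_gtilt (hu.trans_le hs) h) k
      have h2 := mul_le_mul_of_nonneg_left h1 (by positivity : 0 ≤ 4 * β ^ 2)
      have h3 : 4 * β ^ 2 * (u * ent (gtilt μ u k) fun x => f x ^ 2)
          = ent (gtilt μ u k) fun x => f x ^ 2 := by
        rw [← mul_assoc, mul_assoc, mul_assoc, ← mul_assoc (β ^ 2), hu']; ring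
      simp only [sub_self, mul_zero, sub_zero, one_mul, add_zero]
      linarith) k
  have hpr := isProbabilityMeasure_gtilt μ hε k
  have h2 := ent_nonneg_of_mem_Icc (P := gtilt μ ε k) hgm (pow_pos hf.pos 2) hf.sq_mem
  have h3 : 1 / 2 ≤ 1 - 2 * β ^ 2 * (u - ε) := by nlinarith [mul_pos hβ2 hε]
  have h4 := mul_le_mul_of_nonneg_right h3 h2
  linarith

theorem tendsto_integral_gtilt (μ : Measure (Euc n)) [IsProbabilityMeasure μ] {φ : Euc n → ℝ}
    (hφ : Measurable φ) {K : ℝ} (hK : ∀ x, |φ x| ≤ K) :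
    Tendsto (fun ε => ∫ x, φ x ∂(gtilt μ ε 0)) (𝓝[>] 0) (𝓝 (∫ x, φ x ∂μ)) := by
  have main {ψ : Euc n → ℝ} (hψ : Measurable ψ) {K : ℝ} (hK : ∀ x, |ψ x| ≤ K) :
      Tendsto (fun ε => ∫ x, exp (-ε * ‖x‖ ^ 2) * ψ x ∂μ) (𝓝[>] 0) (𝓝 (∫ x, ψ x ∂μ)) := by
    refine tendsto_integral_filter_of_dominated_convergence (fun _ => K)
      (Eventually.of_forall fun ε => by fun_prop) ?_ (integrable_const K) (ae_of_all _ fun x => ?_)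
    · filter_upwards [self_mem_nhdsWithin] with ε hε
      refine ae_of_all _ fun x => ?_
      rw [norm_mul, norm_eq_abs, norm_eq_abs, abs_exp]
      have h1 : exp (-ε * ‖x‖ ^ 2) ≤ 1 := by
        rw [exp_le_one_iff, neg_mul, neg_nonpos]
        exact mul_nonneg (le_of_lt hε) (sq_nonneg _)
      calc exp (-ε * ‖x‖ ^ 2) * |ψ x| ≤ 1 * |ψ x| := by gcongr
        _ ≤ K := by rw [one_mul]; exact hK x
    · have h1 : Tendsto (fun ε : ℝ => exp (-ε * ‖x‖ ^ 2) * ψ x) (𝓝 0)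
          (𝓝 (exp (-0 * ‖x‖ ^ 2) * ψ x)) := by
        apply Continuous.tendsto; fun_prop
      simp only [neg_zero, zero_mul, exp_zero, one_mul] at h1
      exact h1.mono_left nhdsWithin_le_nhds
  have h1 := (main hφ hK).div (main (ψ := fun _ => 1) measurable_const (K := 1) (by simp))
    (by simp)
  simp only [integral_const, probReal_univ, smul_eq_mul, mul_one, div_one] at h1
  refine h1.congr' ?_
  filter_upwards [self_mem_nhdsWithin] with ε hε
  rw [gtilt_eq_tilted μ hε, integral_tilted]
  simp only [inner_zero_left, add_zero, smul_eq_mul, Pi.div_apply]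
  rw [← integral_div]
  congr 1; ext x; ring

/-- The logarithmic Sobolev inequality for nice functions. -/
theorem IsNice.ent_le {f : Euc n → ℝ} {c D G L : ℝ} (hf : IsNice f c D G L)
    {μ : Measure (Euc n)} [IsProbabilityMeasure μ] (hlc : IsLogConcave μ) {β : ℝ} (hβ : 0 < β)
    (hsts : StronglyTiltStable μ β) :
    ent μ (fun x => f x ^ 2) ≤ 8 * β ^ 2 * ∫ x, ‖fderiv ℝ f x‖ ^ 2 ∂μ := by
  have hgm : Measurable fun x => f x ^ 2 := hf.differentiable.continuous.measurable.pow_const 2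
  have hgl : Measurable fun x => f x ^ 2 * log (f x ^ 2) := hgm.mul hgm.log
  have hM := integral_mem_Icc (P := μ) hgm hf.sq_mem
  have hM0 : ∫ x, f x ^ 2 ∂μ ≠ 0 := ((pow_pos hf.pos 2).trans_le hM.1).ne'
  have hgb (x : Euc n) : |f x ^ 2| ≤ D ^ 2 := by
    rw [abs_of_nonneg (sq_nonneg _)]; exact (hf.sq_mem x).2
  have l1 := tendsto_integral_gtilt μ hgm hgb
  have l2 := tendsto_integral_gtilt μ hgl fun x => abs_mul_log_le (pow_pos hf.pos 2) (hf.sq_mem x)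
  have l3 := (tendsto_integral_gtilt μ IsNice.measurable_norm_fderiv_sq
    hf.abs_norm_fderiv_sq_le).const_mul (8 * β ^ 2)
  refine le_of_tendsto_of_tendsto (l2.sub (l1.mul (l1.log hM0))) l3 ?_
  have hu : 0 < 1 / (4 * β ^ 2) := by positivity
  filter_upwards [Ioc_mem_nhdsGT hu] with ε hε
  exact hf.ent_gtilt_le hlc hβ hsts hε.1 hε.2 0

theorem isNice_add_const {u : Euc n → ℝ} (hu : ContDiff ℝ 2 u) (hcs : HasCompactSupport u)
    (h0 : ∀ x, 0 ≤ u x) {ε : ℝ} (hε : 0 < ε) :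
    ∃ D G L, IsNice (fun x => u x + ε) ε D G L := by
  obtain ⟨B, hB⟩ := hcs.exists_bound_of_continuous hu.continuous
  have hu1 : ContDiff ℝ 1 (fderiv ℝ u) := hu.fderiv_right (by norm_num)
  obtain ⟨G, hG⟩ := (hcs.fderiv ℝ).exists_bound_of_continuous hu1.continuous
  obtain ⟨L, hL⟩ := hu1.lipschitzWith_of_hasCompactSupport (hcs.fderiv ℝ) (by norm_num)
  have hd : fderiv ℝ (fun x => u x + ε) = fderiv ℝ u := by
    ext1 x; exact fderiv_add_const ε
  refine ⟨B + ε, G, L, hε, L.2, fun x => ⟨by linarith [h0 x], ?_⟩,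
    (hu.differentiable (by norm_num)).add_const ε, fun x => by rw [hd]; exact hG x, fun x y => ?_⟩
  · have := (le_abs_self _).trans (hB x)
    simpa using this
  · rw [hd]; exact hL.norm_sub_le x y

theorem integrable_normed_smul {F : Type*} [NormedAddCommGroup F] [NormedSpace ℝ F]
    (φ : ContDiffBump (0 : Euc n)) {g : Euc n → F}
    (hg : AEStronglyMeasurable g volume) {B : ℝ} (hB : ∀ x, ‖g x‖ ≤ B) (x : Euc n) :
    Integrable (fun t => φ.normed volume t • g (x - t)) := by
  refine (φ.integrable_normed.mul_const B).mono' ?_ (ae_of_all _ fun t => ?_)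
  · exact φ.continuous_normed.aestronglyMeasurable.smul
      (hg.comp_quasiMeasurePreserving (quasiMeasurePreserving_sub_left volume x))
  · rw [norm_smul, norm_of_nonneg (φ.nonneg_normed t)]
    exact mul_le_mul_of_nonneg_left (hB _) (φ.nonneg_normed t)

theorem norm_normed_convolution_le {F : Type*} [NormedAddCommGroup F] [NormedSpace ℝ F]
    (φ : ContDiffBump (0 : Euc n)) {g : Euc n → F} {B : ℝ} (hB : ∀ x, ‖g x‖ ≤ B) (x : Euc n) :
    ‖(φ.normed volume ⋆[ContinuousLinearMap.lsmul ℝ ℝ, volume] g) x‖ ≤ B := by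
  simp only [convolution_def, ContinuousLinearMap.lsmul_apply]
  refine (norm_integral_le_of_norm_le (φ.integrable_normed.mul_const B)
    (ae_of_all _ fun t => ?_)).trans ?_
  · rw [norm_smul, norm_of_nonneg (φ.nonneg_normed t)]
    exact mul_le_mul_of_nonneg_left (hB _) (φ.nonneg_normed t)
  · rw [integral_mul_const B, φ.integral_normed, one_mul]

theorem hasFDerivAt_normed_convolution (φ : ContDiffBump (0 : Euc n)) {g : Euc n → ℝ} {C : ℝ≥0}
    (hg : LipschitzWith C g) {B : ℝ} (hB : ∀ x, ‖g x‖ ≤ B) (x : Euc n) :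
    HasFDerivAt (φ.normed volume ⋆[ContinuousLinearMap.lsmul ℝ ℝ, volume] g)
      ((φ.normed volume ⋆[ContinuousLinearMap.lsmul ℝ ℝ, volume] fderiv ℝ g) x) x := by
  have hd : ∀ᵐ t : Euc n, DifferentiableAt ℝ g (x - t) :=
    (quasiMeasurePreserving_sub_left volume x).ae hg.ae_differentiableAt
  have h := hasFDerivAt_integral_of_dominated_loc_of_lip (μ := (volume : Measure (Euc n)))
    (F := fun y t => φ.normed volume t • g (y - t)) (x₀ := x)
    (F' := fun t => φ.normed volume t • fderiv ℝ g (x - t))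
    (bound := fun t => φ.normed volume t * C) univ_mem
    (Eventually.of_forall fun y =>
      (integrable_normed_smul φ hg.continuous.aestronglyMeasurable hB y).aestronglyMeasurable)
    (integrable_normed_smul φ hg.continuous.aestronglyMeasurable hB x)
    (integrable_normed_smul φ (measurable_fderiv ℝ g).aestronglyMeasurable
      (fun y => norm_fderiv_le_of_lipschitz ℝ hg) x).aestronglyMeasurable
    (ae_of_all _ fun t => ?_) (φ.integrable_normed.mul_const _) ?_
  · exact h.2
  · refine LipschitzOnWith.of_dist_le_mul fun y _ z _ => ?_
    have h1 := hg.dist_le_mul (y - t) (z - t)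
    rw [dist_sub_right] at h1
    rw [Real.dist_eq, smul_eq_mul, smul_eq_mul, ← mul_sub, abs_mul, Real.coe_nnabs, abs_mul,
      NNReal.abs_eq, mul_assoc]
    rw [Real.dist_eq] at h1
    gcongr
  · filter_upwards [hd] with t ht
    have h1 : HasFDerivAt (fun y => g (y - t)) (fderiv ℝ g (x - t)) x :=
      ht.hasFDerivAt.comp x ((hasFDerivAt_id x).sub_const t)
    exact h1.const_smul (φ.normed volume t)

theorem tendsto_ent {μ : Measure (Euc n)} [IsProbabilityMeasure μ] {g : ℕ → Euc n → ℝ}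
    {g' b b' : Euc n → ℝ} (hg : ∀ j, Measurable (g j)) (hb : Integrable b μ)
    (hb' : Integrable b' μ) (h : ∀ j x, |g j x| ≤ b x)
    (h' : ∀ j x, |g j x * log (g j x)| ≤ b' x)
    (hl : ∀ x, Tendsto (fun j => g j x) atTop (𝓝 (g' x))) :
    Tendsto (fun j => ent μ (g j)) atTop (𝓝 (ent μ g')) := by
  have l1 : Tendsto (fun j => ∫ x, g j x ∂μ) atTop (𝓝 (∫ x, g' x ∂μ)) :=
    tendsto_integral_of_dominated_convergence b (fun j => (hg j).aestronglyMeasurable) hb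
      (fun j => ae_of_all _ (h j)) (ae_of_all _ hl)
  have l2 : Tendsto (fun j => ∫ x, g j x * log (g j x) ∂μ) atTop
      (𝓝 (∫ x, g' x * log (g' x) ∂μ)) :=
    tendsto_integral_of_dominated_convergence b'
      (fun j => ((hg j).mul (hg j).log).aestronglyMeasurable) hb'
      (fun j => ae_of_all _ (h' j))
      (ae_of_all _ fun x => (continuous_mul_log.tendsto _).comp (hl x))
  exact l2.sub ((continuous_mul_log.tendsto _).comp l1)

/-- The logarithmic Sobolev inequality for compactly supported Lipschitz functions. -/
theorem ent_sq_le_of_lipschitzWith {μ : Measure (Euc n)} [IsProbabilityMeasure μ]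
    (hlc : IsLogConcave μ) {β : ℝ} (hβ : 0 < β) (hsts : StronglyTiltStable μ β)
    {f : Euc n → ℝ} {C : ℝ≥0} (hf : LipschitzWith C f) (hcs : HasCompactSupport f)
    (h0 : ∀ x, 0 ≤ f x) :
    ent μ (fun x => f x ^ 2) ≤ 8 * β ^ 2 * ∫ x, ‖fderiv ℝ f x‖ ^ 2 ∂μ := by
  obtain ⟨B, hB⟩ := hcs.exists_bound_of_continuous hf.continuous
  have hac : μ ≪ volume := by
    obtain ⟨d, -, -, -, hd⟩ := hlc
    rw [hd]; exact withDensity_absolutelyContinuous _ _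
  let φ : ℕ → ContDiffBump (0 : Euc n) := fun j =>
    ⟨1 / ((j : ℝ) + 1), 2 * (1 / ((j : ℝ) + 1)), by positivity,
      lt_two_mul_self (by positivity)⟩
  have hε : Tendsto (fun j : ℕ => 1 / ((j : ℝ) + 1)) atTop (𝓝 0) :=
    tendsto_one_div_add_atTop_nhds_zero_nat
  have hφ : Tendsto (fun j => (φ j).rOut) atTop (𝓝 0) := by
    simpa only [mul_zero] using hε.const_mul 2
  let F : ℕ → Euc n → ℝ := fun j =>
    (φ j).normed volume ⋆[ContinuousLinearMap.lsmul ℝ ℝ, volume] f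
  have hF0 (j x) : 0 ≤ F j x := by
    refine integral_nonneg fun t => ?_
    exact mul_nonneg ((φ j).nonneg_normed t) (h0 _)
  have hFB (j x) : F j x ≤ B := (le_abs_self _).trans (norm_normed_convolution_le _ hB x)
  have hFd (j x) : HasFDerivAt (F j) _ x := hasFDerivAt_normed_convolution (φ j) hf hB x
  have hG (x) : ‖fderiv ℝ f x‖ ≤ C := norm_fderiv_le_of_lipschitz ℝ hf
  have key (j : ℕ) : ent μ (fun x => (F j x + 1 / ((j : ℝ) + 1)) ^ 2)
      ≤ 8 * β ^ 2 * ∫ x, ‖fderiv ℝ (F j) x‖ ^ 2 ∂μ := by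
    have hF2 : ContDiff ℝ 2 (F j) :=
      (φ j).hasCompactSupport_normed.contDiff_convolution_left _ (n := 2) (φ j).contDiff_normed
        hf.continuous.locallyIntegrable
    have hFc : HasCompactSupport (F j) := (φ j).hasCompactSupport_normed.convolution _ hcs
    obtain ⟨D, G, L, hn⟩ := isNice_add_const hF2 hFc (hF0 j)
      (ε := 1 / ((j : ℝ) + 1)) (by positivity)
    have := hn.ent_le hlc hβ hsts
    simpa only [fderiv_add_const] using this
  have hFm (j) : Measurable (F j) :=
    (continuous_iff_continuousAt.2 fun x => (hFd j x).continuousAt).measurable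
  have hbd (j x) : (F j x + 1 / ((j : ℝ) + 1)) ^ 2 ∈ Set.Icc 0 ((B + 1) ^ 2) := by
    have h1 : 1 / ((j : ℝ) + 1) ≤ 1 := by
      rw [div_le_one (by positivity)]; linarith [Nat.cast_nonneg (α := ℝ) j]
    have h2 : 0 ≤ 1 / ((j : ℝ) + 1) := by positivity
    refine ⟨sq_nonneg _, pow_le_pow_left₀ (add_nonneg (hF0 j x) h2) ?_ 2⟩
    linarith [hFB j x]
  obtain ⟨K, hK⟩ := (isCompact_Icc (a := 0) (b := (B + 1) ^ 2)).exists_bound_of_continuousOn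
    continuous_mul_log.continuousOn
  have l1 : Tendsto (fun j : ℕ => ent μ (fun x => (F j x + 1 / ((j : ℝ) + 1)) ^ 2)) atTop
      (𝓝 (ent μ fun x => f x ^ 2)) := by
    refine tendsto_ent (fun j => ((hFm j).add_const _).pow_const 2)
      (integrable_const ((B + 1) ^ 2)) (integrable_const K) (fun j x => ?_)
      (fun j x => hK _ (hbd j x)) fun x => ?_
    · rw [abs_of_nonneg (hbd j x).1]; exact (hbd j x).2
    · have := ContDiffBump.convolution_tendsto_right_of_continuous (μ := volume) hφ
        hf.continuous x
      simpa using (this.add hε).pow 2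
  have l2 : Tendsto (fun j => ∫ x, ‖fderiv ℝ (F j) x‖ ^ 2 ∂μ) atTop
      (𝓝 (∫ x, ‖fderiv ℝ f x‖ ^ 2 ∂μ)) := by
    refine tendsto_integral_of_dominated_convergence (fun _ => (C : ℝ) ^ 2)
      (fun j => IsNice.measurable_norm_fderiv_sq.aestronglyMeasurable) (integrable_const _)
      (fun j => ae_of_all _ fun x => ?_) ?_
    · rw [norm_pow, norm_norm, (hFd j x).fderiv]
      gcongr
      exact norm_normed_convolution_le _ hG x
    · have hli : LocallyIntegrable (fderiv ℝ f) := by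
        refine (locallyIntegrable_const (C : ℝ)).mono
          (measurable_fderiv ℝ f).aestronglyMeasurable (ae_of_all _ fun x => ?_)
        exact (hG x).trans (le_abs_self _)
      have := ContDiffBump.ae_convolution_tendsto_right_of_locallyIntegrable (K := 2) hφ
        (Eventually.of_forall fun j => le_rfl) hli
      filter_upwards [hac.ae_le this] with x hx
      simp only [fun j => (hFd j x).fderiv]
      exact hx.norm.pow 2
  exact le_of_tendsto_of_tendsto' l1 (l2.const_mul _) key

/-- A Lipschitz cutoff function supported in a ball of radius `R`. -/
def tent {n : ℕ} (R : ℝ) (x : Euc n) : ℝ := max 0 (1 - R⁻¹ * ‖x‖)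

theorem tent_nonneg (R : ℝ) (x : Euc n) : 0 ≤ tent R x := le_max_left _ _

theorem tent_le_one {R : ℝ} (hR : 0 < R) (x : Euc n) : tent R x ≤ 1 :=
  max_le zero_le_one (by have : 0 ≤ R⁻¹ * ‖x‖ := by positivity
                         linarith)

theorem tent_eq_zero {R : ℝ} (hR : 0 < R) {x : Euc n} (hx : R < ‖x‖) : tent R x = 0 := by
  refine max_eq_left ?_
  have : 1 ≤ R⁻¹ * ‖x‖ := by
    rw [inv_mul_eq_div, one_le_div hR]; exact hx.le
  linarith

theorem lipschitzWith_tent (R : ℝ≥0) : LipschitzWith R⁻¹ (tent (n := n) R) := by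
  refine LipschitzWith.const_max ?_ 0
  refine LipschitzWith.of_dist_le_mul fun x y => ?_
  rw [Real.dist_eq, sub_sub_sub_cancel_left, ← mul_sub, abs_mul, NNReal.coe_inv,
    abs_of_nonneg (inv_nonneg.2 R.coe_nonneg), dist_comm, dist_eq_norm]
  exact mul_le_mul_of_nonneg_left (abs_norm_sub_norm_le _ _) (inv_nonneg.2 R.coe_nonneg)

theorem exists_lipschitzWith_abs_mul_tent {f : Euc n → ℝ} (hf : LocallyLipschitz f) {R : ℝ≥0}
    (hR : 0 < R) : ∃ C, LipschitzWith C fun x => |f x| * tent R x := by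
  have hK := isCompact_closedBall (0 : Euc n) R
  obtain ⟨A, hA⟩ := hf.locallyLipschitzOn.exists_lipschitzOnWith_of_compact hK
  obtain ⟨B, hB⟩ := hK.exists_bound_of_continuousOn hf.continuous.continuousOn
  have hB0 : 0 ≤ B := (norm_nonneg _).trans (hB 0 (Metric.mem_closedBall_self R.2))
  have hout (x : Euc n) (hx : x ∉ Metric.closedBall (0 : Euc n) R) : tent R x = 0 := by
    rw [mem_closedBall_zero_iff, not_le] at hx
    exact tent_eq_zero hR hx
  have hC : 0 ≤ (A : ℝ) + B * (R : ℝ)⁻¹ := by positivity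
  refine ⟨⟨_, hC⟩, LipschitzWith.of_le_add_mul _ fun x y => ?_⟩
  change |f x| * tent R x ≤ |f y| * tent R y + (A + B * (R : ℝ)⁻¹) * dist x y
  have hy0 : 0 ≤ |f y| * tent R y := mul_nonneg (abs_nonneg _) (tent_nonneg _ _)
  have ht : tent R x - tent R y ≤ (R : ℝ)⁻¹ * dist x y :=
    (le_abs_self _).trans ((lipschitzWith_tent R).dist_le_mul x y)
  have hAd : 0 ≤ (A : ℝ) * dist x y := by positivity
  by_cases hx : x ∈ Metric.closedBall (0 : Euc n) R
  · have h1 : |f x| * (tent R x - tent R y) ≤ B * ((R : ℝ)⁻¹ * dist x y) :=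
      (mul_le_mul_of_nonneg_left ht (abs_nonneg _)).trans
        (mul_le_mul_of_nonneg_right (hB x hx) (by positivity))
    by_cases hy : y ∈ Metric.closedBall (0 : Euc n) R
    · have h2 : |f x| - |f y| ≤ A * dist x y :=
        (abs_sub_abs_le_abs_sub _ _).trans (hA.dist_le_mul x hx y hy)
      have h3 : (|f x| - |f y|) * tent R y ≤ A * dist x y :=
        (mul_le_mul_of_nonneg_right h2 (tent_nonneg _ _)).trans
          (mul_le_of_le_one_right hAd (tent_le_one hR y))
      linarith
    · rw [hout y hy] at h1 ⊢
      linarith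
  · rw [hout x hx, mul_zero]
    exact add_nonneg hy0 (mul_nonneg hC dist_nonneg)

theorem norm_fderiv_abs_le (f : Euc n → ℝ) (hf : Continuous f) (x : Euc n) :
    ‖fderiv ℝ (fun y => |f y|) x‖ ≤ ‖fderiv ℝ f x‖ := by
  rcases lt_trichotomy (f x) 0 with h | h | h
  · have : (fun y => |f y|) =ᶠ[𝓝 x] fun y => -f y := by
      filter_upwards [hf.continuousAt.eventually_lt_const h] with y hy
      exact abs_of_neg hy
    rw [this.fderiv_eq, fderiv_fun_neg, norm_neg]
  · have : IsLocalMin (fun y => |f y|) x := Eventually.of_forall fun y => by simp [h]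
    rw [this.fderiv_eq_zero, norm_zero]
    exact norm_nonneg _
  · have : (fun y => |f y|) =ᶠ[𝓝 x] f := by
      filter_upwards [hf.continuousAt.eventually_const_lt h] with y hy
      exact abs_of_pos hy
    rw [this.fderiv_eq]

theorem norm_fderiv_abs_mul_tent_le {f : Euc n → ℝ} (hf : Continuous f) {R : ℝ≥0}
    (hR : 0 < R) {x : Euc n} (hx : DifferentiableAt ℝ (tent (n := n) R) x) :
    ‖fderiv ℝ (fun y => |f y| * tent R y) x‖ ≤ ‖fderiv ℝ f x‖ + (R : ℝ)⁻¹ * |f x| := by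
  have hnn : 0 ≤ ‖fderiv ℝ f x‖ + (R : ℝ)⁻¹ * |f x| := by positivity
  by_cases h0 : tent R x = 0
  · have : IsLocalMin (fun y => |f y| * tent R y) x := Eventually.of_forall fun y => by
      simpa [h0] using mul_nonneg (abs_nonneg (f y)) (tent_nonneg R y)
    rwa [this.fderiv_eq_zero, norm_zero]
  by_cases hd : DifferentiableAt ℝ (fun y => |f y| * tent R y) x
  · have hfd : DifferentiableAt ℝ (fun y => |f y|) x := by
      refine (hd.mul (hx.fun_inv h0)).congr_of_eventuallyEq ?_
      filter_upwards [(lipschitzWith_tent R).continuous.continuousAt.eventually_ne h0] with y hy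
      exact (mul_inv_cancel_right₀ hy _).symm
    rw [fderiv_fun_mul hfd hx, add_comm]
    refine (norm_add_le _ _).trans (add_le_add ?_ ?_)
    · rw [norm_smul, norm_of_nonneg (tent_nonneg _ _)]
      exact (mul_le_of_le_one_left (norm_nonneg _) (tent_le_one hR x)).trans
        (norm_fderiv_abs_le f hf x)
    · rw [norm_smul, norm_eq_abs, abs_abs, mul_comm]
      refine mul_le_mul_of_nonneg_right ?_ (abs_nonneg _)
      simpa using norm_fderiv_le_of_lipschitz ℝ (lipschitzWith_tent (n := n) R) (x₀ := x)
  · rwa [fderiv_zero_of_not_differentiableAt hd, norm_zero]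

theorem abs_mul_log_le_of_le {s t : ℝ} (h0 : 0 ≤ t) (h : t ≤ s) :
    |t * log t| ≤ 1 + |s * log s| := by
  rcases le_total t 1 with h1 | h1
  · rcases h0.eq_or_lt with rfl | h0
    · simp; positivity
    · have := abs_log_mul_self_lt t h0 h1
      rw [mul_comm]
      linarith [abs_nonneg (s * log s)]
  · have h2 : t * log t ≤ s * log s :=
      mul_le_mul h (log_le_log (by linarith) h) (log_nonneg h1) (by linarith)
    rw [abs_of_nonneg (mul_nonneg h0 (log_nonneg h1))]
    linarith [le_abs_self (s * log s)]

/-- The logarithmic Sobolev inequality for locally Lipschitz functions. -/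
theorem ent_sq_le_of_locallyLipschitz {μ : Measure (Euc n)} [IsProbabilityMeasure μ]
    (hlc : IsLogConcave μ) {β : ℝ} (hβ : 0 < β) (hsts : StronglyTiltStable μ β)
    {f : Euc n → ℝ} (hf : LocallyLipschitz f) (h1 : Integrable (fun x => f x ^ 2) μ)
    (h2 : Integrable (fun x => f x ^ 2 * log (f x ^ 2)) μ)
    (h3 : Integrable (fun x => ‖fderiv ℝ f x‖ ^ 2) μ) :
    ent μ (fun x => f x ^ 2) ≤ 8 * β ^ 2 * ∫ x, ‖fderiv ℝ f x‖ ^ 2 ∂μ := by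
  have hac : μ ≪ volume := by
    obtain ⟨d, -, -, -, hd⟩ := hlc
    rw [hd]; exact withDensity_absolutelyContinuous _ _
  let R : ℕ → ℝ≥0 := fun j => j + 1
  have hR (j) : 0 < R j := by positivity
  have hRinv : Tendsto (fun j => (R j : ℝ)⁻¹) atTop (𝓝 0) := by
    simpa [R] using tendsto_one_div_add_atTop_nhds_zero_nat (𝕜 := ℝ)
  let g : ℕ → Euc n → ℝ := fun j x => |f x| * tent (R j) x
  have hg0 (j x) : 0 ≤ g j x := mul_nonneg (abs_nonneg _) (tent_nonneg _ _)
  have hgf (j x) : g j x ^ 2 ≤ f x ^ 2 := by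
    rw [← sq_abs (f x)]
    exact pow_le_pow_left₀ (hg0 j x)
      (mul_le_of_le_one_right (abs_nonneg _) (tent_le_one (hR j) x)) 2
  have hcs (j) : HasCompactSupport (g j) :=
    HasCompactSupport.intro (isCompact_closedBall (0 : Euc n) (R j)) fun x hx => by
      rw [mem_closedBall_zero_iff, not_le] at hx
      change |f x| * tent (R j) x = 0
      rw [tent_eq_zero (R := (R j : ℝ)) (hR j) hx, mul_zero]
  have key (j : ℕ) : ent μ (fun x => g j x ^ 2) ≤ 8 * β ^ 2 *
      ((1 + (R j : ℝ)⁻¹) * ∫ x, ‖fderiv ℝ f x‖ ^ 2 ∂μ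
        + ((R j : ℝ)⁻¹ ^ 2 + (R j : ℝ)⁻¹) * ∫ x, f x ^ 2 ∂μ) := by
    obtain ⟨C, hC⟩ := exists_lipschitzWith_abs_mul_tent hf (hR j)
    refine (ent_sq_le_of_lipschitzWith hlc hβ hsts hC (hcs j) (hg0 j)).trans
      (mul_le_mul_of_nonneg_left ?_ (by positivity))
    have hi : Integrable (fun x => ‖fderiv ℝ (g j) x‖ ^ 2) μ := by
      refine Integrable.of_bound IsNice.measurable_norm_fderiv_sq.aestronglyMeasurable
        ((C : ℝ) ^ 2) (ae_of_all _ fun x => ?_)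
      rw [norm_pow, norm_norm]
      exact pow_le_pow_left₀ (norm_nonneg _) (norm_fderiv_le_of_lipschitz ℝ hC) 2
    have i1 := h3.const_mul (1 + (R j : ℝ)⁻¹)
    have i2 := h1.const_mul ((R j : ℝ)⁻¹ ^ 2 + (R j : ℝ)⁻¹)
    rw [← integral_const_mul, ← integral_const_mul, ← integral_add i1 i2]
    refine integral_mono_ae hi (i1.add i2) ?_
    filter_upwards [hac.ae_le (lipschitzWith_tent (n := n) (R j)).ae_differentiableAt] with x hx
    change ‖fderiv ℝ (g j) x‖ ^ 2 ≤ (1 + (R j : ℝ)⁻¹) * ‖fderiv ℝ f x‖ ^ 2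
      + ((R j : ℝ)⁻¹ ^ 2 + (R j : ℝ)⁻¹) * f x ^ 2
    have e1 := pow_le_pow_left₀ (norm_nonneg _)
      (norm_fderiv_abs_mul_tent_le hf.continuous (hR j) hx) 2
    refine e1.trans ?_
    rw [← sq_abs (f x)]
    have e2 := mul_nonneg (inv_nonneg.2 (R j).coe_nonneg) (sq_nonneg (‖fderiv ℝ f x‖ - |f x|))
    linarith
  have l1 : Tendsto (fun j : ℕ => ent μ (fun x => g j x ^ 2)) atTop
      (𝓝 (ent μ fun x => f x ^ 2)) := by
    refine tendsto_ent (fun j => ?_) h1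
      ((integrable_const (1 : ℝ)).add h2.abs) (fun j x => ?_) (fun j x => ?_) fun x => ?_
    · exact ((hf.continuous.abs.mul (lipschitzWith_tent (R j)).continuous).pow 2).measurable
    · rw [abs_of_nonneg (sq_nonneg _)]; exact hgf j x
    · exact abs_mul_log_le_of_le (sq_nonneg _) (hgf j x)
    · have h4 : Tendsto (fun j => |f x| * max 0 (1 - (R j : ℝ)⁻¹ * ‖x‖)) atTop
          (𝓝 (|f x| * max 0 (1 - 0 * ‖x‖))) :=
        (tendsto_const_nhds.max ((hRinv.mul_const ‖x‖).const_sub 1)).const_mul _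
      have h5 := h4.pow 2
      simp only [zero_mul, sub_zero, zero_le_one, sup_of_le_right, mul_one, sq_abs] at h5
      exact h5
  have l2 := (((hRinv.const_add 1).mul_const (∫ x, ‖fderiv ℝ f x‖ ^ 2 ∂μ)).add
    (((hRinv.pow 2).add hRinv).mul_const (∫ x, f x ^ 2 ∂μ))).const_mul (8 * β ^ 2)
  have l3 := le_of_tendsto_of_tendsto' l1 l2 key
  simpa using l3

end

/-- A β-strongly tilt-stable log-concave probability measure satisfies a
log-Sobolev inequality with constant `2β`. -/
theorem statement5 {n : ℕ} (μ : Measure (Euc n)) [IsProbabilityMeasure μ]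
    (hlc : IsLogConcave μ) (β : ℝ) (hβ : 0 < β) (hsts : StronglyTiltStable μ β) :
    SatisfiesLSI μ (2 * β) := by
  intro f hf h1 h2 h3
  have h := ent_sq_le_of_locallyLipschitz hlc hβ hsts hf h1 h2 h3
  rwa [show 2 * (2 * β) ^ 2 = 8 * β ^ 2 by ring]

end
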